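/- Let Ω ⊂ ℝⁿ be open, and let (u_k) be a sequence of weakly super-1-harmonic functions on Ω. Suppose u_k converges to u locally weakly* both in BV_loc(Ω) and in L^∞_loc(Ω), and u_k ≤ u holds Lebesgue-a.e. on Ω for all k. Then u is weakly super-1-harmonic on Ω. -/

import Mathlib

open MeasureTheory Set Filter Topology Metric
open scoped RealInnerProductSpace ENNReal

noncomputable section

/-- Euclidean space `ℝⁿ`. -/
abbrev Eu (n : ℕ) : Type := EuclideanSpace ℝ (Fin n)

/-- `(n-1)`-dimensional Hausdorff measure on `ℝⁿ`. -/
def hm (n : ℕ) : Measure (Eu n) := μH[(n : ℝ) - 1]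

/-- Smooth test functions compactly supported in `Ω`. -/
def IsTest {n : ℕ} (Ω : Set (Eu n)) (φ : Eu n → ℝ) : Prop :=
  ContDiff ℝ (⊤ : ℕ∞) φ ∧ HasCompactSupport φ ∧ tsupport φ ⊆ Ω

/-- `σ ∈ L^∞(Ω, ℝⁿ)` with `‖σ‖ ≤ C` a.e. on `Ω`. -/
def Bdd {n : ℕ} (Ω : Set (Eu n)) (σ : Eu n → Eu n) (C : ℝ) : Prop :=
  AEStronglyMeasurable σ (volume.restrict Ω) ∧ ∀ᵐ x ∂(volume.restrict Ω), ‖σ x‖ ≤ C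

/-- `σ ∈ L^∞_loc(Ω, ℝⁿ)`. -/
def LocBdd {n : ℕ} (Ω : Set (Eu n)) (σ : Eu n → Eu n) : Prop :=
  AEStronglyMeasurable σ (volume.restrict Ω) ∧
  ∀ K : Set (Eu n), K ⊆ Ω → IsCompact K → ∃ C : ℝ, ∀ᵐ x ∂(volume.restrict K), ‖σ x‖ ≤ C

/-- scalar `u ∈ L^∞_loc(Ω)`. -/
def LocBddFun {n : ℕ} (Ω : Set (Eu n)) (u : Eu n → ℝ) : Prop :=
  AEStronglyMeasurable u (volume.restrict Ω) ∧
  ∀ K : Set (Eu n), K ⊆ Ω → IsCompact K → ∃ C : ℝ, ∀ᵐ x ∂(volume.restrict K), |u x| ≤ C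

/-- scalar `u ∈ L^∞(Ω)` with bound `C`. -/
def BddFun {n : ℕ} (Ω : Set (Eu n)) (u : Eu n → ℝ) (C : ℝ) : Prop :=
  AEStronglyMeasurable u (volume.restrict Ω) ∧ ∀ᵐ x ∂(volume.restrict Ω), |u x| ≤ C

/-- A measure carried by `Ω` which is finite on compact subsets of `Ω` (Radon on `Ω`). -/
def LocFinOn {n : ℕ} (Ω : Set (Eu n)) (μ : Measure (Eu n)) : Prop :=
  (∀ K : Set (Eu n), K ⊆ Ω → IsCompact K → μ K < ⊤) ∧ μ Ωᶜ = 0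

/-- A finite measure carried by `Ω`. -/
def FinOn {n : ℕ} (Ω : Set (Eu n)) (μ : Measure (Eu n)) : Prop :=
  μ univ < ⊤ ∧ μ Ωᶜ = 0

/-- The (signed) measure `μp - μn` represents `-Div σ` on `Ω`: for every test function `φ`
compactly supported in `Ω` one has `∫_Ω σ·∇φ dx = ∫ φ dμp - ∫ φ dμn`. -/
def RepNegDiv {n : ℕ} (Ω : Set (Eu n)) (σ : Eu n → Eu n) (μp μn : Measure (Eu n)) : Prop :=
  ∀ φ : Eu n → ℝ, IsTest Ω φ →
    ∫ x in Ω, ⟪σ x, gradient φ x⟫ = (∫ x, φ x ∂μp) - ∫ x, φ x ∂μn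

/-- `Div σ ≤ 0` in the sense of distributions on `Ω`. -/
def DivNonpos {n : ℕ} (Ω : Set (Eu n)) (σ : Eu n → Eu n) : Prop :=
  ∀ φ : Eu n → ℝ, IsTest Ω φ → (∀ x, 0 ≤ φ x) → 0 ≤ ∫ x in Ω, ⟪σ x, gradient φ x⟫

/-- The set `A` has Lebesgue density zero at the point `x`. -/
def DensityZeroAt {n : ℕ} (A : Set (Eu n)) (x : Eu n) : Prop :=
  Tendsto (fun r : ℝ => volume (A ∩ ball x r) / volume (ball x r)) (𝓝[>] 0) (𝓝 0)

/-- The upper (approximate) representative `u⁺`: Lebesgue value at approximate continuity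
points, larger jump value at approximate jump points. -/
def upperRep {n : ℕ} (u : Eu n → ℝ) (x : Eu n) : ℝ :=
  sInf {t : ℝ | DensityZeroAt {y | t < u y} x}

/-- The lower (approximate) representative `u⁻`. -/
def lowerRep {n : ℕ} (u : Eu n → ℝ) (x : Eu n) : ℝ :=
  sSup {t : ℝ | DensityZeroAt {y | u y < t} x}

/-- The precise (mean-value) representative `u* = (u⁺ + u⁻)/2`. -/
def preciseRep {n : ℕ} (u : Eu n → ℝ) (x : Eu n) : ℝ := (upperRep u x + lowerRep u x) / 2

/-- `Du = θ·ν` is the gradient measure of `u` on `Ω` with total variation `ν` and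
polar vector `θ` (so `ν = |Du|`). -/
def HasGradMeasure {n : ℕ} (Ω : Set (Eu n)) (u : Eu n → ℝ) (ν : Measure (Eu n))
    (θ : Eu n → Eu n) : Prop :=
  (∀ᵐ x ∂ν, ‖θ x‖ = 1) ∧ ν Ωᶜ = 0 ∧
  ∀ φ : Eu n → ℝ, IsTest Ω φ → ∫ x in Ω, u x • gradient φ x = - ∫ x, φ x • θ x ∂ν

/-- `u ∈ BV_loc(Ω)`. -/
def MemBVLoc {n : ℕ} (Ω : Set (Eu n)) (u : Eu n → ℝ) : Prop :=
  LocallyIntegrableOn u Ω ∧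
  ∃ ν θ, LocFinOn Ω ν ∧ HasGradMeasure Ω u ν θ

/-- `g` is the weak (Sobolev) gradient of `u ∈ W^{1,1}(Ω)`. -/
def HasSobGrad {n : ℕ} (Ω : Set (Eu n)) (u : Eu n → ℝ) (g : Eu n → Eu n) : Prop :=
  IntegrableOn g Ω ∧
  ∀ φ : Eu n → ℝ, IsTest Ω φ → ∫ x in Ω, u x • gradient φ x = - ∫ x in Ω, φ x • g x

/-- `u ∈ W^{1,1}(Ω)`. -/
def MemW11 {n : ℕ} (Ω : Set (Eu n)) (u : Eu n → ℝ) : Prop :=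
  IntegrableOn u Ω ∧ ∃ g, HasSobGrad Ω u g

/-- `u ∈ W^{1,1}_loc(Ω)` with weak gradient `g`. -/
def HasSobGradLoc {n : ℕ} (Ω : Set (Eu n)) (u : Eu n → ℝ) (g : Eu n → Eu n) : Prop :=
  LocallyIntegrableOn g Ω ∧
  ∀ φ : Eu n → ℝ, IsTest Ω φ → ∫ x in Ω, u x • gradient φ x = - ∫ x in Ω, φ x • g x

def MemW11Loc {n : ℕ} (Ω : Set (Eu n)) (u : Eu n → ℝ) : Prop :=
  LocallyIntegrableOn u Ω ∧ ∃ g, HasSobGradLoc Ω u g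

/-- `T` is the interior trace of `u` on `∂Ω`, characterized `H^{n-1}`-a.e. on `∂Ω`
by convergence of interior mean values. -/
def IsIntTrace {n : ℕ} (Ω : Set (Eu n)) (u T : Eu n → ℝ) : Prop :=
  ∀ᵐ x ∂((hm n).restrict (frontier Ω)),
    Tendsto (fun r : ℝ => (∫ y in Ω ∩ ball x r, |u y - T x|) / (volume (ball x r)).toReal)
      (𝓝[>] 0) (𝓝 0)

/-- The domain assumption `H^{n-1}(∂Ω) = P(Ω) < ∞`, in the equivalent form
`𝟙_Ω ∈ BV(ℝⁿ)` with `|D𝟙_Ω| = H^{n-1}⌞∂Ω`. -/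
def DomainAssum {n : ℕ} (Ω : Set (Eu n)) : Prop :=
  hm n (frontier Ω) < ⊤ ∧
  ∃ θ, HasGradMeasure (univ : Set (Eu n)) (Ω.indicator fun _ => (1 : ℝ))
    ((hm n).restrict (frontier Ω)) θ

/-- `g` is the normal trace `σ_n*` of `σ` on `∂Ω`, characterized by the Gauss–Green
formula for `W^{1,1} ∩ L^∞` functions; here `μ = -Div σ ≥ 0`. -/
def IsNormalTrace {n : ℕ} (Ω : Set (Eu n)) (σ : Eu n → Eu n) (μ : Measure (Eu n))
    (g : Eu n → ℝ) : Prop :=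
  ∀ (v : Eu n → ℝ) (gv : Eu n → Eu n) (T : Eu n → ℝ),
    MemW11 Ω v → (∃ C, BddFun Ω v C) → HasSobGrad Ω v gv → IsIntTrace Ω v T →
    ∀ φ : Eu n → ℝ, IsTest (univ : Set (Eu n)) φ →
      (- ∫ x in Ω, v x * ⟪σ x, gradient φ x⟫) + (∫ x, φ x * preciseRep v x ∂μ)
        = (∫ x in Ω, φ x * ⟪σ x, gv x⟫) + ∫ x in frontier Ω, φ x * T x * g x ∂(hm n)

/-- Weakly super-1-harmonic: there is `σ ∈ L^∞` with `|σ| ≤ 1` a.e., `Div σ ≤ 0`,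
and `⟨σ, Du⁺⟩ = |Du|` as measures on `Ω`. -/
def SuperOneHarmonic {n : ℕ} (Ω : Set (Eu n)) (u : Eu n → ℝ) : Prop :=
  MemBVLoc Ω u ∧ LocBddFun Ω u ∧
  ∃ σ : Eu n → Eu n, ∃ μ : Measure (Eu n),
    Bdd Ω σ 1 ∧ DivNonpos Ω σ ∧ RepNegDiv Ω σ μ 0 ∧ LocFinOn Ω μ ∧
    ∃ ν θ, LocFinOn Ω ν ∧ HasGradMeasure Ω u ν θ ∧
      ∀ φ : Eu n → ℝ, IsTest Ω φ →
        (- ∫ x in Ω, u x * ⟪σ x, gradient φ x⟫) + (∫ x, φ x * upperRep u x ∂μ)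
          = ∫ x, φ x ∂ν

section TestFunctions

variable {n : ℕ} {U V : Set (Eu n)} {φ ψ : Eu n → ℝ}

lemma IsTest.contDiff (h : IsTest U φ) : ContDiff ℝ (⊤ : ℕ∞) φ := h.1

lemma IsTest.hasCompactSupport (h : IsTest U φ) : HasCompactSupport φ := h.2.1

lemma IsTest.continuous (h : IsTest U φ) : Continuous φ := h.1.continuous

lemma IsTest.differentiable (h : IsTest U φ) : Differentiable ℝ φ :=
  h.1.differentiable (by simp)

lemma IsTest.continuous_fderiv (h : IsTest U φ) : Continuous (fderiv ℝ φ) :=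
  h.1.continuous_fderiv (by simp)

lemma IsTest.mono (h : IsTest U φ) (hUV : U ⊆ V) : IsTest V φ :=
  ⟨h.1, h.2.1, h.2.2.trans hUV⟩

lemma IsTest.mul_contDiff (h : IsTest U φ) (hψ : ContDiff ℝ (⊤ : ℕ∞) ψ) :
    IsTest U (fun x => φ x * ψ x) :=
  ⟨h.1.mul hψ, h.2.1.mul_right, (tsupport_mul_subset_left).trans h.2.2⟩

lemma IsTest.const_mul (h : IsTest U φ) (c : ℝ) : IsTest U (fun x => c * φ x) := by
  simpa [mul_comm] using h.mul_contDiff (ψ := fun _ => c) contDiff_const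

lemma IsTest.add (h : IsTest U φ) (h' : IsTest U ψ) : IsTest U (fun x => φ x + ψ x) :=
  ⟨h.1.add h'.1, h.2.1.add h'.2.1,
    (tsupport_add φ ψ).trans (union_subset h.2.2 h'.2.2)⟩

lemma IsTest.zero_of_notMem (h : IsTest U φ) {x : Eu n} (hx : x ∉ U) : φ x = 0 :=
  image_eq_zero_of_notMem_tsupport fun hx' => hx (h.2.2 hx')

lemma IsTest.fderiv_zero_of_notMem (h : IsTest U φ) {x : Eu n} (hx : x ∉ U) :
    fderiv ℝ φ x = 0 := by
  by_contra hne
  exact hx (h.2.2 (support_fderiv_subset ℝ hne))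

lemma IsTest.exists_bound (h : IsTest U φ) : ∃ C : ℝ, 0 ≤ C ∧ ∀ x, |φ x| ≤ C := by
  obtain ⟨C, hC⟩ := h.hasCompactSupport.exists_bound_of_continuous h.continuous
  exact ⟨max C 0, le_max_right _ _, fun x => (hC x).trans (le_max_left _ _)⟩

lemma IsTest.exists_bound_fderiv (h : IsTest U φ) :
    ∃ C : ℝ, 0 ≤ C ∧ ∀ x, ‖fderiv ℝ φ x‖ ≤ C := by
  obtain ⟨C, hC⟩ := (h.hasCompactSupport.fderiv ℝ).exists_bound_of_continuous h.continuous_fderiv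
  exact ⟨max C 0, le_max_right _ _, fun x => (hC x).trans (le_max_left _ _)⟩

lemma IsTest.integrable (h : IsTest U φ) (μ : Measure (Eu n)) [IsFiniteMeasureOnCompacts μ] :
    Integrable φ μ := h.continuous.integrable_of_hasCompactSupport h.hasCompactSupport

lemma IsTest.integrable_fderiv (h : IsTest U φ) : Integrable (fderiv ℝ φ) :=
  h.continuous_fderiv.integrable_of_hasCompactSupport (h.hasCompactSupport.fderiv ℝ)

lemma IsTest.fderiv_apply (h : IsTest U φ) (e : Eu n) : IsTest U (fun x => fderiv ℝ φ x e) :=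
  ⟨(h.1.fderiv_right (m := (⊤ : ℕ∞)) (by simp)).clm_apply contDiff_const,
    h.2.1.fderiv_apply ℝ e, (tsupport_fderiv_apply_subset ℝ e).trans h.2.2⟩

lemma exists_isTest_one_nhdsSet {K : Set (Eu n)} (hK : IsCompact K) (hU : IsOpen U)
    (hKU : K ⊆ U) :
    ∃ η : Eu n → ℝ, IsTest U η ∧ (∀ x, η x ∈ Icc (0 : ℝ) 1) ∧ ∃ W, IsOpen W ∧ K ⊆ W ∧
      ∀ x ∈ W, η x = 1 := by
  obtain ⟨L, hL, hKL, hLU⟩ := exists_compact_between hK hU hKU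
  obtain ⟨f, h1, h0, hf⟩ := exists_contMDiffMap_one_nhds_of_subset_interior
    (modelWithCornersSelf ℝ (Eu n)) (n := (⊤ : ℕ∞)) hK.isClosed hKL
  have hsupp : Function.support f ⊆ L := fun x hx => by
    by_contra hxL
    exact hx (h0 x hxL)
  have hts : tsupport f ⊆ L := closure_minimal hsupp hL.isClosed
  obtain ⟨W, hW, hKW, h⟩ := mem_nhdsSet_iff_exists.1 h1
  exact ⟨f, ⟨f.contMDiff.contDiff, hL.of_isClosed_subset (isClosed_tsupport _) hts,
    hts.trans hLU⟩, hf, W, hW, hKW, h⟩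

lemma exists_isTest_one {K : Set (Eu n)} (hK : IsCompact K) (hU : IsOpen U)
    (hKU : K ⊆ U) :
    ∃ η : Eu n → ℝ, IsTest U η ∧ (∀ x, η x ∈ Icc (0 : ℝ) 1) ∧ ∀ x ∈ K, η x = 1 := by
  obtain ⟨η, h1, h2, W, _, h3, h4⟩ := exists_isTest_one_nhdsSet hK hU hKU
  exact ⟨η, h1, h2, fun x hx => h4 x (h3 hx)⟩

/-- A nonnegative radially decreasing cutoff function, scaled to the ball of radius `r`. -/
def radialCutoff (n : ℕ) (x : Eu n) (r : ℝ) (y : Eu n) : ℝ :=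
  Real.smoothTransition (2 - ‖r⁻¹ • (y - x)‖ ^ 2)

lemma radialCutoff_nonneg (x : Eu n) (r : ℝ) (y : Eu n) : 0 ≤ radialCutoff n x r y :=
  Real.smoothTransition.nonneg _

lemma radialCutoff_le_one (x : Eu n) (r : ℝ) (y : Eu n) : radialCutoff n x r y ≤ 1 :=
  Real.smoothTransition.le_one _

lemma radialCutoff_eq_one {x : Eu n} {r : ℝ} (hr : 0 < r) {y : Eu n}
    (hy : y ∈ closedBall x r) : radialCutoff n x r y = 1 := by
  apply Real.smoothTransition.one_of_one_le
  rw [norm_smul, norm_inv, Real.norm_of_nonneg hr.le]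
  rw [mem_closedBall, dist_eq_norm] at hy
  have : r⁻¹ * ‖y - x‖ ≤ 1 := by rw [inv_mul_le_iff₀ hr]; simpa using hy
  have h0 : 0 ≤ r⁻¹ * ‖y - x‖ := by positivity
  nlinarith

lemma radialCutoff_eq_zero {x : Eu n} {r : ℝ} (hr : 0 < r) {y : Eu n}
    (hy : y ∉ closedBall x (2 * r)) : radialCutoff n x r y = 0 := by
  apply Real.smoothTransition.zero_of_nonpos
  rw [norm_smul, norm_inv, Real.norm_of_nonneg hr.le]
  rw [mem_closedBall, dist_eq_norm, not_le] at hy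
  have : 2 ≤ r⁻¹ * ‖y - x‖ := by rw [le_inv_mul_iff₀ hr]; linarith
  nlinarith

lemma radialCutoff_anti {x : Eu n} {r : ℝ} {y z : Eu n} (h : ‖y - x‖ ≤ ‖z - x‖) :
    radialCutoff n x r z ≤ radialCutoff n x r y := by
  apply Real.smoothTransition.monotone
  rw [norm_smul, norm_smul]
  gcongr

lemma isTest_radialCutoff {x : Eu n} {r : ℝ} (hr : 0 < r) (hU : closedBall x (2 * r) ⊆ U) :
    IsTest U (radialCutoff n x r) := by
  have hts : tsupport (radialCutoff n x r) ⊆ closedBall x (2 * r) :=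
    closure_minimal (fun y hy => by
      by_contra h
      exact hy (radialCutoff_eq_zero hr h)) isClosed_closedBall
  refine ⟨?_, (isCompact_closedBall _ _).of_isClosed_subset (isClosed_tsupport _) hts,
    hts.trans hU⟩
  have h1 : ContDiff ℝ (⊤ : ℕ∞) (fun y : Eu n => r⁻¹ • (y - x)) :=
    (contDiff_id.sub contDiff_const).const_smul r⁻¹
  have h2 : ContDiff ℝ (⊤ : ℕ∞) (fun y : Eu n => 2 - ‖r⁻¹ • (y - x)‖ ^ 2) :=
    contDiff_const.sub (h1.norm_sq ℝ)
  have h3 : ContDiff ℝ (⊤ : ℕ∞) Real.smoothTransition := Real.smoothTransition.contDiff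
  exact h3.comp h2

lemma exists_bound_fderiv_radialCutoff (n : ℕ) :
    ∃ C : ℝ, 1 ≤ C ∧ ∀ (x : Eu n) (r : ℝ), 0 < r → ∀ y,
      ‖fderiv ℝ (radialCutoff n x r) y‖ ≤ C / r := by
  have h0 : IsTest univ (radialCutoff n 0 1) := isTest_radialCutoff one_pos (subset_univ _)
  obtain ⟨C, -, hC⟩ := h0.exists_bound_fderiv
  refine ⟨max C 1, le_max_right _ _, fun x r hr y => ?_⟩
  have heq : radialCutoff n x r = fun y => radialCutoff n 0 1 (r⁻¹ • (y - x)) := by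
    funext y
    simp [radialCutoff]
  have hd : HasFDerivAt (fun y => radialCutoff n 0 1 (r⁻¹ • (y - x)))
      ((fderiv ℝ (radialCutoff n 0 1) (r⁻¹ • (y - x))).comp
        (r⁻¹ • ContinuousLinearMap.id ℝ (Eu n))) y :=
    (h0.differentiable _).hasFDerivAt.comp y (((hasFDerivAt_id y).sub_const x).const_smul r⁻¹)
  rw [heq, hd.fderiv]
  refine (ContinuousLinearMap.opNorm_comp_le _ _).trans ?_
  have h2 : ‖r⁻¹ • ContinuousLinearMap.id ℝ (Eu n)‖ ≤ r⁻¹ := by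
    rw [norm_smul, norm_inv, Real.norm_of_nonneg hr.le]
    exact mul_le_of_le_one_right (by positivity) ContinuousLinearMap.norm_id_le
  rw [div_eq_mul_inv]
  exact mul_le_mul ((hC _).trans (le_max_left _ _)) h2 (norm_nonneg _)
    (zero_le_one.trans (le_max_right _ _))

/-- Superlevel sets of the radial cutoff are closed balls. -/
lemma exists_superlevel_radialCutoff {x : Eu n} {r τ : ℝ} (hr : 0 < r) (hτ : 0 < τ) (hτ1 : τ ≤ 1) :
    ∃ ρ : ℝ, {y | τ ≤ radialCutoff n x r y} = closedBall x ρ ∧ r ≤ ρ ∧ ρ ≤ 2 * r := by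
  have h0 : IsTest univ (radialCutoff n x r) := isTest_radialCutoff hr (subset_univ _)
  set S := {y | τ ≤ radialCutoff n x r y}
  have hsub : S ⊆ closedBall x (2 * r) := fun y hy => by
    by_contra h
    have := radialCutoff_eq_zero hr h
    simp only [S, mem_ofPred_eq] at hy
    linarith
  have hS : IsCompact S := (isCompact_closedBall x (2 * r)).of_isClosed_subset
    (isClosed_le continuous_const h0.continuous) hsub
  have hne : S.Nonempty := ⟨x, by
    simp only [S, mem_ofPred_eq]
    rw [radialCutoff_eq_one hr (mem_closedBall_self hr.le)]; exact hτ1⟩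
  obtain ⟨z, hz, hmax⟩ := hS.exists_isMaxOn hne
    (f := fun y => ‖y - x‖) (by fun_prop)
  have hz2 : ‖z - x‖ ≤ 2 * r := by
    have := hsub hz
    rwa [mem_closedBall, dist_eq_norm] at this
  have key : ∀ y, τ ≤ radialCutoff n x r y ↔ ‖y - x‖ ≤ ‖z - x‖ :=
    fun y => ⟨fun hy => hmax (show y ∈ S from hy), fun hy => le_trans hz (radialCutoff_anti hy)⟩
  by_cases hzr : r ≤ ‖z - x‖
  · refine ⟨‖z - x‖, ?_, hzr, hz2⟩
    ext y
    rw [mem_closedBall, dist_eq_norm]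
    exact key y
  · refine ⟨r, ?_, le_rfl, by linarith⟩
    ext y
    rw [mem_closedBall, dist_eq_norm]
    refine ⟨fun hy => ((key y).1 hy).trans (not_le.1 hzr).le, fun hy => ?_⟩
    change τ ≤ radialCutoff n x r y
    rwa [radialCutoff_eq_one hr (by rwa [mem_closedBall, dist_eq_norm])]

end TestFunctions

section Mollification

variable {n : ℕ}

/-- The distributional gradient of the bounded function `f` on `U` is the finite measure `θ ν`. -/
structure GradOn (U : Set (Eu n)) (f : Eu n → ℝ) (ν : Measure (Eu n)) (θ : Eu n → Eu n) :
    Prop where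
  isOpen : IsOpen U
  meas : Measurable f
  bdd : ∃ M, ∀ x, |f x| ≤ M
  fin : IsFiniteMeasure ν
  null : ν Uᶜ = 0
  meas_dir : Measurable θ
  norm_dir : ∀ᵐ x ∂ν, ‖θ x‖ = 1
  ibp : ∀ φ : Eu n → ℝ, IsTest U φ → ∀ e : Eu n,
    ∫ y, f y * fderiv ℝ φ y e = - ∫ y, φ y * ⟪θ y, e⟫ ∂ν

/-- The field `σ` is bounded by one and `-Div σ` is the finite measure `μ` on `U`. -/
structure DivOn (U : Set (Eu n)) (σ : Eu n → Eu n) (μ : Measure (Eu n)) : Prop where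
  isOpen : IsOpen U
  meas : Measurable σ
  norm_le : ∀ x, ‖σ x‖ ≤ 1
  fin : IsFiniteMeasure μ
  null : μ Uᶜ = 0
  ibp : ∀ φ : Eu n → ℝ, IsTest U φ → ∫ y, fderiv ℝ φ y (σ y) = ∫ y, φ y ∂μ

/-- Mollification of `f` by the normalized bump function `b`. -/
def mol (b : ContDiffBump (0 : Eu n)) (f : Eu n → ℝ) (y : Eu n) : ℝ :=
  ∫ z, b.normed volume (y - z) * f z

lemma mol_eq_convolution (b : ContDiffBump (0 : Eu n)) (f : Eu n → ℝ) :
    mol b f = convolution (b.normed volume) f (ContinuousLinearMap.lsmul ℝ ℝ) volume := by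
  funext y
  rw [convolution_eq_swap]
  rfl

lemma locallyIntegrable_of_bdd {f : Eu n → ℝ} (hf : Measurable f) (hb : ∃ M, ∀ x, |f x| ≤ M) :
    LocallyIntegrable f := by
  obtain ⟨M, hM⟩ := hb
  intro x
  refine ⟨ball x 1, ball_mem_nhds x one_pos, ?_⟩
  exact Measure.integrableOn_of_bounded (M := M) measure_ball_lt_top.ne
    hf.aestronglyMeasurable (Eventually.of_forall hM)

lemma contDiff_normed' (b : ContDiffBump (0 : Eu n)) : ContDiff ℝ (⊤ : ℕ∞) (b.normed volume) :=
  b.contDiff_normed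

lemma contDiff_mol (b : ContDiffBump (0 : Eu n)) {f : Eu n → ℝ} (hf : LocallyIntegrable f) :
    ContDiff ℝ (⊤ : ℕ∞) (mol b f) := by
  rw [mol_eq_convolution]
  exact HasCompactSupport.contDiff_convolution_left _ b.hasCompactSupport_normed
    b.contDiff_normed hf

lemma integrable_mol_kernel (b : ContDiffBump (0 : Eu n)) (y : Eu n) :
    Integrable (fun z => b.normed volume (y - z)) :=
  b.integrable_normed.comp_sub_left y

lemma integral_mol_kernel (b : ContDiffBump (0 : Eu n)) (y : Eu n) :
    ∫ z, b.normed volume (y - z) = 1 := by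
  rw [integral_sub_left_eq_self (b.normed volume) volume y]
  exact b.integral_normed

lemma mol_kernel_eq_zero (b : ContDiffBump (0 : Eu n)) {y z : Eu n} (h : b.rOut ≤ dist y z) :
    b.normed volume (y - z) = 0 := by
  rw [← Function.notMem_support, b.support_normed_eq, mem_ball_zero_iff, not_lt,
    ← dist_eq_norm]
  exact h

lemma integrable_mol_integrand (b : ContDiffBump (0 : Eu n)) {f : Eu n → ℝ} (hf : Measurable f)
    (hb : ∃ M, ∀ x, |f x| ≤ M) (y : Eu n) :
    Integrable (fun z => b.normed volume (y - z) * f z) := by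
  obtain ⟨M, hM⟩ := hb
  exact (integrable_mol_kernel b y).mul_bdd hf.aestronglyMeasurable (Eventually.of_forall hM)

lemma mol_const (b : ContDiffBump (0 : Eu n)) (c : ℝ) (y : Eu n) : mol b (fun _ => c) y = c := by
  simp only [mol]
  rw [integral_mul_const, integral_mol_kernel, one_mul]

lemma mol_mono (b : ContDiffBump (0 : Eu n)) {f g : Eu n → ℝ} {y : Eu n}
    (hfi : Integrable (fun z => b.normed volume (y - z) * f z))
    (hgi : Integrable (fun z => b.normed volume (y - z) * g z)) (h : ∀ x, f x ≤ g x) :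
    mol b f y ≤ mol b g y :=
  integral_mono hfi hgi fun z => mul_le_mul_of_nonneg_left (h z) (b.nonneg_normed _)

lemma mol_le (b : ContDiffBump (0 : Eu n)) {f : Eu n → ℝ} (hf : Measurable f)
    (hb : ∃ M, ∀ x, |f x| ≤ M) {M : ℝ} (h : ∀ x, f x ≤ M) (y : Eu n) : mol b f y ≤ M := by
  rw [← mol_const b M y]
  exact mol_mono b (integrable_mol_integrand b hf hb y)
    ((integrable_mol_kernel b y).mul_const M) h

lemma le_mol (b : ContDiffBump (0 : Eu n)) {f : Eu n → ℝ} (hf : Measurable f)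
    (hb : ∃ M, ∀ x, |f x| ≤ M) {M : ℝ} (h : ∀ x, M ≤ f x) (y : Eu n) : M ≤ mol b f y := by
  rw [← mol_const b M y]
  exact mol_mono b ((integrable_mol_kernel b y).mul_const M)
    (integrable_mol_integrand b hf hb y) h

lemma fderiv_mol_apply (b : ContDiffBump (0 : Eu n)) {f : Eu n → ℝ} (hf : LocallyIntegrable f)
    (y e : Eu n) :
    fderiv ℝ (mol b f) y e = ∫ z, fderiv ℝ (b.normed volume) (y - z) e * f z := by
  have h := HasCompactSupport.hasFDerivAt_convolution_left (ContinuousLinearMap.lsmul ℝ ℝ)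
    (μ := volume) (b.hasCompactSupport_normed (μ := volume))
    (b.contDiff_normed (μ := volume) (n := 1)) hf y
  rw [mol_eq_convolution, h.fderiv, convolution_eq_swap]
  have hce := HasCompactSupport.convolutionExists_left
    ((ContinuousLinearMap.lsmul ℝ ℝ).precompL (Eu n)) (μ := volume)
    ((b.hasCompactSupport_normed (μ := volume)).fderiv ℝ)
    ((b.contDiff_normed (μ := volume) (n := 1)).continuous_fderiv (by simp)) hf y
  have hInt := hce.integrable_swap
  rw [ContinuousLinearMap.integral_apply hInt]
  rfl

lemma isTest_mol_kernel (b : ContDiffBump (0 : Eu n)) (y : Eu n) {U : Set (Eu n)}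
    (hU : closedBall y b.rOut ⊆ U) : IsTest U (fun z => b.normed volume (y - z)) := by
  have hts : tsupport (fun z => b.normed volume (y - z)) ⊆ closedBall y b.rOut :=
    closure_minimal (fun z hz => by
      by_contra h
      rw [mem_closedBall, not_le, dist_comm] at h
      exact hz (mol_kernel_eq_zero b h.le)) isClosed_closedBall
  refine ⟨(contDiff_normed' b).comp (contDiff_const.sub contDiff_id), ?_, hts.trans hU⟩
  exact (isCompact_closedBall _ _).of_isClosed_subset (isClosed_tsupport _) hts

lemma fderiv_mol_kernel (b : ContDiffBump (0 : Eu n)) (y z e : Eu n) :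
    fderiv ℝ (fun z => b.normed volume (y - z)) z e = - fderiv ℝ (b.normed volume) (y - z) e := by
  have hd : HasFDerivAt (fun z => b.normed volume (y - z))
      ((fderiv ℝ (b.normed volume) (y - z)).comp (-ContinuousLinearMap.id ℝ (Eu n))) z :=
    (((contDiff_normed' b).differentiable (by simp)) _).hasFDerivAt.comp z
      ((hasFDerivAt_id z).const_sub y)
  rw [hd.fderiv]
  simp

variable {U : Set (Eu n)} {f : Eu n → ℝ} {ν : Measure (Eu n)} {θ : Eu n → Eu n}

lemma GradOn.locallyIntegrable (h : GradOn U f ν θ) : LocallyIntegrable f :=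
  locallyIntegrable_of_bdd h.meas h.bdd

lemma GradOn.fderiv_mol (h : GradOn U f ν θ) (b : ContDiffBump (0 : Eu n)) {y : Eu n}
    (hy : closedBall y b.rOut ⊆ U) (e : Eu n) :
    fderiv ℝ (mol b f) y e = ∫ z, b.normed volume (y - z) * ⟪θ z, e⟫ ∂ν := by
  rw [fderiv_mol_apply b h.locallyIntegrable]
  have := h.ibp _ (isTest_mol_kernel b y hy) e
  simp only [fderiv_mol_kernel] at this
  rw [← neg_inj, ← this, ← integral_neg]
  congr 1
  funext z
  ring

lemma GradOn.norm_fderiv_mol_le (h : GradOn U f ν θ) (b : ContDiffBump (0 : Eu n)) {y : Eu n}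
    (hy : closedBall y b.rOut ⊆ U) :
    ‖fderiv ℝ (mol b f) y‖ ≤ ∫ z, b.normed volume (y - z) ∂ν := by
  have := h.fin
  have hInt : Integrable (fun z => b.normed volume (y - z)) ν :=
    (isTest_mol_kernel b y hy).integrable ν
  refine ContinuousLinearMap.opNorm_le_bound _
    (integral_nonneg fun z => b.nonneg_normed _) fun e => ?_
  rw [h.fderiv_mol b hy, ← integral_mul_const]
  refine norm_integral_le_of_norm_le (hInt.mul_const _) ?_
  filter_upwards [h.norm_dir] with z hz
  rw [norm_mul, Real.norm_of_nonneg (b.nonneg_normed _)]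
  gcongr
  · exact b.nonneg_normed _
  · exact (norm_inner_le_norm _ _).trans (by rw [hz, one_mul])

/-- A sequence of bump functions with radii tending to zero. -/
def bumpSeq (n : ℕ) (j : ℕ) : ContDiffBump (0 : Eu n) where
  rIn := 1 / (2 * (j + 1))
  rOut := 1 / (j + 1)
  rIn_pos := by positivity
  rIn_lt_rOut := by
    apply one_div_lt_one_div_of_lt <;> linarith [Nat.cast_nonneg (α := ℝ) j]

lemma bumpSeq_rOut (n j : ℕ) : (bumpSeq n j).rOut = 1 / ((j : ℝ) + 1) := rfl

lemma bumpSeq_rIn (n j : ℕ) : (bumpSeq n j).rIn = 1 / (2 * ((j : ℝ) + 1)) := rfl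

lemma tendsto_bumpSeq_rOut (n : ℕ) : Tendsto (fun j => (bumpSeq n j).rOut) atTop (𝓝 0) :=
  tendsto_one_div_add_atTop_nhds_zero_nat

lemma ae_tendsto_mol (hf : LocallyIntegrable f) :
    ∀ᵐ x : Eu n, Tendsto (fun j => mol (bumpSeq n j) f x) atTop (𝓝 (f x)) := by
  have := ContDiffBump.ae_convolution_tendsto_right_of_locallyIntegrable (μ := volume)
    (φ := fun j => bumpSeq n j) (l := atTop) (K := 2) (tendsto_bumpSeq_rOut n)
    (Eventually.of_forall fun j => by
      rw [bumpSeq_rOut, bumpSeq_rIn]; field_simp; exact le_rfl) hf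
  filter_upwards [this] with x hx
  simpa only [mol_eq_convolution] using hx

end Mollification

section Isoperimetric

variable {n : ℕ} {U : Set (Eu n)} {f : Eu n → ℝ} {ν : Measure (Eu n)} {θ : Eu n → Eu n}

lemma lintegral_mol_kernel (b : ContDiffBump (0 : Eu n)) (z : Eu n) :
    ∫⁻ y, ENNReal.ofReal (b.normed volume (y - z)) = 1 := by
  rw [← ofReal_integral_eq_lintegral_ofReal (b.integrable_normed.comp_sub_right z)
    (Eventually.of_forall fun y => b.nonneg_normed _),
    integral_sub_right_eq_self (b.normed volume) z, b.integral_normed, ENNReal.ofReal_one]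

lemma continuous_normed' (b : ContDiffBump (0 : Eu n)) : Continuous (b.normed volume) :=
  (contDiff_normed' b).continuous

lemma measurable_mol_kernel (b : ContDiffBump (0 : Eu n)) :
    Measurable (fun p : Eu n × Eu n => ENNReal.ofReal (b.normed volume (p.1 - p.2))) := by
  have h1 : Continuous (fun p : Eu n × Eu n => b.normed volume (p.1 - p.2)) :=
    (continuous_normed' b).comp (continuous_fst.sub continuous_snd)
  exact h1.measurable.ennreal_ofReal

lemma GradOn.enorm_fderiv_mol_le (h : GradOn U f ν θ) (b : ContDiffBump (0 : Eu n)) {y : Eu n}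
    (hy : closedBall y b.rOut ⊆ U) :
    ‖fderiv ℝ (mol b f) y‖ₑ ≤ ∫⁻ z, ENNReal.ofReal (b.normed volume (y - z)) ∂ν := by
  have := h.fin
  rw [← ofReal_norm, ← ofReal_integral_eq_lintegral_ofReal
    ((isTest_mol_kernel b y hy).integrable ν) (Eventually.of_forall fun y => b.nonneg_normed _)]
  exact ENNReal.ofReal_le_ofReal (h.norm_fderiv_mol_le b hy)

lemma GradOn.lintegral_fderiv_mol_le (h : GradOn U f ν θ) (b : ContDiffBump (0 : Eu n))
    {w : Eu n → ℝ≥0∞} (hw : Measurable w) (hwU : ∀ y, w y ≠ 0 → closedBall y b.rOut ⊆ U) :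
    ∫⁻ y, w y * ‖fderiv ℝ (mol b f) y‖ₑ ≤
      ∫⁻ z, (∫⁻ y, w y * ENNReal.ofReal (b.normed volume (y - z))) ∂ν := by
  have := h.fin
  have hk := measurable_mol_kernel b
  calc ∫⁻ y, w y * ‖fderiv ℝ (mol b f) y‖ₑ
      ≤ ∫⁻ y, (∫⁻ z, w y * ENNReal.ofReal (b.normed volume (y - z)) ∂ν) := by
        refine lintegral_mono fun y => ?_
        simp only
        have hky : Measurable (fun z => ENNReal.ofReal (b.normed volume (y - z))) :=
          (isTest_mol_kernel b y (subset_univ _)).continuous.measurable.ennreal_ofReal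
        rw [lintegral_const_mul _ hky]
        rcases eq_or_ne (w y) 0 with hy | hy
        · rw [hy, zero_mul, zero_mul]
        · exact mul_le_mul_right (h.enorm_fderiv_mol_le b (hwU y hy)) _
    _ = _ := by
        have hm : Measurable (fun p : Eu n × Eu n =>
            w p.1 * ENNReal.ofReal (b.normed volume (p.1 - p.2))) :=
          (hw.comp measurable_fst).mul hk
        exact lintegral_lintegral_swap hm.aemeasurable

lemma GradOn.lintegral_fderiv_mol_closedBall_le (h : GradOn U f ν θ)
    (b : ContDiffBump (0 : Eu n)) {x : Eu n} {R R' : ℝ} (hR : R + b.rOut ≤ R')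
    (hU : closedBall x R' ⊆ U) :
    ∫⁻ y in closedBall x R, ‖fderiv ℝ (mol b f) y‖ₑ ≤ ν (closedBall x R') := by
  have h1 := h.lintegral_fderiv_mol_le b (w := (closedBall x R).indicator 1)
    (measurable_one.indicator measurableSet_closedBall) (fun y hy => by
      have hy' : y ∈ closedBall x R := by
        by_contra hn
        exact hy (indicator_of_notMem hn _)
      refine (closedBall_subset_closedBall' ?_).trans hU
      rw [mem_closedBall] at hy'
      linarith)
  rw [← lintegral_indicator measurableSet_closedBall]
  have heq : ∀ y, (closedBall x R).indicator (fun y => ‖fderiv ℝ (mol b f) y‖ₑ) y =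
      (closedBall x R).indicator 1 y * ‖fderiv ℝ (mol b f) y‖ₑ := fun y => by
    by_cases hy : y ∈ closedBall x R <;> simp [hy]
  simp_rw [heq]
  refine h1.trans ?_
  rw [← lintegral_indicator_one measurableSet_closedBall]
  refine lintegral_mono fun z => ?_
  by_cases hz : z ∈ closedBall x R'
  · simp only [indicator_of_mem hz, Pi.one_apply]
    rw [← lintegral_mol_kernel b z]
    refine lintegral_mono fun y => ?_
    refine mul_le_of_le_one_left (zero_le) ?_
    exact indicator_le_self' (by simp) y
  · simp only [indicator_of_notMem hz]
    refine le_of_eq ((lintegral_eq_zero_iff' ?_).2 ?_)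
    · exact ((measurable_one.indicator measurableSet_closedBall).mul
        ((continuous_normed' b).comp (continuous_id.sub
          continuous_const)).measurable.ennreal_ofReal).aemeasurable
    · refine Eventually.of_forall fun y => ?_
      by_cases hy : y ∈ closedBall x R
      · rw [mem_closedBall] at hy hz
        have : b.rOut ≤ dist y z := by
          have := dist_triangle z y x
          rw [dist_comm z y] at this
          linarith
        simp [mol_kernel_eq_zero b this]
      · simp [hy]

lemma lintegral_translate_sub_le {g : Eu n → ℝ} (hg : ContDiff ℝ (⊤ : ℕ∞) g) {S S' : Set (Eu n)}
    (hS : MeasurableSet S) (hS' : MeasurableSet S') (z : Eu n)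
    (hSS : ∀ y ∈ S, ∀ t ∈ Icc (0 : ℝ) 1, y + t • z ∈ S') :
    ∫⁻ y in S, ‖g (y + z) - g y‖ₑ ≤ ‖z‖ₑ * ∫⁻ y in S', ‖fderiv ℝ g y‖ₑ := by
  have hcf : Continuous (fderiv ℝ g) := hg.continuous_fderiv (by simp)
  have hdiff : Differentiable ℝ g := hg.differentiable (by simp)
  have hpt : ∀ y, ‖g (y + z) - g y‖ₑ ≤
      ∫⁻ t in Icc (0 : ℝ) 1, ‖fderiv ℝ g (y + t • z)‖ₑ * ‖z‖ₑ := fun y => by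
    have hd : ∀ t : ℝ, HasDerivAt (fun t : ℝ => g (y + t • z)) (fderiv ℝ g (y + t • z) z) t := by
      intro t
      have h1 : HasDerivAt (fun t : ℝ => y + t • z) ((1 : ℝ) • z) t :=
        ((hasDerivAt_id t).smul_const z).const_add y
      rw [one_smul] at h1
      exact (hdiff _).hasFDerivAt.comp_hasDerivAt t h1
    have hc : Continuous (fun t : ℝ => fderiv ℝ g (y + t • z) z) := by fun_prop
    have hftc := intervalIntegral.integral_eq_sub_of_hasDerivAt (a := 0) (b := 1)
      (fun t _ => hd t) (hc.intervalIntegrable _ _)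
    simp only [one_smul, zero_smul, add_zero] at hftc
    rw [← hftc, intervalIntegral.integral_of_le zero_le_one]
    refine (enorm_integral_le_lintegral_enorm _).trans ?_
    refine (lintegral_mono_set Ioc_subset_Icc_self).trans ?_
    refine lintegral_mono fun t => ?_
    exact ContinuousLinearMap.le_opENorm _ _
  calc ∫⁻ y in S, ‖g (y + z) - g y‖ₑ
      ≤ ∫⁻ y in S, ∫⁻ t in Icc (0 : ℝ) 1, ‖fderiv ℝ g (y + t • z)‖ₑ * ‖z‖ₑ :=
        lintegral_mono fun y => hpt y
    _ = ∫⁻ t in Icc (0 : ℝ) 1, ∫⁻ y in S, ‖fderiv ℝ g (y + t • z)‖ₑ * ‖z‖ₑ := by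
        rw [lintegral_lintegral_swap]
        have hm : Measurable (fun p : Eu n × ℝ => ‖fderiv ℝ g (p.1 + p.2 • z)‖ₑ) :=
          (hcf.comp (continuous_fst.add (continuous_snd.smul continuous_const))).enorm.measurable
        exact (hm.mul_const ‖z‖ₑ).aemeasurable
    _ ≤ ∫⁻ t in Icc (0 : ℝ) 1, ‖z‖ₑ * ∫⁻ y in S', ‖fderiv ℝ g y‖ₑ := by
        refine setLIntegral_mono' measurableSet_Icc fun t ht => ?_
        rw [lintegral_mul_const _ (by
          exact (hcf.comp (continuous_id.add continuous_const)).enorm.measurable), mul_comm]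
        refine mul_le_mul_right ?_ _
        rw [← lintegral_indicator hS, ← lintegral_indicator hS',
          ← lintegral_add_right_eq_self (S'.indicator fun y => ‖fderiv ℝ g y‖ₑ) (t • z)]
        refine lintegral_mono fun y => ?_
        by_cases hy : y ∈ S
        · simp [hy, hSS y hy t ht]
        · simp [hy]
    _ = _ := by simp

lemma GradOn.measure_translate_le {E : Set (Eu n)} (hE : MeasurableSet E)
    (h : GradOn U (E.indicator 1) ν θ) {x z : Eu n} {ρ s R : ℝ} (hz : ‖z‖ ≤ s)
    (hR : ρ + s < R) (hU : closedBall x R ⊆ U) :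
    volume {y | y ∈ closedBall x ρ ∩ E ∧ y + z ∉ E} ≤
      ENNReal.ofReal s * ν (closedBall x R) := by
  have hli := h.locallyIntegrable
  have hae := ae_tendsto_mol hli
  have hae' : ∀ᵐ y : Eu n, Tendsto (fun j => mol (bumpSeq n j) (E.indicator 1) (y + z)) atTop
      (𝓝 (E.indicator 1 (y + z))) :=
    (measurePreserving_add_right (volume : Measure (Eu n)) z).quasiMeasurePreserving.ae hae
  have hmeas : MeasurableSet {y | y ∈ closedBall x ρ ∩ E ∧ y + z ∉ E} :=
    (measurableSet_closedBall.inter hE).inter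
      ((measurable_add_const z) hE.compl)
  have hcd := fun j => contDiff_mol (bumpSeq n j) hli
  have step : ∀ᶠ j in atTop, ∫⁻ y in closedBall x ρ,
      ‖mol (bumpSeq n j) (E.indicator 1) (y + z) - mol (bumpSeq n j) (E.indicator 1) y‖ₑ ≤
      ENNReal.ofReal s * ν (closedBall x R) := by
    filter_upwards [(tendsto_bumpSeq_rOut n).eventually (gt_mem_nhds (sub_pos.2 hR))] with j hj
    refine (lintegral_translate_sub_le (hcd j) measurableSet_closedBall
      (S' := closedBall x (ρ + s)) measurableSet_closedBall z ?_).trans ?_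
    · intro y hy t ht
      rw [mem_closedBall, dist_eq_norm] at hy ⊢
      have h1 : ‖t • z‖ ≤ s := by
        rw [norm_smul, Real.norm_of_nonneg ht.1]
        nlinarith [norm_nonneg z, ht.2, ht.1]
      calc ‖y + t • z - x‖ = ‖(y - x) + t • z‖ := by congr 1; abel
        _ ≤ _ := (norm_add_le _ _).trans (add_le_add hy h1)
    · gcongr
      · rw [← ofReal_norm]
        exact ENNReal.ofReal_le_ofReal hz
      · exact h.lintegral_fderiv_mol_closedBall_le _ (by linarith) hU
  calc volume {y | y ∈ closedBall x ρ ∩ E ∧ y + z ∉ E}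
      = ∫⁻ y in closedBall x ρ, {y | y ∈ closedBall x ρ ∩ E ∧ y + z ∉ E}.indicator 1 y := by
        rw [lintegral_indicator_one hmeas, Measure.restrict_apply hmeas]
        congr 1
        ext y
        constructor
        · intro hy; exact ⟨hy, hy.1.1⟩
        · intro hy; exact hy.1
    _ ≤ ∫⁻ y in closedBall x ρ, liminf (fun j => ‖mol (bumpSeq n j) (E.indicator 1) (y + z) -
          mol (bumpSeq n j) (E.indicator 1) y‖ₑ) atTop := by
        refine lintegral_mono_ae (ae_restrict_of_ae ?_)
        filter_upwards [hae, hae'] with y hy hy'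
        rw [((hy'.sub hy).enorm).liminf_eq]
        by_cases hm : y ∈ closedBall x ρ ∩ E ∧ y + z ∉ E
        · rw [indicator_of_mem (by exact hm), indicator_of_notMem hm.2, indicator_of_mem hm.1.2]
          simp
        · rw [indicator_of_notMem (by exact hm)]
          exact zero_le
    _ ≤ liminf (fun j => ∫⁻ y in closedBall x ρ, ‖mol (bumpSeq n j) (E.indicator 1) (y + z) -
          mol (bumpSeq n j) (E.indicator 1) y‖ₑ) atTop := by
        refine lintegral_liminf_le fun j => ?_
        exact (((hcd j).continuous.comp (continuous_id.add continuous_const)).sub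
          (hcd j).continuous).enorm.measurable
    _ ≤ _ := by
        refine (liminf_le_liminf step).trans ?_
        rw [liminf_const]

lemma GradOn.lintegral_measure_closedBall_diff_le {E : Set (Eu n)} (hE : MeasurableSet E)
    (h : GradOn U (E.indicator 1) ν θ) {x : Eu n} {ρ s R : ℝ}
    (hR : ρ + s < R) (hU : closedBall x R ⊆ U) :
    ∫⁻ y in E ∩ closedBall x ρ, volume (closedBall y s \ E) ≤
      volume (closedBall (0 : Eu n) s) * (ENNReal.ofReal s * ν (closedBall x R)) := by
  have hm2 : MeasurableSet {p : Eu n × Eu n | p.1 + p.2 ∉ E} :=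
    (measurable_fst.add measurable_snd) hE.compl
  calc ∫⁻ y in E ∩ closedBall x ρ, volume (closedBall y s \ E)
      = ∫⁻ y in E ∩ closedBall x ρ, ∫⁻ z in closedBall (0 : Eu n) s,
          {p : Eu n × Eu n | p.1 + p.2 ∉ E}.indicator 1 (y, z) := by
        congr 1
        funext y
        have h1 : MeasurableSet {z | y + z ∉ E} := (measurable_const_add y) hE.compl
        have : (fun z => {p : Eu n × Eu n | p.1 + p.2 ∉ E}.indicator (1 : Eu n × Eu n → ℝ≥0∞) (y, z))
          = {z | y + z ∉ E}.indicator 1 := rfl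
        rw [this, lintegral_indicator_one h1, Measure.restrict_apply h1,
          ← measure_preimage_add volume y (closedBall y s \ E)]
        congr 1
        ext z
        simp [and_comm, dist_eq_norm]
    _ = ∫⁻ z in closedBall (0 : Eu n) s, ∫⁻ y in E ∩ closedBall x ρ,
          {p : Eu n × Eu n | p.1 + p.2 ∉ E}.indicator 1 (y, z) := by
        rw [lintegral_lintegral_swap]
        exact (measurable_one.indicator hm2).aemeasurable
    _ ≤ ∫⁻ z in closedBall (0 : Eu n) s, ENNReal.ofReal s * ν (closedBall x R) := by
        refine setLIntegral_mono' measurableSet_closedBall fun z hz => ?_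
        rw [mem_closedBall_zero_iff] at hz
        refine le_trans (le_of_eq ?_) (h.measure_translate_le hE hz hR hU)
        have h1 : MeasurableSet {y | y + z ∉ E} := (measurable_add_const z) hE.compl
        have : (fun y => {p : Eu n × Eu n | p.1 + p.2 ∉ E}.indicator (1 : Eu n × Eu n → ℝ≥0∞) (y, z))
          = {y | y + z ∉ E}.indicator 1 := rfl
        rw [this, lintegral_indicator_one h1, Measure.restrict_apply h1]
        congr 1
        ext y
        simp only [mem_inter_iff, mem_ofPred_eq]
        tauto
    _ = _ := by
        rw [setLIntegral_const, mul_comm]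

/-- Volume of the part of `E` in the closed ball. -/
def ballVol (E : Set (Eu n)) (x : Eu n) (r : ℝ) : ℝ := volume.real (E ∩ closedBall x r)

lemma ballVol_nonneg (E : Set (Eu n)) (x : Eu n) (r : ℝ) : 0 ≤ ballVol E x r := measureReal_nonneg

lemma inter_closedBall_ne_top (E : Set (Eu n)) (x : Eu n) (r : ℝ) :
    volume (E ∩ closedBall x r) ≠ ⊤ :=
  (measure_mono inter_subset_right |>.trans_lt measure_closedBall_lt_top).ne

lemma ballVol_mono (E : Set (Eu n)) {x y : Eu n} {r s : ℝ} (h : closedBall x r ⊆ closedBall y s) :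
    ballVol E x r ≤ ballVol E y s :=
  measureReal_mono (inter_subset_inter_right _ h) (inter_closedBall_ne_top _ _ _)

/-- Volume of the unit ball. -/
def unitVol (n : ℕ) : ℝ := volume.real (ball (0 : Eu n) 1)

lemma unitVol_pos (n : ℕ) : 0 < unitVol n :=
  ENNReal.toReal_pos (measure_ball_pos _ _ one_pos).ne' measure_ball_lt_top.ne

lemma volume_real_closedBall (x : Eu n) {r : ℝ} (hr : 0 ≤ r) :
    volume.real (closedBall x r) = r ^ n * unitVol n := by
  rw [measureReal_def, Measure.addHaar_closedBall _ x hr, ENNReal.toReal_mul,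
    ENNReal.toReal_ofReal (by positivity), finrank_euclideanSpace_fin]
  rfl

lemma volume_real_ball (x : Eu n) {r : ℝ} (hr : 0 < r) :
    volume.real (ball x r) = r ^ n * unitVol n := by
  rw [measureReal_def, Measure.addHaar_ball_of_pos _ x hr, ENNReal.toReal_mul,
    ENNReal.toReal_ofReal (by positivity), finrank_euclideanSpace_fin]
  rfl

lemma GradOn.const_mul_ballVol_le {E : Set (Eu n)} (hE : MeasurableSet E)
    (h : GradOn U (E.indicator 1) ν θ) {x : Eu n} {ρ s R c : ℝ} (hs : 0 ≤ s)
    (hR : ρ + s < R) (hU : closedBall x R ⊆ U)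
    (hc : ∀ y ∈ E ∩ closedBall x ρ, c ≤ volume.real (closedBall y s \ E)) :
    c * ballVol E x ρ ≤ s ^ n * unitVol n * (s * ν.real (closedBall x R)) := by
  have := h.fin
  by_cases hc0 : c ≤ 0
  · refine (mul_nonpos_of_nonpos_of_nonneg hc0 (ballVol_nonneg _ _ _)).trans ?_
    have := unitVol_pos n
    positivity
  have h1 := h.lintegral_measure_closedBall_diff_le hE hR hU
  have h2 : ENNReal.ofReal c * volume (E ∩ closedBall x ρ) ≤
      ∫⁻ y in E ∩ closedBall x ρ, volume (closedBall y s \ E) := by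
    rw [← setLIntegral_const]
    refine setLIntegral_mono' (hE.inter measurableSet_closedBall) fun y hy => ?_
    refine ENNReal.ofReal_le_of_le_toReal (hc y hy)
  have h3 := ENNReal.toReal_mono ?_ (h2.trans h1)
  · rw [ENNReal.toReal_mul, ENNReal.toReal_mul, ENNReal.toReal_mul, ENNReal.toReal_ofReal hs,
      ENNReal.toReal_ofReal (not_le.1 hc0).le] at h3
    have h4 := volume_real_closedBall (0 : Eu n) hs
    rw [measureReal_def] at h4
    rw [h4] at h3
    exact h3
  · refine ENNReal.mul_ne_top measure_closedBall_lt_top.ne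
      (ENNReal.mul_ne_top ENNReal.ofReal_ne_top (measure_ne_top _ _))

/-- Relative isoperimetric inequality, in product form. -/
lemma GradOn.isoperimetric {E : Set (Eu n)} (hE : MeasurableSet E)
    (h : GradOn U (E.indicator 1) ν θ) {x : Eu n} {r : ℝ} (hr : 0 < r)
    (hU : closedBall x (4 * r) ⊆ U) :
    (r ^ n * unitVol n - ballVol E x r) * ballVol E x r ≤
      (2 * r) ^ n * unitVol n * (2 * r * ν.real (closedBall x (4 * r))) := by
  refine h.const_mul_ballVol_le hE (by positivity) (by linarith) hU fun y hy => ?_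
  rw [← volume_real_closedBall x hr.le]
  have h1 : closedBall x r ⊆ (E ∩ closedBall x r) ∪ (closedBall y (2 * r) \ E) := by
    intro z hz
    by_cases hzE : z ∈ E
    · exact Or.inl ⟨hzE, hz⟩
    · refine Or.inr ⟨?_, hzE⟩
      have hy2 := hy.2
      rw [mem_closedBall] at hz hy2 ⊢
      linarith [dist_triangle_right z y x]
  have h2 : volume.real (closedBall x r) ≤ ballVol E x r + volume.real (closedBall y (2 * r) \ E) :=
    (measureReal_mono h1 (measure_union_lt_top (inter_closedBall_ne_top _ _ _).lt_top
      (measure_mono sdiff_subset |>.trans_lt measure_closedBall_lt_top)).ne).trans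
      (measureReal_union_le _ _)
  linarith

lemma GradOn.ballVol_le_of_small {E : Set (Eu n)} (hE : MeasurableSet E)
    (h : GradOn U (E.indicator 1) ν θ) {x : Eu n} {r s R : ℝ} (hs : 0 < s)
    (hR : r + s < R) (hU : closedBall x R ⊆ U)
    (hsmall : ballVol E x (r + s) ≤ s ^ n * unitVol n / 2) :
    ballVol E x r ≤ 2 * s * ν.real (closedBall x R) := by
  have h1 : s ^ n * unitVol n / 2 * ballVol E x r ≤
      s ^ n * unitVol n * (s * ν.real (closedBall x R)) := by
    refine h.const_mul_ballVol_le hE hs.le hR hU fun y hy => ?_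
    have h1 : closedBall y s ⊆ (E ∩ closedBall x (r + s)) ∪ (closedBall y s \ E) := by
      intro z hz
      by_cases hzE : z ∈ E
      · refine Or.inl ⟨hzE, ?_⟩
        have hy2 := hy.2
        rw [mem_closedBall] at hz hy2 ⊢
        linarith [dist_triangle z y x]
      · exact Or.inr ⟨hz, hzE⟩
    have h2 : volume.real (closedBall y s) ≤
        ballVol E x (r + s) + volume.real (closedBall y s \ E) :=
      (measureReal_mono h1 (measure_union_lt_top (inter_closedBall_ne_top _ _ _).lt_top
        (measure_mono sdiff_subset |>.trans_lt measure_closedBall_lt_top)).ne).trans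
        (measureReal_union_le _ _)
    rw [volume_real_closedBall y hs.le] at h2
    linarith
  have h2 : 0 < s ^ n * unitVol n := mul_pos (by positivity) (unitVol_pos n)
  have h3 : s ^ n * unitVol n * (ballVol E x r) ≤
      s ^ n * unitVol n * (2 * s * ν.real (closedBall x R)) := by linarith
  exact le_of_mul_le_mul_left h3 h2

end Isoperimetric

section DeGiorgi

variable {n : ℕ} {U : Set (Eu n)} {ν : Measure (Eu n)} {θ : Eu n → Eu n} {E : Set (Eu n)}

lemma measure_le_of_frequently_closedBall_le {μ ν : Measure (Eu n)} [IsFiniteMeasure μ]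
    [IsLocallyFiniteMeasure ν] {S : Set (Eu n)}
    (h : ∀ x ∈ S, ∃ᶠ r in 𝓝[>] (0 : ℝ), μ (closedBall x r) ≤ ν (closedBall x r)) :
    μ S ≤ ν S :=
  (Besicovitch.vitaliFamily μ).measure_le_of_frequently_le ν Measure.AbsolutelyContinuous.rfl S
    fun x hx => (Besicovitch.tendsto_filterAt μ x).frequently (h x hx)

lemma measure_eq_zero_of_frequently_small [IsFiniteMeasure ν] {S : Set (Eu n)}
    (h : ∀ x ∈ S, ∀ ε : ℝ, 0 < ε → ∃ᶠ r in 𝓝[>] (0 : ℝ),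
      ν.real (closedBall x r) ≤ ε * volume.real (closedBall x r)) :
    ν S = 0 := by
  have key : ∀ N : ℕ, ν (S ∩ closedBall 0 N) = 0 := by
    intro N
    refine le_antisymm ?_ zero_le
    have h1 : ∀ ε : ℝ, 0 < ε →
        ν (S ∩ closedBall 0 N) ≤ ENNReal.ofReal ε * volume (closedBall (0 : Eu n) N) := by
      intro ε hε
      have : IsLocallyFiniteMeasure (ENNReal.ofReal ε • (volume : Measure (Eu n))) :=
        inferInstanceAs (IsLocallyFiniteMeasure ((Real.toNNReal ε) • (volume : Measure (Eu n))))
      refine (measure_le_of_frequently_closedBall_le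
        (ν := ENNReal.ofReal ε • (volume : Measure (Eu n))) fun x hx => ?_).trans ?_
      · refine (h x hx.1 ε hε).mono fun r hr => ?_
        rw [Measure.smul_apply, smul_eq_mul]
        rw [← ENNReal.toReal_le_toReal (measure_ne_top _ _)
          (ENNReal.mul_ne_top ENNReal.ofReal_ne_top measure_closedBall_lt_top.ne),
          ENNReal.toReal_mul, ENNReal.toReal_ofReal hε.le]
        exact hr
      · rw [Measure.smul_apply, smul_eq_mul]
        gcongr
        exact inter_subset_right
    have h2 : Tendsto (fun ε : ℝ => ENNReal.ofReal ε * volume (closedBall (0 : Eu n) N))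
        (𝓝[>] 0) (𝓝 0) := by
      have : Tendsto (fun ε : ℝ => ENNReal.ofReal ε * volume (closedBall (0 : Eu n) N))
          (𝓝 0) (𝓝 (ENNReal.ofReal 0 * volume (closedBall (0 : Eu n) N))) :=
        ENNReal.Tendsto.mul_const (ENNReal.continuous_ofReal.tendsto 0)
          (Or.inr measure_closedBall_lt_top.ne)
      rw [ENNReal.ofReal_zero, zero_mul] at this
      exact this.mono_left nhdsWithin_le_nhds
    exact ge_of_tendsto h2 (eventually_mem_nhdsWithin.mono fun ε hε => h1 ε hε)
  have hS : S = ⋃ N : ℕ, S ∩ closedBall 0 N := by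
    rw [← inter_iUnion, iUnion_closedBall_nat, inter_univ]
  rw [hS]
  exact measure_iUnion_null key

lemma GradOn.integrable_dir {f : Eu n → ℝ} (h : GradOn U f ν θ) : Integrable θ ν := by
  have := h.fin
  exact Integrable.of_bound h.meas_dir.aestronglyMeasurable 1 (h.norm_dir.mono fun x hx => hx.le)

lemma GradOn.ae_mem {f : Eu n → ℝ} (h : GradOn U f ν θ) : ∀ᵐ x ∂ν, x ∈ U := h.null

lemma lintegral_radialCutoff_le {ν lam : Measure (Eu n)} {x : Eu n} {r : ℝ} (hr : 0 < r)
    {c : ℝ≥0∞} (hc : ∀ ρ, r ≤ ρ → ρ ≤ 2 * r → lam (closedBall x ρ) ≤ c * ν (closedBall x ρ)) :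
    ∫⁻ y, ENNReal.ofReal (radialCutoff n x r y) ∂lam ≤
      c * ∫⁻ y, ENNReal.ofReal (radialCutoff n x r y) ∂ν := by
  have hcont : Continuous (radialCutoff n x r) :=
    (isTest_radialCutoff hr (subset_univ _)).continuous
  rw [lintegral_eq_lintegral_meas_le _ (Eventually.of_forall (radialCutoff_nonneg x r))
      hcont.measurable.aemeasurable,
    lintegral_eq_lintegral_meas_le _ (Eventually.of_forall (radialCutoff_nonneg x r))
      hcont.measurable.aemeasurable]
  have hanti : Antitone fun t => ν {a | t ≤ radialCutoff n x r a} := fun s t hst =>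
    measure_mono fun a ha => le_trans hst ha
  rw [← lintegral_const_mul _ hanti.measurable]
  refine setLIntegral_mono' measurableSet_Ioi fun t ht => ?_
  by_cases ht1 : t ≤ 1
  · obtain ⟨ρ, h1, h2, h3⟩ := exists_superlevel_radialCutoff (x := x) hr ht ht1
    rw [h1]
    exact hc ρ h2 h3
  · have : {a | t ≤ radialCutoff n x r a} = ∅ := by
      ext a
      simp only [mem_ofPred_eq, mem_empty_iff_false, iff_false, not_le]
      exact (radialCutoff_le_one x r a).trans_lt (not_le.1 ht1)
    rw [this]
    simp

lemma exists_deGiorgi_const (n : ℕ) : ∃ C : ℝ, 1 ≤ C ∧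
    ∀ (U E : Set (Eu n)) (ν : Measure (Eu n)) (θ : Eu n → Eu n), MeasurableSet E →
      GradOn U (E.indicator 1) ν θ →
      ∀ᵐ x ∂ν, ∀ᶠ r in 𝓝[>] (0 : ℝ), r * ν.real (closedBall x r) ≤ C * ballVol E x (2 * r) := by
  obtain ⟨C, hC1, hC⟩ := exists_bound_fderiv_radialCutoff n
  refine ⟨2 * C, by linarith, fun U E ν θ hE h => ?_⟩
  have := h.fin
  have hleb := (Besicovitch.vitaliFamily ν).ae_tendsto_lintegral_enorm_sub_div
    h.integrable_dir.locallyIntegrable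
  filter_upwards [hleb, h.norm_dir, h.ae_mem] with x hx hnx hxU
  have h1 := (hx.comp (Besicovitch.tendsto_filterAt ν x)).eventually
    (gt_mem_nhds (show (0 : ℝ≥0∞) < 1 / 2 by simp))
  obtain ⟨r₀, hr₀, hball⟩ := nhds_basis_closedBall.mem_iff.1 (h.isOpen.mem_nhds hxU)
  obtain ⟨r₁, hr₁, hr₁'⟩ := mem_nhdsGT_iff_exists_Ioo_subset.1 h1
  have hmin : (0 : ℝ) < min (r₀ / 2) (r₁ / 2) :=
    lt_min (half_pos hr₀) (half_pos hr₁)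
  filter_upwards [Ioo_mem_nhdsGT hmin] with r hr
  have hr0 : 0 < r := hr.1
  have hrr₀ : 2 * r < r₀ := by have := (lt_min_iff.1 hr.2).1; linarith
  have hrr₁ : 2 * r < r₁ := by have := (lt_min_iff.1 hr.2).2; linarith
  set η := radialCutoff n x r with hη
  have htest : IsTest U η :=
    isTest_radialCutoff hr0 ((closedBall_subset_closedBall hrr₀.le).trans hball)
  have hηint : Integrable η ν := htest.integrable ν
  -- the oscillation term
  have hosc : ∫ y, η y * ‖θ y - θ x‖ ∂ν ≤ 1 / 2 * ∫ y, η y ∂ν := by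
    have h2 : ∫⁻ y, ENNReal.ofReal (η y) ∂(ν.withDensity fun y => ‖θ y - θ x‖ₑ) ≤
        1 / 2 * ∫⁻ y, ENNReal.ofReal (η y) ∂ν := by
      refine lintegral_radialCutoff_le hr0 fun ρ hρ hρ' => ?_
      rw [withDensity_apply _ measurableSet_closedBall]
      have : ρ ∈ Ioo 0 r₁ := ⟨hr0.trans_le hρ, hρ'.trans_lt hrr₁⟩
      have h3 : (∫⁻ y in closedBall x ρ, ‖θ y - θ x‖ₑ ∂ν) / ν (closedBall x ρ) ≤ 1 / 2 :=
        le_of_lt (hr₁' this)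
      rwa [ENNReal.div_le_iff_le_mul (Or.inr (by simp)) (Or.inl (measure_ne_top _ _))] at h3
    rw [lintegral_withDensity_eq_lintegral_mul _ (h.meas_dir.sub_const _).enorm
      htest.continuous.measurable.ennreal_ofReal] at h2
    rw [integral_eq_lintegral_of_nonneg_ae, integral_eq_lintegral_of_nonneg_ae
      (Eventually.of_forall (radialCutoff_nonneg x r)) htest.continuous.aestronglyMeasurable]
    · have h4 := ENNReal.toReal_mono (ENNReal.mul_ne_top (by simp)
        hηint.lintegral_lt_top.ne) h2
      rw [ENNReal.toReal_mul] at h4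
      simp only [one_div, ENNReal.toReal_inv, ENNReal.toReal_ofNat] at h4 ⊢
      refine le_trans (le_of_eq ?_) h4
      congr 1
      refine lintegral_congr fun y => ?_
      rw [Pi.mul_apply, ENNReal.ofReal_mul (radialCutoff_nonneg x r y), ofReal_norm, mul_comm]
    · exact Eventually.of_forall fun y => mul_nonneg (radialCutoff_nonneg x r y) (norm_nonneg _)
    · exact (htest.continuous.measurable.mul (h.meas_dir.sub_const _).norm).aestronglyMeasurable
  have hInt1 : Integrable (fun y => η y * ‖θ y - θ x‖) ν :=
    ((h.integrable_dir.sub (integrable_const _)).norm).bdd_mul (c := 1)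
      htest.continuous.aestronglyMeasurable (Eventually.of_forall fun y => by
      rw [Real.norm_of_nonneg (radialCutoff_nonneg x r y)]; exact radialCutoff_le_one x r y)
  have hInt2 : Integrable (fun y => η y * ⟪θ y, θ x⟫) ν :=
    (h.integrable_dir.inner_const (𝕜 := ℝ) (θ x)).bdd_mul (c := 1)
      htest.continuous.aestronglyMeasurable (Eventually.of_forall fun y => by
      rw [Real.norm_of_nonneg (radialCutoff_nonneg x r y)]; exact radialCutoff_le_one x r y)
  have hlow : ∫ y, η y ∂ν ≤ ∫ y, η y * ‖θ y - θ x‖ ∂ν + ∫ y, η y * ⟪θ y, θ x⟫ ∂ν := by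
    rw [← integral_add hInt1 hInt2]
    refine integral_mono hηint (hInt1.add hInt2) fun y => ?_
    have h5 : 1 ≤ ‖θ y - θ x‖ + ⟪θ y, θ x⟫ := by
      have h6 : ⟪θ x - θ y, θ x⟫ ≤ ‖θ x - θ y‖ * ‖θ x‖ := real_inner_le_norm _ _
      rw [inner_sub_left, real_inner_self_eq_norm_sq, hnx, norm_sub_rev] at h6
      linarith
    have := radialCutoff_nonneg x r y
    change η y ≤ η y * _ + η y * _
    rw [← mul_add]
    exact le_mul_of_one_le_right this h5
  have hup : ∫ y, η y * ⟪θ y, θ x⟫ ∂ν ≤ C / r * ballVol E x (2 * r) := by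
    have h7 := h.ibp η htest (θ x)
    have h8 : ∫ y, η y * ⟪θ y, θ x⟫ ∂ν = - ∫ y, E.indicator 1 y * fderiv ℝ η y (θ x) := by
      rw [h7, neg_neg]
    rw [h8]
    refine (neg_le_abs _).trans ?_
    have h9 : ∀ y, E.indicator 1 y * fderiv ℝ η y (θ x) =
        (E ∩ closedBall x (2 * r)).indicator (fun y => fderiv ℝ η y (θ x)) y := by
      intro y
      by_cases hyE : y ∈ E
      · by_cases hyB : y ∈ closedBall x (2 * r)
        · have h10 : y ∈ E ∩ closedBall x (2 * r) := ⟨hyE, hyB⟩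
          rw [indicator_of_mem hyE, indicator_of_mem h10]; simp
        · have h10 := (isTest_radialCutoff (n := n) (x := x) hr0
            (Subset.rfl)).fderiv_zero_of_notMem hyB
          have h11 : y ∉ E ∩ closedBall x (2 * r) := fun h => hyB h.2
          rw [indicator_of_notMem h11, hη, h10]; simp
      · have h11 : y ∉ E ∩ closedBall x (2 * r) := fun h => hyE h.1
        rw [indicator_of_notMem hyE, indicator_of_notMem h11]; simp
    simp_rw [h9]
    rw [integral_indicator (hE.inter measurableSet_closedBall), ← Real.norm_eq_abs]
    refine norm_setIntegral_le_of_norm_le_const (inter_closedBall_ne_top _ _ _).lt_top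
      (fun y _ => ?_)
    refine (ContinuousLinearMap.le_opNorm _ _).trans ?_
    rw [hnx, mul_one]
    exact hC x r hr0 y
  have hball' : ν.real (closedBall x r) ≤ ∫ y, η y ∂ν := by
    rw [← integral_indicator_one measurableSet_closedBall]
    refine integral_mono ((integrable_const (1 : ℝ)).indicator measurableSet_closedBall) hηint
      fun y => ?_
    by_cases hy : y ∈ closedBall x r
    · rw [indicator_of_mem hy, hη, radialCutoff_eq_one hr0 hy]; simp
    · rw [indicator_of_notMem hy]; exact radialCutoff_nonneg x r y
  have hfin : ν.real (closedBall x r) ≤ 2 * (C / r * ballVol E x (2 * r)) := by linarith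
  calc r * ν.real (closedBall x r) ≤ r * (2 * (C / r * ballVol E x (2 * r))) := by gcongr
    _ = 2 * C * ballVol E x (2 * r) := by field_simp

end DeGiorgi

section Density

variable {n : ℕ} {U : Set (Eu n)} {ν μ : Measure (Eu n)} {θ σ : Eu n → Eu n} {E : Set (Eu n)}

lemma exists_lowerDensity_const (n : ℕ) : ∃ a : ℝ, 0 < a ∧ 2 ^ n * a ≤ unitVol n / 2 ∧
    ∀ (U E : Set (Eu n)) (ν : Measure (Eu n)) (θ : Eu n → Eu n), MeasurableSet E →
      GradOn U (E.indicator 1) ν θ →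
      ∀ᵐ x ∂ν, ∀ᶠ r in 𝓝[>] (0 : ℝ), a * r ^ n ≤ ballVol E x r := by
  obtain ⟨C, hC1, hC⟩ := exists_deGiorgi_const n
  have hω := unitVol_pos n
  set κ : ℝ := 1 / (48 * 6 ^ n * C) with hκ
  have hκ0 : 0 < κ := by positivity
  have hκ6 : κ ≤ 1 / 6 := by
    rw [hκ]
    apply one_div_le_one_div_of_le (by norm_num)
    have : (1 : ℝ) ≤ 6 ^ n := one_le_pow₀ (by norm_num)
    nlinarith
  set a : ℝ := min (κ ^ n * unitVol n / 2) (unitVol n / 2 / 2 ^ n) with ha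
  have ha0 : 0 < a := by positivity
  refine ⟨a, ha0, ?_, fun U E ν θ hE h => ?_⟩
  · have : a ≤ unitVol n / 2 / 2 ^ n := min_le_right _ _
    rw [le_div_iff₀ (by positivity)] at this
    linarith
  have := h.fin
  have hdg := hC U E ν θ hE h
  set good : Set (Eu n) := {x | x ∈ U ∧
    ∀ᶠ r in 𝓝[>] (0 : ℝ), r * ν.real (closedBall x r) ≤ C * ballVol E x (2 * r)} with hgood
  have hgoodae : ∀ᵐ x ∂ν, x ∈ good := by
    filter_upwards [hdg, h.ae_mem] with x hx hxU using ⟨hxU, hx⟩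
  suffices hbad : ν (good ∩ {x | ∃ᶠ r in 𝓝[>] (0 : ℝ), ballVol E x r < a * r ^ n}) = 0 by
    have hbad' : ∀ᵐ x ∂ν, x ∉ good ∩ {x | ∃ᶠ r in 𝓝[>] (0 : ℝ), ballVol E x r < a * r ^ n} :=
      measure_eq_zero_iff_ae_notMem.1 hbad
    filter_upwards [hgoodae, hbad'] with x hx hx'
    have h1 : ¬ ∃ᶠ r in 𝓝[>] (0 : ℝ), ballVol E x r < a * r ^ n := fun hf => hx' ⟨hx, hf⟩
    rw [not_frequently] at h1
    exact h1.mono fun r hr => not_lt.1 hr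
  refine measure_eq_zero_of_frequently_small fun x hx ε hε => ?_
  obtain ⟨⟨hxU, hxd⟩, hxf⟩ := hx
  obtain ⟨r₀, hr₀, hball⟩ := nhds_basis_closedBall.mem_iff.1 (h.isOpen.mem_nhds hxU)
  obtain ⟨r₁, hr₁, hr₁'⟩ := mem_nhdsGT_iff_exists_Ioo_subset.1 hxd
  have hr₁0 : (0 : ℝ) < r₁ := hr₁
  obtain ⟨R, hRm, hR⟩ := (hxf.and_eventually
    (Ioo_mem_nhdsGT (lt_min hr₀ hr₁0))).exists
  have hR0 : 0 < R := hR.1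
  have hRr₀ : R < r₀ := (lt_min_iff.1 hR.2).1
  have hRr₁ : R < r₁ := (lt_min_iff.1 hR.2).2
  have hq : ∀ j : ℕ, 0 < R / 6 ^ j ∧ R / 6 ^ j ≤ R := fun j =>
    ⟨by positivity, div_le_self hR0.le (one_le_pow₀ (by norm_num))⟩
  have hper : ∀ q : ℝ, 0 < q → q ≤ R →
      q * ν.real (closedBall x (q / 2)) ≤ 2 * C * ballVol E x q := by
    intro q hq0 hqR
    have h1 : q / 2 * ν.real (closedBall x (q / 2)) ≤ C * ballVol E x (2 * (q / 2)) :=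
      hr₁' ⟨half_pos hq0, by linarith⟩
    rw [mul_div_cancel₀ q two_ne_zero] at h1
    linarith
  have hstep : ∀ j : ℕ, ballVol E x (R / 6 ^ j) ≤ (1 / 12) ^ j * (a * (R / 6 ^ j) ^ n) := by
    intro j
    induction j with
    | zero => simpa using hRm.le
    | succ j ih =>
      set q := R / 6 ^ j with hqdef
      obtain ⟨hq0, hqR⟩ := hq j
      rw [← hqdef] at hq0 hqR
      have hsucc : R / 6 ^ (j + 1) = q / 6 := by rw [hqdef, pow_succ]; field_simp
      rw [hsucc]
      have h1 : ballVol E x q ≤ a * q ^ n := ih.trans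
        (mul_le_of_le_one_left (by positivity) (pow_le_one₀ (by norm_num) (by norm_num)))
      have h2 : ballVol E x (q / 6) ≤ 2 * (κ * q) * ν.real (closedBall x (q / 2)) := by
        refine h.ballVol_le_of_small hE (by positivity) (by nlinarith)
          ((closedBall_subset_closedBall (by linarith)).trans hball) ?_
        refine (ballVol_mono E (closedBall_subset_closedBall (show q / 6 + κ * q ≤ q by
          nlinarith))).trans (h1.trans ?_)
        have : a ≤ κ ^ n * unitVol n / 2 := min_le_left _ _
        calc a * q ^ n ≤ κ ^ n * unitVol n / 2 * q ^ n := by gcongr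
          _ = _ := by ring
      have h3 := hper q hq0 hqR
      have h4 : ballVol E x (q / 6) ≤ 4 * κ * C * ballVol E x q := by nlinarith
      have h5 : 4 * κ * C = 1 / 12 * (1 / 6) ^ n := by
        rw [hκ, one_div_pow]; field_simp; norm_num
      rw [h5] at h4
      refine h4.trans ?_
      calc 1 / 12 * (1 / 6) ^ n * ballVol E x q
          ≤ 1 / 12 * (1 / 6) ^ n * ((1 / 12) ^ j * (a * q ^ n)) := by gcongr
        _ = (1 / 12) ^ (j + 1) * (a * (q / 6) ^ n) := by
          rw [pow_succ, div_pow q 6 n, one_div_pow 6 n]; ring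
  have hbound : ∀ j : ℕ, ν.real (closedBall x (R / 6 ^ j / 2)) ≤
      (2 * C * a / R * 2 ^ n) * (1 / 2) ^ j * (R / 6 ^ j / 2) ^ n := by
    intro j
    have h1 := hper _ (hq j).1 (hq j).2
    have h2 := hstep j
    have h3 : R / 6 ^ j * ν.real (closedBall x (R / 6 ^ j / 2)) ≤
        2 * C * ((1 / 12) ^ j * (a * (R / 6 ^ j) ^ n)) := h1.trans (by gcongr)
    have h4 : (1 / 12 : ℝ) ^ j = (1 / 2) ^ j * (1 / 6) ^ j := by rw [← mul_pow]; norm_num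
    refine le_of_mul_le_mul_left (h3.trans (le_of_eq ?_)) (hq j).1
    rw [h4, div_pow (R / 6 ^ j) 2 n, one_div_pow 6 j]
    field_simp
  have hlim : Tendsto (fun j : ℕ => (2 * C * a / R * 2 ^ n) * (1 / 2 : ℝ) ^ j) atTop (𝓝 0) := by
    simpa using (tendsto_pow_atTop_nhds_zero_of_lt_one (r := (1 / 2 : ℝ)) (by norm_num)
      (by norm_num)).const_mul (2 * C * a / R * 2 ^ n)
  have htend : Tendsto (fun j : ℕ => R / 6 ^ j / 2) atTop (𝓝[>] 0) := by
    refine tendsto_nhdsWithin_iff.2 ⟨?_, Eventually.of_forall fun j => half_pos (hq j).1⟩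
    have : Tendsto (fun j : ℕ => (1 / 6 : ℝ) ^ j) atTop (𝓝 0) :=
      tendsto_pow_atTop_nhds_zero_of_lt_one (by norm_num) (by norm_num)
    have h2 := (this.const_mul R).div_const 2
    simp only [mul_zero, zero_div] at h2
    refine h2.congr fun j => ?_
    rw [one_div_pow]; ring
  refine htend.frequently (Eventually.frequently ?_)
  filter_upwards [hlim.eventually (gt_mem_nhds (mul_pos hε hω))] with j hj
  rw [volume_real_closedBall x (half_pos (hq j).1).le]
  refine (hbound j).trans ?_
  have h1 : 0 < (R / 6 ^ j / 2) ^ n := pow_pos (half_pos (hq j).1) n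
  calc _ ≤ ε * unitVol n * (R / 6 ^ j / 2) ^ n := mul_le_mul_of_nonneg_right hj.le h1.le
    _ = _ := by ring

/-- A dimensional constant bounding the density of a set of finite perimeter from below. -/
def lowDens (n : ℕ) : ℝ := (exists_lowerDensity_const n).choose

lemma lowDens_pos (n : ℕ) : 0 < lowDens n := (exists_lowerDensity_const n).choose_spec.1

lemma two_pow_mul_lowDens_le (n : ℕ) : 2 ^ n * lowDens n ≤ unitVol n / 2 :=
  (exists_lowerDensity_const n).choose_spec.2.1

lemma GradOn.ae_lowDens_le (hE : MeasurableSet E) (h : GradOn U (E.indicator 1) ν θ) :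
    ∀ᵐ x ∂ν, ∀ᶠ r in 𝓝[>] (0 : ℝ), lowDens n * r ^ n ≤ ballVol E x r :=
  (exists_lowerDensity_const n).choose_spec.2.2 U E ν θ hE h

lemma exists_div_const (n : ℕ) : ∃ C : ℝ, 0 < C ∧
    ∀ (U : Set (Eu n)) (σ : Eu n → Eu n) (μ : Measure (Eu n)), DivOn U σ μ →
      ∀ (x : Eu n) (r : ℝ), 0 < r → closedBall x (2 * r) ⊆ U →
        r * μ.real (closedBall x r) ≤ C * r ^ n := by
  obtain ⟨C, hC1, hC⟩ := exists_bound_fderiv_radialCutoff n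
  have hω := unitVol_pos n
  refine ⟨C * 2 ^ n * unitVol n, by positivity, fun U σ μ h x r hr hU => ?_⟩
  have := h.fin
  have htest : IsTest U (radialCutoff n x r) := isTest_radialCutoff hr hU
  have h1 : μ.real (closedBall x r) ≤ ∫ y, radialCutoff n x r y ∂μ := by
    rw [← integral_indicator_one measurableSet_closedBall]
    refine integral_mono ((integrable_const (1 : ℝ)).indicator measurableSet_closedBall)
      (htest.integrable μ) fun y => ?_
    by_cases hy : y ∈ closedBall x r
    · rw [indicator_of_mem hy, radialCutoff_eq_one hr hy]; simp
    · rw [indicator_of_notMem hy]; exact radialCutoff_nonneg x r y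
  rw [← h.ibp _ htest] at h1
  have h2 : ∀ y, fderiv ℝ (radialCutoff n x r) y (σ y) =
      (closedBall x (2 * r)).indicator (fun y => fderiv ℝ (radialCutoff n x r) y (σ y)) y := by
    intro y
    by_cases hy : y ∈ closedBall x (2 * r)
    · rw [indicator_of_mem hy]
    · rw [indicator_of_notMem hy, (isTest_radialCutoff (n := n) (x := x) hr
            (Subset.rfl)).fderiv_zero_of_notMem hy]; simp
  have h3 : ∫ y, fderiv ℝ (radialCutoff n x r) y (σ y) ≤ C / r * ((2 * r) ^ n * unitVol n) := by
    rw [integral_congr_ae (Eventually.of_forall h2),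
      integral_indicator measurableSet_closedBall, ← volume_real_closedBall x (by positivity)]
    refine (le_abs_self _).trans ?_
    rw [← Real.norm_eq_abs]
    refine norm_setIntegral_le_of_norm_le_const measure_closedBall_lt_top (fun y _ => ?_)
    refine (ContinuousLinearMap.le_opNorm _ _).trans ?_
    refine (mul_le_of_le_one_right (norm_nonneg _) (h.norm_le y)).trans ?_
    exact hC x r hr y
  calc r * μ.real (closedBall x r) ≤ r * (C / r * ((2 * r) ^ n * unitVol n)) := by
        gcongr; exact h1.trans h3
    _ = _ := by rw [mul_pow]; field_simp

/-- A dimensional constant bounding the growth of divergence measures of bounded fields. -/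
def divConst (n : ℕ) : ℝ := (exists_div_const n).choose

lemma divConst_pos (n : ℕ) : 0 < divConst n := (exists_div_const n).choose_spec.1

lemma DivOn.mul_measure_closedBall_le (h : DivOn U σ μ) {x : Eu n} {r : ℝ} (hr : 0 < r)
    (hU : closedBall x (2 * r) ⊆ U) : r * μ.real (closedBall x r) ≤ divConst n * r ^ n :=
  (exists_div_const n).choose_spec.2 U σ μ h x r hr hU

lemma exists_intermediate_density (E : Set (Eu n)) (x : Eu n) {r₂ R a t : ℝ} (hr₂ : 0 < r₂)
    (hR : r₂ ≤ R) (ha : 0 < a) (hta : t ≤ a) (hmR : ballVol E x R ≤ a * R ^ n)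
    (hmr : t * r₂ ^ n ≤ ballVol E x r₂) :
    ∃ r, r₂ ≤ r ∧ r ≤ R ∧ t * r ^ n ≤ ballVol E x r ∧ ballVol E x r ≤ 2 ^ n * a * r ^ n := by
  by_cases h0 : ballVol E x r₂ ≤ 2 ^ n * a * r₂ ^ n
  · exact ⟨r₂, le_rfl, hR, hmr, h0⟩
  have hex : ∃ j : ℕ, ¬ (a * (2 ^ j * r₂) ^ n < ballVol E x (2 ^ j * r₂) ∧ 2 ^ j * r₂ ≤ R) := by
    obtain ⟨j, hj⟩ := pow_unbounded_of_one_lt (R / r₂) (one_lt_two)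
    refine ⟨j, fun h => ?_⟩
    rw [div_lt_iff₀ hr₂] at hj
    linarith [h.2]
  classical
  have hj := Nat.find_spec hex
  have hmin := fun i => Nat.find_min hex (m := i)
  set j := Nat.find hex
  have hj0 : j ≠ 0 := by
    intro h
    rw [h] at hj
    apply hj
    simp only [pow_zero, one_mul]
    refine ⟨lt_of_le_of_lt ?_ (not_le.1 h0), hR⟩
    have : (1 : ℝ) ≤ 2 ^ n := one_le_pow₀ (by norm_num)
    have h1 : 0 ≤ a * r₂ ^ n := by positivity
    nlinarith
  obtain ⟨i, hi⟩ := Nat.exists_eq_succ_of_ne_zero hj0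
  have hi' := hmin i (by omega)
  rw [not_not] at hi'
  set r := 2 ^ i * r₂ with hr
  have hrpos : 0 < r := by positivity
  have h2r : 2 ^ j * r₂ = 2 * r := by rw [hi, Nat.succ_eq_add_one, pow_succ, hr]; ring
  rw [h2r] at hj
  refine ⟨r, le_mul_of_one_le_left hr₂.le (one_le_pow₀ (by norm_num)), hi'.2, ?_, ?_⟩
  · exact le_trans (by gcongr) hi'.1.le
  · by_cases hR2 : 2 * r ≤ R
    · have : ballVol E x (2 * r) ≤ a * (2 * r) ^ n := by
        by_contra hc
        exact hj ⟨not_le.1 hc, hR2⟩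
      refine (ballVol_mono E (closedBall_subset_closedBall (by linarith))).trans (this.trans ?_)
      rw [mul_pow]
      exact le_of_eq (by ring)
    · refine (ballVol_mono E (closedBall_subset_closedBall hi'.2)).trans (hmR.trans ?_)
      calc a * R ^ n ≤ a * (2 * r) ^ n := by
            have : 0 < R := hr₂.trans_le hR
            gcongr; linarith
        _ = _ := by rw [mul_pow]; ring

lemma GradOn.exists_radius (hE : MeasurableSet E) (h : GradOn U (E.indicator 1) ν θ)
    {x : Eu n} {r₂ R t : ℝ} (hr₂ : 0 < r₂) (hR : r₂ ≤ R) (ht : 0 < t) (hta : t ≤ lowDens n)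
    (hU : closedBall x (4 * R) ⊆ U) (hmR : ballVol E x R ≤ lowDens n * R ^ n)
    (hmr : t * r₂ ^ n ≤ ballVol E x r₂) :
    ∃ r, r₂ ≤ r ∧ r ≤ R ∧ t * r ^ n ≤ 2 ^ (n + 2) * (r * ν.real (closedBall x (4 * r))) := by
  have hω := unitVol_pos n
  obtain ⟨r, h1, h2, h3, h4⟩ :=
    exists_intermediate_density E x hr₂ hR (lowDens_pos n) hta hmR hmr
  have hr : 0 < r := hr₂.trans_le h1
  refine ⟨r, h1, h2, ?_⟩
  have h5 := h.isoperimetric hE hr ((closedBall_subset_closedBall (by linarith)).trans hU)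
  have h6 : ballVol E x r ≤ unitVol n / 2 * r ^ n := h4.trans (by
    gcongr; exact two_pow_mul_lowDens_le n)
  have hrn : 0 < r ^ n := by positivity
  have h7 : (unitVol n / 2 * r ^ n) * (t * r ^ n) ≤
      (r ^ n * unitVol n - ballVol E x r) * ballVol E x r := by
    apply mul_le_mul _ h3 (by positivity) _
    · linarith
    · nlinarith
  have h8 := h7.trans h5
  have h9 : 0 < unitVol n / 2 * r ^ n := by positivity
  refine le_of_mul_le_mul_left (h8.trans (le_of_eq ?_)) h9
  rw [mul_pow]; ring

lemma densityZeroAt_iff (E : Set (Eu n)) (x : Eu n) :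
    DensityZeroAt E x ↔ ∀ t : ℝ, 0 < t → ∀ᶠ r in 𝓝[>] (0 : ℝ), ballVol E x r < t * r ^ n := by
  have hω := unitVol_pos n
  have hball : ∀ r : ℝ, 0 < r → volume (E ∩ ball x r) = volume (E ∩ closedBall x r) := by
    intro r hr
    refine le_antisymm (measure_mono (inter_subset_inter_right _ ball_subset_closedBall)) ?_
    rw [← ball_union_sphere, inter_union_distrib_left]
    refine (measure_union_le _ _).trans ?_
    rw [measure_mono_null inter_subset_right
      (Measure.addHaar_sphere_of_ne_zero volume x hr.ne'), add_zero]
  have hlt : ∀ r t : ℝ, 0 < r → 0 < t →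
      (volume (E ∩ ball x r) / volume (ball x r) < ENNReal.ofReal t ↔
        ballVol E x r < t * unitVol n * r ^ n) := by
    intro r t hr ht
    have h0 : volume (ball x r) ≠ 0 := (measure_ball_pos _ _ hr).ne'
    have h1 : volume (ball x r) ≠ ⊤ := measure_ball_lt_top.ne
    rw [ENNReal.div_lt_iff (Or.inl h0) (Or.inl h1), hball r hr,
      ← ENNReal.toReal_lt_toReal (inter_closedBall_ne_top _ _ _)
        (ENNReal.mul_ne_top ENNReal.ofReal_ne_top h1), ENNReal.toReal_mul,
      ENNReal.toReal_ofReal ht.le]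
    have h2 := volume_real_ball x hr
    rw [measureReal_def] at h2
    rw [h2, mul_assoc, mul_comm (unitVol n)]
    rfl
  constructor
  · intro h t ht
    have h1 := h.eventually (gt_mem_nhds (show (0 : ℝ≥0∞) < ENNReal.ofReal (t / unitVol n) by
      rw [ENNReal.ofReal_pos]; positivity))
    filter_upwards [h1, self_mem_nhdsWithin] with r hr hr0
    rw [hlt r _ hr0 (by positivity), div_mul_cancel₀ _ hω.ne'] at hr
    exact hr
  · intro h
    refine ENNReal.tendsto_nhds_zero.2 fun ε hε => ?_
    obtain ⟨t, ht0, htε⟩ := ENNReal.lt_iff_exists_real_btwn.1 hε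
    have ht : 0 < t := by
      have := htε.1
      rwa [ENNReal.ofReal_pos] at this
    filter_upwards [h (t * unitVol n) (by positivity), self_mem_nhdsWithin] with r hr hr0
    exact (((hlt r t hr0 ht).2 hr).trans htε.2).le

lemma ae_densityZero_or_lowDens_le (hE : MeasurableSet E) (h : GradOn U (E.indicator 1) ν θ)
    (hd : DivOn U σ μ) :
    ∀ᵐ x ∂μ, DensityZeroAt E x ∨ ∀ᶠ r in 𝓝[>] (0 : ℝ), lowDens n * r ^ n ≤ ballVol E x r := by
  have := h.fin
  have := hd.fin
  have ha := lowDens_pos n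
  have hCd := divConst_pos n
  set N : Set (Eu n) := {x | x ∈ U ∧ ∃ᶠ r in 𝓝[>] (0 : ℝ), ballVol E x r < lowDens n * r ^ n}
    with hN
  have hνN : ν N = 0 := by
    rw [measure_eq_zero_iff_ae_notMem]
    filter_upwards [h.ae_lowDens_le hE] with x hx hxN
    obtain ⟨r, h1, h2⟩ := (hxN.2.and_eventually hx).exists
    linarith
  set Nj : ℕ → Set (Eu n) := fun j => {x | x ∈ N ∧
    ∃ᶠ r in 𝓝[>] (0 : ℝ), 1 / ((j : ℝ) + 1) * r ^ n ≤ ballVol E x r} with hNj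
  have hμN : ∀ j, μ (Nj j) = 0 := by
    intro j
    set t := min (1 / ((j : ℝ) + 1)) (lowDens n) with ht
    have ht0 : 0 < t := lt_min (by positivity) ha
    set c : ℝ := divConst n * 4 ^ n * 2 ^ (n + 2) / (4 * t) with hc
    have hc0 : 0 ≤ c := by positivity
    have hlf : IsLocallyFiniteMeasure (ENNReal.ofReal c • ν) :=
      inferInstanceAs (IsLocallyFiniteMeasure ((Real.toNNReal c) • ν))
    have hle : μ (Nj j) ≤ (ENNReal.ofReal c • ν) (Nj j) := by
      refine measure_le_of_frequently_closedBall_le fun x hx => ?_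
      obtain ⟨⟨hxU, hxl⟩, hxh⟩ := hx
      obtain ⟨r₀, hr₀, hball⟩ := nhds_basis_closedBall.mem_iff.1 (h.isOpen.mem_nhds hxU)
      rw [Filter.frequently_iff]
      intro s hs
      obtain ⟨δ, hδ, hδs⟩ := mem_nhdsGT_iff_exists_Ioo_subset.1 hs
      have hδ0 : (0 : ℝ) < δ := hδ
      obtain ⟨R, hRm, hR⟩ := (hxl.and_eventually (Ioo_mem_nhdsGT (show (0 : ℝ) <
        min (r₀ / 8) (δ / 4) from lt_min (by linarith) (by linarith)))).exists
      have hR0 : 0 < R := hR.1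
      have hRr₀ : R < r₀ / 8 := (lt_min_iff.1 hR.2).1
      have hRδ : R < δ / 4 := (lt_min_iff.1 hR.2).2
      obtain ⟨r₂, hr₂m, hr₂⟩ := (hxh.and_eventually (Ioo_mem_nhdsGT hR0)).exists
      obtain ⟨r, h1, h2, h3⟩ := h.exists_radius hE (x := x) hr₂.1 hr₂.2.le ht0 (min_le_right _ _)
        ((closedBall_subset_closedBall (by linarith)).trans hball) hRm.le
        (le_trans (mul_le_mul_of_nonneg_right (min_le_left _ _) (pow_nonneg hr₂.1.le n)) hr₂m)
      have hr : 0 < r := hr₂.1.trans_le h1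
      refine ⟨4 * r, hδs ⟨by positivity, by linarith⟩, ?_⟩
      have h4 := hd.mul_measure_closedBall_le (x := x) (r := 4 * r) (by positivity)
        ((closedBall_subset_closedBall (by linarith)).trans hball)
      rw [Measure.smul_apply, smul_eq_mul, ← ENNReal.toReal_le_toReal (measure_ne_top _ _)
          (ENNReal.mul_ne_top ENNReal.ofReal_ne_top (measure_ne_top _ _)),
          ENNReal.toReal_mul, ENNReal.toReal_ofReal hc0]
      change μ.real _ ≤ c * ν.real _
      have h5 : 4 * r * μ.real (closedBall x (4 * r)) ≤
          4 * r * (c * ν.real (closedBall x (4 * r))) := by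
        refine h4.trans ?_
        calc divConst n * (4 * r) ^ n = divConst n * 4 ^ n / t * (t * r ^ n) := by
              rw [mul_pow]; field_simp
          _ ≤ divConst n * 4 ^ n / t * (2 ^ (n + 2) * (r * ν.real (closedBall x (4 * r)))) := by
              gcongr
          _ = _ := by rw [hc]; field_simp
      exact le_of_mul_le_mul_left h5 (by positivity)
    refine le_antisymm (hle.trans ?_) zero_le
    rw [Measure.smul_apply, measure_mono_null (fun x hx => hx.1) hνN, smul_zero]
  have hall : ∀ᵐ x ∂μ, ∀ j, x ∉ Nj j :=
    ae_all_iff.2 fun j => measure_eq_zero_iff_ae_notMem.1 (hμN j)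
  have hUae : ∀ᵐ x ∂μ, x ∈ U := hd.null
  filter_upwards [hall, hUae] with x hx hxU
  by_cases hlow : ∃ᶠ r in 𝓝[>] (0 : ℝ), ballVol E x r < lowDens n * r ^ n
  · left
    rw [densityZeroAt_iff]
    intro t ht
    obtain ⟨j, hj⟩ := exists_nat_one_div_lt ht
    have h1 : ¬ ∃ᶠ r in 𝓝[>] (0 : ℝ), 1 / ((j : ℝ) + 1) * r ^ n ≤ ballVol E x r :=
      fun hf => hx j ⟨⟨hxU, hlow⟩, hf⟩
    rw [not_frequently] at h1
    filter_upwards [h1, self_mem_nhdsWithin] with r hr hr0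
    refine (not_le.1 hr).trans_le ?_
    have : (0 : ℝ) < r := hr0
    gcongr
  · right
    rw [not_frequently] at hlow
    exact hlow.mono fun r hr => not_lt.1 hr

/-- The constant in the boxing inequality. -/
def boxConst (n : ℕ) : ℝ := divConst n * 20 ^ n * 2 ^ (n + 2) / (20 * lowDens n)

lemma boxConst_nonneg (n : ℕ) : 0 ≤ boxConst n := by
  have := divConst_pos n
  have := lowDens_pos n
  unfold boxConst
  positivity

/-- A boxing inequality for divergence measures. -/
lemma boxing (hE : MeasurableSet E) (h : GradOn U (E.indicator 1) ν θ) (hd : DivOn U σ μ)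
    {K : Set (Eu n)} {R : ℝ} (hR : 0 < R) (hU : ∀ x ∈ K, closedBall x (41 * R) ⊆ U)
    (hK : ∀ x ∈ K, ballVol E x (2 * R) ≤ lowDens n * R ^ n) :
    μ {y | (∃ x ∈ K, dist y x ≤ R) ∧ ¬ DensityZeroAt E y} ≤
      ENNReal.ofReal (boxConst n) * ν {y | ∃ x ∈ K, dist y x ≤ 5 * R} := by
  have := h.fin
  have := hd.fin
  have ha := lowDens_pos n
  have hCd := divConst_pos n
  set S : Set (Eu n) := {y | (∃ x ∈ K, dist y x ≤ R) ∧
    ∀ᶠ r in 𝓝[>] (0 : ℝ), lowDens n * r ^ n ≤ ballVol E y r} with hS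
  have hμS : μ {y | (∃ x ∈ K, dist y x ≤ R) ∧ ¬ DensityZeroAt E y} ≤ μ S := by
    refine measure_mono_ae ?_
    filter_upwards [ae_densityZero_or_lowDens_le hE h hd] with y hy hy'
    exact ⟨hy'.1, hy.resolve_left hy'.2⟩
  refine hμS.trans ?_
  have hex : ∀ y : S, ∃ r : ℝ, 0 < r ∧ r ≤ R ∧ μ (closedBall (y : Eu n) (20 * r)) ≤
      ENNReal.ofReal (boxConst n) * ν (closedBall (y : Eu n) (4 * r)) := by
    rintro ⟨y, ⟨x, hxK, hyx⟩, hy⟩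
    have hsub : closedBall y R ⊆ closedBall x (2 * R) :=
      closedBall_subset_closedBall' (by linarith)
    have hsubU : closedBall y (40 * R) ⊆ U :=
      (closedBall_subset_closedBall' (by linarith)).trans (hU x hxK)
    obtain ⟨r₂, hr₂m, hr₂⟩ := (hy.and (Ioo_mem_nhdsGT hR)).exists
    obtain ⟨r, h1, h2, h3⟩ := h.exists_radius hE (x := y) hr₂.1 hr₂.2.le ha le_rfl
      ((closedBall_subset_closedBall (by linarith)).trans hsubU)
      ((ballVol_mono E hsub).trans (hK x hxK)) hr₂m
    have hr : 0 < r := hr₂.1.trans_le h1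
    refine ⟨r, hr, h2, ?_⟩
    have h4 := hd.mul_measure_closedBall_le (x := y) (r := 20 * r) (by positivity)
      ((closedBall_subset_closedBall (by linarith)).trans hsubU)
    rw [← ENNReal.toReal_le_toReal (measure_ne_top _ _)
          (ENNReal.mul_ne_top ENNReal.ofReal_ne_top (measure_ne_top _ _)),
          ENNReal.toReal_mul, ENNReal.toReal_ofReal (boxConst_nonneg n)]
    change μ.real _ ≤ boxConst n * ν.real _
    have h5 : 20 * r * μ.real (closedBall y (20 * r)) ≤
        20 * r * (boxConst n * ν.real (closedBall y (4 * r))) := by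
      refine h4.trans ?_
      calc divConst n * (20 * r) ^ n
          = divConst n * 20 ^ n / lowDens n * (lowDens n * r ^ n) := by
            rw [mul_pow]; field_simp
        _ ≤ divConst n * 20 ^ n / lowDens n *
              (2 ^ (n + 2) * (r * ν.real (closedBall y (4 * r)))) := by
            gcongr
        _ = _ := by rw [boxConst]; field_simp
    exact le_of_mul_le_mul_left h5 (by positivity)
  choose ρ hρ0 hρR hρ using hex
  obtain ⟨I, -, hdisj, hcov⟩ := Vitali.exists_disjoint_subfamily_covering_enlargement_closedBall
    (univ : Set S) (fun y => (y : Eu n)) (fun y => 4 * ρ y) (4 * R)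
    (fun y _ => by have := hρR y; linarith) 5 (by norm_num)
  have hcount : I.Countable := by
    refine hdisj.countable_of_nonempty_interior fun y _ => ?_
    rw [interior_closedBall _ (by have := hρ0 y; positivity)]
    exact nonempty_ball.2 (by have := hρ0 y; positivity)
  have hScov : S ⊆ ⋃ y ∈ I, closedBall (y : Eu n) (20 * ρ y) := by
    intro z hz
    obtain ⟨y, hyI, hy⟩ := hcov ⟨z, hz⟩ (mem_univ _)
    refine mem_biUnion hyI ?_
    have h1 : z ∈ closedBall z (4 * ρ ⟨z, hz⟩) :=
      mem_closedBall_self (by have := hρ0 ⟨z, hz⟩; positivity)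
    have h2 := hy h1
    rwa [show 5 * (4 * ρ y) = 20 * ρ y by ring] at h2
  calc μ S ≤ μ (⋃ y ∈ I, closedBall (y : Eu n) (20 * ρ y)) := measure_mono hScov
    _ ≤ ∑' y : I, μ (closedBall ((y : S) : Eu n) (20 * ρ y)) := measure_biUnion_le _ hcount _
    _ ≤ ∑' y : I, ENNReal.ofReal (boxConst n) * ν (closedBall ((y : S) : Eu n) (4 * ρ y)) :=
        ENNReal.tsum_le_tsum fun y => hρ y
    _ = ENNReal.ofReal (boxConst n) * ν (⋃ y ∈ I, closedBall (y : Eu n) (4 * ρ y)) := by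
        rw [ENNReal.tsum_mul_left, measure_biUnion hcount hdisj
          (fun y _ => measurableSet_closedBall)]
    _ ≤ _ := by
        gcongr
        intro z hz
        obtain ⟨y, hyI, hzy⟩ := mem_iUnion₂.1 hz
        obtain ⟨x, hxK, hyx⟩ := y.2.1
        refine ⟨x, hxK, ?_⟩
        rw [mem_closedBall] at hzy
        have := hρR y
        linarith [dist_triangle z y x]

end Density

section UpperSemicontinuity

variable {n : ℕ} {U E : Set (Eu n)} {ν μ : Measure (Eu n)} {θ σ : Eu n → Eu n}

lemma measurable_ballVol (hE : MeasurableSet E) (r : ℝ) :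
    Measurable fun x => ballVol E x r := by
  have hS : MeasurableSet {p : Eu n × Eu n | p.2 ∈ E ∧ dist p.2 p.1 ≤ r} :=
    (measurable_snd hE).inter
      (measurableSet_le (measurable_snd.dist measurable_fst) measurable_const)
  have h := (measurable_measure_prodMk_left (ν := (volume : Measure (Eu n))) hS).ennreal_toReal
  exact h

lemma densityZeroAt_iff_rat (E : Set (Eu n)) (x : Eu n) :
    DensityZeroAt E x ↔ ∀ j : ℕ, ∃ m : ℕ, ∀ q : ℚ, 0 < (q : ℝ) → (q : ℝ) < 1 / ((m : ℝ) + 1) →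
      ballVol E x q ≤ 1 / ((j : ℝ) + 1) * (q : ℝ) ^ n := by
  rw [densityZeroAt_iff]
  constructor
  · intro h j
    obtain ⟨δ, hδ, hs⟩ := mem_nhdsGT_iff_exists_Ioo_subset.1
      (h (1 / ((j : ℝ) + 1)) (by positivity))
    obtain ⟨m, hm⟩ := exists_nat_one_div_lt (show (0 : ℝ) < δ from hδ)
    refine ⟨m, fun q hq hqm => ?_⟩
    have h1 : ballVol E x q < 1 / ((j : ℝ) + 1) * (q : ℝ) ^ n := hs ⟨hq, hqm.trans hm⟩
    exact h1.le
  · intro h t ht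
    obtain ⟨j, hj⟩ := exists_nat_one_div_lt ht
    obtain ⟨m, hm⟩ := h j
    filter_upwards [Ioo_mem_nhdsGT (show (0 : ℝ) < 1 / ((m : ℝ) + 1) by positivity)] with r hr
    have h0 : (0 : ℝ) < r := hr.1
    refine lt_of_le_of_lt (b := 1 / ((j : ℝ) + 1) * r ^ n) ?_ (by gcongr)
    have hc : Tendsto (fun s : ℝ => 1 / ((j : ℝ) + 1) * s ^ n) (𝓝[>] r)
        (𝓝 (1 / ((j : ℝ) + 1) * r ^ n)) :=
      ((continuous_const.mul (continuous_pow n)).tendsto r).mono_left nhdsWithin_le_nhds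
    refine ge_of_tendsto hc ?_
    filter_upwards [Ioo_mem_nhdsGT hr.2] with s hs
    obtain ⟨q, hq1, hq2⟩ := exists_rat_btwn hs.1
    have h1 := hm q (h0.trans hq1) (hq2.trans hs.2)
    refine (ballVol_mono E (closedBall_subset_closedBall hq1.le)).trans (h1.trans ?_)
    have : (0 : ℝ) < q := h0.trans hq1
    gcongr

lemma measurableSet_densityZeroAt (hE : MeasurableSet E) :
    MeasurableSet {x | DensityZeroAt E x} := by
  simp_rw [densityZeroAt_iff_rat, ofPred_forall, ofPred_exists]
  refine MeasurableSet.iInter fun j => MeasurableSet.iUnion fun m => ?_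
  simp_rw [ofPred_forall]
  exact MeasurableSet.iInter fun q => MeasurableSet.iInter fun _ => MeasurableSet.iInter fun _ =>
    measurableSet_le (measurable_ballVol hE _) measurable_const

lemma measurableSet_not_densityZeroAt (hE : MeasurableSet E) :
    MeasurableSet {x | ¬ DensityZeroAt E x} :=
  (measurableSet_densityZeroAt hE).compl

lemma GradOn.measure_densityZeroAt (hE : MeasurableSet E) (h : GradOn U (E.indicator 1) ν θ) :
    ν {x | DensityZeroAt E x} = 0 := by
  rw [measure_eq_zero_iff_ae_notMem]
  filter_upwards [h.ae_lowDens_le hE] with x hx hx0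
  obtain ⟨r, h1, h2⟩ := (((densityZeroAt_iff E x).1 hx0 _ (lowDens_pos n)).and hx).exists
  linarith

lemma exists_isCompact_densityZero (hE : MeasurableSet E) (hU : IsOpen U) [IsFiniteMeasure μ]
    {ε : ℝ≥0∞} (hε : ε ≠ 0) :
    ∃ K ⊆ {x | DensityZeroAt E x} ∩ U, IsCompact K ∧
      μ (({x | DensityZeroAt E x} ∩ U) \ K) ≤ ε ∧
      ∃ j : ℕ, ∀ k ≥ j, ∀ x ∈ K,
        ballVol E x (2 * (1 / ((k : ℝ) + 1))) ≤ lowDens n * (1 / ((k : ℝ) + 1)) ^ n := by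
  set A := {x | DensityZeroAt E x} ∩ U with hA
  have hAm : MeasurableSet A := (measurableSet_densityZeroAt hE).inter hU.measurableSet
  set B : ℕ → Set (Eu n) := fun j => A ∩ ⋂ k ≥ j, {x | ballVol E x (2 * (1 / ((k : ℝ) + 1))) ≤
    lowDens n * (1 / ((k : ℝ) + 1)) ^ n} with hB
  have hBm : ∀ j, MeasurableSet (B j) := fun j => hAm.inter <|
    MeasurableSet.iInter fun k => MeasurableSet.iInter fun _ =>
      measurableSet_le (measurable_ballVol hE _) measurable_const
  have hanti : Antitone fun j => A \ B j := by
    intro i j hij x hx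
    refine ⟨hx.1, fun hxi => hx.2 ⟨hx.1, ?_⟩⟩
    have h2 := hxi.2
    simp only [mem_iInter] at h2 ⊢
    exact fun k hk => h2 k (hij.trans hk)
  have hempty : ⋂ j, A \ B j = ∅ := by
    rw [eq_empty_iff_forall_notMem]
    intro x hx
    rw [mem_iInter] at hx
    have hxA := (hx 0).1
    have ha : 0 < lowDens n / 2 ^ n := div_pos (lowDens_pos n) (by positivity)
    obtain ⟨δ, hδ, hs⟩ := mem_nhdsGT_iff_exists_Ioo_subset.1
      ((densityZeroAt_iff E x).1 hxA.1 _ ha)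
    obtain ⟨m, hm⟩ := exists_nat_one_div_lt (show (0 : ℝ) < δ / 2 from half_pos hδ)
    refine (hx m).2 ⟨hxA, ?_⟩
    simp only [mem_iInter]
    intro k hk
    have hkm : 1 / ((k : ℝ) + 1) ≤ 1 / ((m : ℝ) + 1) := by
      have : (m : ℝ) ≤ k := by exact_mod_cast hk
      gcongr
    have h0 : 0 < 1 / ((k : ℝ) + 1) := by positivity
    have h1 : ballVol E x (2 * (1 / ((k : ℝ) + 1))) <
        lowDens n / 2 ^ n * (2 * (1 / ((k : ℝ) + 1))) ^ n := hs ⟨by positivity, by linarith⟩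
    rw [mul_pow, ← mul_assoc, div_mul_cancel₀ _ (by positivity)] at h1
    exact h1.le
  have hlim := tendsto_measure_iInter_atTop (μ := μ) (s := fun j => A \ B j)
    (fun j => (hAm.diff (hBm j)).nullMeasurableSet) hanti ⟨0, measure_ne_top _ _⟩
  rw [hempty, measure_empty] at hlim
  have hε2 : 0 < ε / 2 := ENNReal.half_pos hε
  obtain ⟨j, hj⟩ := (hlim.eventually (gt_mem_nhds hε2)).exists
  obtain ⟨K, hKB, hK, hKε⟩ := (hBm j).exists_isCompact_sdiff_lt (μ := μ) (measure_ne_top _ _) hε2.ne'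
  refine ⟨K, hKB.trans inter_subset_left, hK, ?_, j, fun k hk x hx => ?_⟩
  · calc μ (A \ K) ≤ μ (A \ B j ∪ B j \ K) := measure_mono fun x hx => by
          by_cases hxB : x ∈ B j
          · exact Or.inr ⟨hxB, hx.2⟩
          · exact Or.inl ⟨hx.1, hxB⟩
      _ ≤ μ (A \ B j) + μ (B j \ K) := measure_union_le _ _
      _ ≤ ε / 2 + ε / 2 := add_le_add hj.le hKε.le
      _ = ε := ENNReal.add_halves ε
  · have h2 := (hKB hx).2
    simp only [mem_iInter] at h2
    exact h2 k hk

/-- Upper semicontinuity of divergence measures on the measure theoretic closure of a set of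
finite perimeter. -/
lemma eventually_setIntegral_le {ι : Type*} {l : Filter ι} {σk : ι → Eu n → Eu n}
    {μk : ι → Measure (Eu n)} (hE : MeasurableSet E) (h : GradOn U (E.indicator 1) ν θ)
    (hd : DivOn U σ μ) (hdk : ∀ k, DivOn U (σk k) (μk k))
    (hconv : ∀ ψ, IsTest U ψ → Tendsto (fun k => ∫ y, ψ y ∂μk k) l (𝓝 (∫ y, ψ y ∂μ)))
    {φ : Eu n → ℝ} (hφ : IsTest U φ) (hφ0 : ∀ x, 0 ≤ φ x) {ε : ℝ} (hε : 0 < ε) :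
    ∀ᶠ k in l, ∫ y in {x | ¬ DensityZeroAt E x}, φ y ∂μk k ≤
      ∫ y in {x | ¬ DensityZeroAt E x}, φ y ∂μ + ε := by
  have := h.fin
  have := hd.fin
  have hfin := fun k => (hdk k).fin
  obtain ⟨C, hC0, hC⟩ := hφ.exists_bound
  have hEp := measurableSet_not_densityZeroAt hE
  set P := {x | ¬ DensityZeroAt E x} with hP
  set b := boxConst n
  have hb : 0 ≤ b := boxConst_nonneg n
  set δ : ℝ := ε / (4 * (C + 1) * (b + 1)) with hδ
  have hδ0 : 0 < δ := by positivity
  have hδ1 : C * δ ≤ ε / 4 := by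
    rw [hδ, mul_div_assoc', div_le_div_iff₀ (by positivity) (by positivity)]
    nlinarith [mul_nonneg hC0 hε.le, mul_nonneg hb hε.le, mul_nonneg hb (mul_nonneg hC0 hε.le)]
  have hδ2 : C * (b * δ) ≤ ε / 4 := by
    rw [hδ, mul_div_assoc', mul_div_assoc', div_le_div_iff₀ (by positivity) (by positivity)]
    nlinarith [mul_nonneg hC0 hε.le, mul_nonneg hb hε.le, mul_nonneg hb (mul_nonneg hC0 hε.le)]
  obtain ⟨K, hKA, hK, hKμ, j, hj⟩ := exists_isCompact_densityZero (μ := μ) hE h.isOpen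
    (ε := ENNReal.ofReal δ) (by rw [Ne, ENNReal.ofReal_eq_zero, not_le]; exact hδ0)
  have hKν : ν K = 0 := measure_mono_null (hKA.trans inter_subset_left)
    (h.measure_densityZeroAt hE)
  obtain ⟨δU, hδU0, hδU⟩ := hK.exists_cthickening_subset_open h.isOpen
    (hKA.trans inter_subset_right)
  have hνlim : Tendsto (fun k : ℕ => ν (cthickening (5 * (1 / ((k : ℝ) + 1))) K)) atTop (𝓝 0) := by
    have h1 := tendsto_measure_cthickening_of_isCompact (μ := ν) hK
    rw [hKν] at h1
    refine h1.comp ?_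
    simpa using (tendsto_one_div_add_atTop_nhds_zero_nat (𝕜 := ℝ)).const_mul 5
  have hRlim : Tendsto (fun k : ℕ => 41 * (1 / ((k : ℝ) + 1))) atTop (𝓝 0) := by
    simpa using (tendsto_one_div_add_atTop_nhds_zero_nat (𝕜 := ℝ)).const_mul 41
  obtain ⟨k₀, hk₀ν, hk₀U, hk₀j⟩ := ((hνlim.eventually (gt_mem_nhds
    (show (0 : ℝ≥0∞) < ENNReal.ofReal δ by rw [ENNReal.ofReal_pos]; exact hδ0))).and
    ((hRlim.eventually (gt_mem_nhds hδU0)).and (eventually_ge_atTop j))).exists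
  set R : ℝ := 1 / ((k₀ : ℝ) + 1) with hR
  have hR0 : 0 < R := by positivity
  have hballU : ∀ x ∈ K, closedBall x (41 * R) ⊆ U := fun x hx =>
    (closedBall_subset_cthickening hx _).trans ((cthickening_mono hk₀U.le K).trans hδU)
  have hbox : ∀ k, (μk k).real ({y | ∃ x ∈ K, dist y x ≤ R} ∩ P) ≤ b * δ := by
    intro k
    have h1 := boxing hE h (hdk k) hR0 hballU (hj k₀ hk₀j)
    have h2 : ν {y | ∃ x ∈ K, dist y x ≤ 5 * R} ≤ ENNReal.ofReal δ :=
      (measure_mono fun y hy => by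
        obtain ⟨x, hx, hyx⟩ := hy
        exact mem_cthickening_of_dist_le y x _ K hx hyx).trans hk₀ν.le
    refine ENNReal.toReal_le_of_le_ofReal (by positivity) ?_
    rw [ENNReal.ofReal_mul hb]
    exact h1.trans (mul_le_mul_right h2 _)
  obtain ⟨η, hη, hη01, hη1⟩ := exists_isTest_one hK
    (isOpen_thickening.inter h.isOpen : IsOpen (thickening R K ∩ U))
    (subset_inter (self_subset_thickening hR0 K) (hKA.trans inter_subset_right))
  have hψ : IsTest U (fun y => φ y * (1 - η y)) :=
    hφ.mul_contDiff (contDiff_const.sub hη.contDiff)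
  have hupper : ∀ k, ∫ y in P, φ y ∂μk k ≤ ∫ y, φ y * (1 - η y) ∂μk k + ε / 4 := by
    intro k
    set S := thickening R K ∩ P with hS
    have hSm : MeasurableSet S := isOpen_thickening.measurableSet.inter hEp
    have hS' : (μk k).real S ≤ b * δ := by
      refine (measureReal_mono ?_).trans (hbox k)
      rintro y ⟨hy, hyP⟩
      obtain ⟨x, hx, hyx⟩ := mem_thickening_iff.1 hy
      exact ⟨⟨x, hx, hyx.le⟩, hyP⟩
    have h1 : ∫ y in P, φ y ∂μk k ≤
        ∫ y, (φ y * (1 - η y) + S.indicator (fun _ => C) y) ∂μk k := by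
      rw [← integral_indicator hEp]
      refine integral_mono ((hφ.integrable _).indicator hEp)
        ((hψ.integrable _).add ((integrable_const C).indicator hSm)) fun y => ?_
      have hη' := hη01 y
      have hφy := hφ0 y
      have hCy := (le_abs_self _).trans (hC y)
      by_cases hyP : y ∈ P
      · rw [indicator_of_mem hyP]
        by_cases hyS : y ∈ S
        · rw [indicator_of_mem hyS]
          nlinarith [hη'.1, hη'.2, mul_nonneg hφy (sub_nonneg.2 hη'.2)]
        · have : η y = 0 := hη.zero_of_notMem fun hy => hyS ⟨hy.1, hyP⟩
          rw [indicator_of_notMem hyS, this]; simp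
      · rw [indicator_of_notMem hyP]
        exact add_nonneg (mul_nonneg hφy (sub_nonneg.2 hη'.2))
          (indicator_nonneg (fun _ _ => hC0) _)
    rw [integral_add (hψ.integrable _) ((integrable_const C).indicator hSm),
      integral_indicator hSm, setIntegral_const, smul_eq_mul] at h1
    have : (μk k).real S * C ≤ ε / 4 := by
      refine le_trans ?_ hδ2
      rw [mul_comm]; gcongr
    linarith
  have hlower : ∫ y, φ y * (1 - η y) ∂μ ≤ ∫ y in P, φ y ∂μ + ε / 4 := by
    set S := ({x | DensityZeroAt E x} ∩ U) \ K with hS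
    have hSm : MeasurableSet S := ((measurableSet_densityZeroAt hE).inter
      h.isOpen.measurableSet).diff hK.measurableSet
    have hS' : μ.real S ≤ δ := ENNReal.toReal_le_of_le_ofReal hδ0.le hKμ
    have h1 : ∫ y, φ y * (1 - η y) ∂μ ≤
        ∫ y, (P.indicator φ y + S.indicator (fun _ => C) y) ∂μ := by
      refine integral_mono (hψ.integrable _) (((hφ.integrable _).indicator hEp).add
        ((integrable_const C).indicator hSm)) fun y => ?_
      have hη' := hη01 y
      have hφy := hφ0 y
      have hCy := (le_abs_self _).trans (hC y)
      have hle : φ y * (1 - η y) ≤ φ y := by nlinarith [hη'.1]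
      by_cases hyP : y ∈ P
      · simp only [indicator_of_mem hyP]
        have := indicator_nonneg (s := S) (f := fun _ => C) (fun _ _ => hC0) y
        linarith
      · simp only [indicator_of_notMem hyP]
        by_cases hyS : y ∈ S
        · rw [indicator_of_mem hyS]; linarith
        · rw [indicator_of_notMem hyS]
          by_cases hyU : y ∈ U
          · have hyK : y ∈ K := by
              by_contra hyK
              exact hyS ⟨⟨not_not.1 hyP, hyU⟩, hyK⟩
            rw [hη1 y hyK]; simp
          · rw [hφ.zero_of_notMem hyU]; simp
    rw [integral_add ((hφ.integrable _).indicator hEp) ((integrable_const C).indicator hSm),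
      integral_indicator hEp, integral_indicator hSm, setIntegral_const, smul_eq_mul] at h1
    have : μ.real S * C ≤ ε / 4 := by
      refine le_trans ?_ hδ1
      rw [mul_comm]; gcongr
    linarith
  filter_upwards [(hconv _ hψ).eventually (gt_mem_nhds (show ∫ y, φ y * (1 - η y) ∂μ <
    ∫ y, φ y * (1 - η y) ∂μ + ε / 4 by linarith))] with k hk
  linarith [hupper k]

end UpperSemicontinuity

section LowerSemicontinuity

variable {n : ℕ} {U : Set (Eu n)} {ν μ : Measure (Eu n)} {θ σ X : Eu n → Eu n} {f φ : Eu n → ℝ}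

/-- Smooth vector fields compactly supported in `U`. -/
structure IsTestField (U : Set (Eu n)) (X : Eu n → Eu n) : Prop where
  contDiff : ContDiff ℝ (⊤ : ℕ∞) X
  hasCompactSupport : HasCompactSupport X
  tsupport_subset : tsupport X ⊆ U

/-- The divergence of a vector field. -/
def divg (X : Eu n → Eu n) (x : Eu n) : ℝ :=
  ∑ i, fderiv ℝ (fun y => X y i) x (EuclideanSpace.single i 1)

lemma IsTestField.isTest (h : IsTestField U X) (i : Fin n) : IsTest U (fun y => X y i) :=
  ⟨contDiff_euclidean.1 h.contDiff i, h.hasCompactSupport.comp_left (g := fun v : Eu n => v i) rfl,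
    (tsupport_comp_subset (g := fun v : Eu n => v i) rfl X).trans h.tsupport_subset⟩

lemma IsTestField.isTest_divg (h : IsTestField U X) : IsTest U (divg X) := by
  have hz : IsTest U (fun _ : Eu n => (0 : ℝ)) :=
    ⟨contDiff_const, HasCompactSupport.zero, by
      have : tsupport (fun _ : Eu n => (0 : ℝ)) = ∅ := by simp
      rw [this]; exact empty_subset _⟩
  have : ∀ s : Finset (Fin n),
      IsTest U (fun x => ∑ i ∈ s, fderiv ℝ (fun y => X y i) x (EuclideanSpace.single i 1)) := by
    intro s
    induction s using Finset.cons_induction with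
    | empty => simpa using hz
    | cons a s ha ih =>
      simp only [Finset.sum_cons]
      exact ((h.isTest a).fderiv_apply _).add ih
  exact this Finset.univ

lemma sum_apply_smul_single (v : Eu n) : ∑ i, v i • EuclideanSpace.single i (1 : ℝ) = v := by
  have := (EuclideanSpace.basisFun (Fin n) ℝ).sum_repr v
  simpa using this

lemma sum_mul_inner_single (v w : Eu n) :
    ∑ i, v i * ⟪w, EuclideanSpace.single i (1 : ℝ)⟫ = ⟪w, v⟫ := by
  conv_rhs => rw [← sum_apply_smul_single v, inner_sum]
  simp only [inner_smul_right]

lemma sum_mul_clm_single (L : Eu n →L[ℝ] ℝ) (v : Eu n) :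
    ∑ i, v i * L (EuclideanSpace.single i (1 : ℝ)) = L v := by
  conv_rhs => rw [← sum_apply_smul_single v, map_sum]
  simp only [map_smul, smul_eq_mul]

lemma integral_mul_divg (hf : LocallyIntegrable f) (hX : IsTestField U X) :
    ∫ y, f y * divg X y =
      ∑ i, ∫ y, f y * fderiv ℝ (fun z => X z i) y (EuclideanSpace.single i 1) := by
  unfold divg
  simp_rw [Finset.mul_sum]
  refine integral_finsetSum _ fun i _ => ?_
  have ht := (hX.isTest i).fderiv_apply (EuclideanSpace.single i 1)
  simpa [smul_eq_mul, mul_comm] using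
    hf.integrable_smul_left_of_hasCompactSupport ht.continuous ht.hasCompactSupport

lemma GradOn.integral_mul_divg (h : GradOn U f ν θ) (hX : IsTestField U X) :
    ∫ y, f y * divg X y = - ∫ y, ⟪θ y, X y⟫ ∂ν := by
  have := h.fin
  rw [_root_.integral_mul_divg h.locallyIntegrable hX]
  simp_rw [h.ibp _ (hX.isTest _)]
  rw [Finset.sum_neg_distrib, ← integral_finsetSum]
  · simp_rw [sum_mul_inner_single]
  · intro i _
    obtain ⟨C, -, hC⟩ := (hX.isTest i).exists_bound
    exact (h.integrable_dir.inner_const _).bdd_mul (c := C)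
      (hX.isTest i).continuous.aestronglyMeasurable (Eventually.of_forall hC)

lemma integral_mul_divg_of_contDiff (hf : ContDiff ℝ (⊤ : ℕ∞) f) (hX : IsTestField U X) :
    ∫ y, f y * divg X y = - ∫ y, fderiv ℝ f y (X y) := by
  have hfd : ∀ i : Fin n, Continuous fun x => fderiv ℝ f x (EuclideanSpace.single i 1) := fun i =>
    (hf.continuous_fderiv (by simp)).clm_apply continuous_const
  have hInt : ∀ i : Fin n, Integrable
      (fun x => fderiv ℝ f x (EuclideanSpace.single i 1) * X x i) := fun i =>
    ((hfd i).mul (hX.isTest i).continuous).integrable_of_hasCompactSupport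
      (hX.isTest i).hasCompactSupport.mul_left
  rw [_root_.integral_mul_divg hf.continuous.locallyIntegrable hX]
  have : ∀ i : Fin n, ∫ y, f y * fderiv ℝ (fun z => X z i) y (EuclideanSpace.single i 1) =
      - ∫ y, fderiv ℝ f y (EuclideanSpace.single i 1) * X y i := by
    intro i
    have ht := (hX.isTest i).fderiv_apply (EuclideanSpace.single i 1)
    refine integral_mul_fderiv_eq_neg_fderiv_mul_of_integrable (hInt i) ?_ ?_
      (fun x _ => hf.differentiable (by simp) x) (fun x _ => (hX.isTest i).differentiable x)
    · exact (hf.continuous.mul ht.continuous).integrable_of_hasCompactSupport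
        ht.hasCompactSupport.mul_left
    · exact (hf.continuous.mul (hX.isTest i).continuous).integrable_of_hasCompactSupport
        (hX.isTest i).hasCompactSupport.mul_left
  simp_rw [this]
  rw [Finset.sum_neg_distrib, ← integral_finsetSum _ fun i _ => hInt i]
  simp_rw [mul_comm _ (X _ _), sum_mul_clm_single]

lemma neg_integral_mul_divg_le (hf : ContDiff ℝ (⊤ : ℕ∞) f) (hX : IsTestField U X)
    (hφ : IsTest U φ) (hXφ : ∀ x, ‖X x‖ ≤ φ x) :
    - ∫ y, f y * divg X y ≤ ∫ y, φ y * ‖fderiv ℝ f y‖ := by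
  rw [integral_mul_divg_of_contDiff hf hX, neg_neg]
  have hfd := hf.continuous_fderiv (by simp)
  have h1 : Integrable fun y => fderiv ℝ f y (X y) := by
    refine (hfd.clm_apply hX.contDiff.continuous).integrable_of_hasCompactSupport
      (hX.hasCompactSupport.mono fun x hx hx0 => hx ?_)
    simp [hx0]
  refine integral_mono h1 ((hφ.continuous.mul hfd.norm).integrable_of_hasCompactSupport
    hφ.hasCompactSupport.mul_right) fun y => ?_
  refine (le_abs_self _).trans (((fderiv ℝ f y).le_opNorm (X y)).trans ?_)
  rw [mul_comm]
  exact mul_le_mul_of_nonneg_right (hXφ y) (norm_nonneg _)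

lemma norm_sub_inv_max_smul_le {V : Type*} [NormedAddCommGroup V] [NormedSpace ℝ V] {a g : V}
    (ha : ‖a‖ = 1) : ‖a - (max 1 ‖g‖)⁻¹ • g‖ ≤ 2 * ‖a - g‖ := by
  have h1 : ‖g - (max 1 ‖g‖)⁻¹ • g‖ ≤ ‖a - g‖ := by
    rcases le_total ‖g‖ 1 with h | h
    · rw [max_eq_left h]; simp
    · rw [max_eq_right h]
      have h0 : 0 < ‖g‖ := by linarith
      have : g - ‖g‖⁻¹ • g = ((‖g‖ - 1) * ‖g‖⁻¹) • g := by
        rw [sub_mul, mul_inv_cancel₀ h0.ne', one_mul, sub_smul, one_smul]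
      rw [this, norm_smul, norm_mul, norm_inv, norm_norm, mul_assoc, inv_mul_cancel₀ h0.ne',
        mul_one, Real.norm_of_nonneg (by linarith), ← ha, norm_sub_rev a]
      exact norm_sub_norm_le _ _
  calc ‖a - (max 1 ‖g‖)⁻¹ • g‖ ≤ ‖a - g‖ + ‖g - (max 1 ‖g‖)⁻¹ • g‖ := norm_sub_le_norm_sub_add_norm_sub _ _ _
    _ ≤ _ := by linarith

/-- The polar vector is approximated by smooth fields in `L¹`. -/
lemma exists_smooth_dir [IsFiniteMeasure ν] (hθm : Integrable θ ν) (hθ : ∀ᵐ x ∂ν, ‖θ x‖ = 1)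
    {ε : ℝ} (hε : 0 < ε) :
    ∃ G : Eu n → Eu n, ContDiff ℝ (⊤ : ℕ∞) G ∧ (∀ x, ‖G x‖ ≤ 1 + ε) ∧ Integrable G ν ∧
      ∫ x, ‖θ x - G x‖ ∂ν ≤ ε := by
  set δ : ℝ := min ε (ε / (2 * (1 + ν.real univ))) with hδ
  have hN : 0 ≤ ν.real univ := measureReal_nonneg
  have hδ0 : 0 < δ := lt_min hε (by positivity)
  obtain ⟨g, hgc, hgle, hg, hgi⟩ := hθm.exists_hasCompactSupport_integral_sub_le
    (show 0 < ε / 4 by positivity)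
  set g' : Eu n → Eu n := fun x => (max 1 ‖g x‖)⁻¹ • g x with hg'
  have hpos : ∀ x, 0 < max 1 ‖g x‖ := fun x => lt_max_of_lt_left one_pos
  have hg'c : Continuous g' :=
    ((continuous_const.max hg.norm).inv₀ fun x => (hpos x).ne').smul hg
  have hg'1 : ∀ x, ‖g' x‖ ≤ 1 := fun x => by
    rw [hg', norm_smul, norm_inv, Real.norm_of_nonneg (hpos x).le, inv_mul_le_iff₀ (hpos x),
      mul_one]
    exact le_max_right _ _
  obtain ⟨G, hG, hGg, -⟩ := hg'c.exists_contDiff_approx ⊤ (ε := fun _ => δ) continuous_const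
    (fun _ => hδ0)
  have hG1 : ∀ x, ‖G x‖ ≤ 1 + ε := fun x => by
    have h1 := hGg x
    rw [dist_eq_norm] at h1
    have h2 : ‖G x‖ ≤ ‖G x - g' x‖ + ‖g' x‖ := by
      simpa using norm_add_le (G x - g' x) (g' x)
    linarith [hg'1 x, min_le_left ε (ε / (2 * (1 + ν.real univ)))]
  have hGi : Integrable G ν := Integrable.of_bound hG.continuous.aestronglyMeasurable _
    (Eventually.of_forall hG1)
  refine ⟨G, hG, hG1, hGi, ?_⟩
  have hi1 : Integrable (fun x => 2 * ‖θ x - g x‖) ν := ((hθm.sub hgi).norm).const_mul 2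
  calc ∫ x, ‖θ x - G x‖ ∂ν ≤ ∫ x, (2 * ‖θ x - g x‖ + δ) ∂ν := by
        refine integral_mono_ae (hθm.sub hGi).norm (hi1.add (integrable_const δ)) ?_
        filter_upwards [hθ] with x hx
        have h1 := norm_sub_inv_max_smul_le (g := g x) hx
        have h2 := (hGg x).le
        rw [dist_eq_norm, norm_sub_rev] at h2
        have h3 := norm_sub_le_norm_sub_add_norm_sub (θ x) (g' x) (G x)
        simp only [hg'] at h2 h3 ⊢
        linarith
    _ = 2 * ∫ x, ‖θ x - g x‖ ∂ν + ν.real univ * δ := by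
        rw [integral_add hi1 (integrable_const δ), integral_const_mul, integral_const, smul_eq_mul]
    _ ≤ 2 * (ε / 4) + ν.real univ * (ε / (2 * (1 + ν.real univ))) := by
        gcongr; exact min_le_right _ _
    _ ≤ ε := by
        have : ν.real univ * (ε / (2 * (1 + ν.real univ))) ≤ ε / 2 := by
          rw [mul_div_assoc', div_le_div_iff₀ (by positivity) (by positivity)]
          nlinarith
        linarith

lemma exists_isTestField_inner_ge [IsFiniteMeasure ν] (hθm : Integrable θ ν)
    (hθ : ∀ᵐ x ∂ν, ‖θ x‖ = 1) (hφ : IsTest U φ) (hφ0 : ∀ x, 0 ≤ φ x) {ε : ℝ} (hε : 0 < ε) :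
    ∃ X, IsTestField U X ∧ (∀ x, ‖X x‖ ≤ φ x) ∧ ∫ x, φ x ∂ν ≤ ∫ x, ⟪θ x, X x⟫ ∂ν + ε := by
  obtain ⟨C, hC0, hC⟩ := hφ.exists_bound
  have hA : 0 ≤ ∫ x, φ x ∂ν := integral_nonneg hφ0
  set A := ∫ x, φ x ∂ν with hAdef
  set δ := ε / (C + A + 1) with hδ
  have hδ0 : 0 < δ := by positivity
  obtain ⟨G, hG, hG1, hGi, hGθ⟩ := exists_smooth_dir hθm hθ hδ0
  have hφG : IsTestField U fun x => ((1 + δ)⁻¹ * φ x) • G x := by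
    have ht := hφ.const_mul (1 + δ)⁻¹
    exact ⟨ht.contDiff.smul hG, ht.hasCompactSupport.smul_right,
      (tsupport_smul_subset_left _ _).trans ht.2.2⟩
  have hi : Integrable (fun x => φ x * ⟪θ x, G x⟫) ν := by
    refine Integrable.bdd_mul (c := C) ?_ hφ.continuous.aestronglyMeasurable
      (Eventually.of_forall hC)
    refine Integrable.of_bound (hθm.1.inner hGi.1) (1 + δ) ?_
    filter_upwards [hθ] with x hx
    refine (norm_inner_le_norm _ _).trans ?_
    rw [hx, one_mul]; exact hG1 x
  have hkey : A - C * δ ≤ ∫ x, φ x * ⟪θ x, G x⟫ ∂ν := by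
    have h1 : A - ∫ x, φ x * ⟪θ x, G x⟫ ∂ν ≤ ∫ x, C * ‖θ x - G x‖ ∂ν := by
      rw [hAdef, ← integral_sub (hφ.integrable ν) hi]
      refine integral_mono_ae ((hφ.integrable ν).sub hi) ((hθm.sub hGi).norm.const_mul C) ?_
      filter_upwards [hθ] with x hx
      have h2 : 1 - ⟪θ x, G x⟫ = ⟪θ x, θ x - G x⟫ := by
        rw [inner_sub_right, real_inner_self_eq_norm_sq, hx]; norm_num
      have h3 : ⟪θ x, θ x - G x⟫ ≤ ‖θ x - G x‖ := by
        simpa [hx] using real_inner_le_norm (θ x) (θ x - G x)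
      calc φ x - φ x * ⟪θ x, G x⟫ = φ x * (1 - ⟪θ x, G x⟫) := by ring
        _ ≤ φ x * ‖θ x - G x‖ := by rw [h2]; exact mul_le_mul_of_nonneg_left h3 (hφ0 x)
        _ ≤ C * ‖θ x - G x‖ :=
          mul_le_mul_of_nonneg_right ((le_abs_self _).trans (hC x)) (norm_nonneg _)
    rw [integral_const_mul] at h1
    have h2 : C * ∫ x, ‖θ x - G x‖ ∂ν ≤ C * δ := by gcongr
    linarith
  refine ⟨_, hφG, fun x => ?_, ?_⟩
  · rw [norm_smul, Real.norm_of_nonneg (mul_nonneg (by positivity) (hφ0 x)), mul_comm _ (φ x),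
      mul_assoc]
    refine mul_le_of_le_one_right (hφ0 x) ?_
    rw [inv_mul_le_iff₀ (by positivity), mul_one]
    exact hG1 x
  · have h1 : ∫ x, ⟪θ x, ((1 + δ)⁻¹ * φ x) • G x⟫ ∂ν = (1 + δ)⁻¹ * ∫ x, φ x * ⟪θ x, G x⟫ ∂ν := by
      rw [← integral_const_mul]
      simp only [inner_smul_right, mul_assoc]
    rw [h1]
    have h2 : A - ε ≤ (1 + δ)⁻¹ * (A - C * δ) := by
      rw [le_inv_mul_iff₀ (by positivity)]
      have h3 : (C + A + 1) * δ = ε := by rw [hδ]; field_simp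
      nlinarith [mul_nonneg hδ0.le hε.le]
    have h4 : (1 + δ)⁻¹ * (A - C * δ) ≤ (1 + δ)⁻¹ * ∫ x, φ x * ⟪θ x, G x⟫ ∂ν := by gcongr
    linarith

/-- Lower semicontinuity of the total variation. -/
lemma GradOn.eventually_integral_le {ι : Type*} {l : Filter ι} {fj : ι → Eu n → ℝ} {V : ι → ℝ}
    (h : GradOn U f ν θ) (hφ : IsTest U φ) (hφ0 : ∀ x, 0 ≤ φ x)
    (hconv : ∀ ψ, IsTest U ψ → Tendsto (fun j => ∫ y, fj j y * ψ y) l (𝓝 (∫ y, f y * ψ y)))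
    (hV : ∀ᶠ j in l, ∀ X, IsTestField U X → (∀ x, ‖X x‖ ≤ φ x) → - ∫ y, fj j y * divg X y ≤ V j)
    {ε : ℝ} (hε : 0 < ε) :
    ∀ᶠ j in l, ∫ y, φ y ∂ν ≤ V j + ε := by
  have := h.fin
  obtain ⟨X, hX, hXφ, hle⟩ := exists_isTestField_inner_ge h.integrable_dir h.norm_dir hφ hφ0
    (half_pos hε)
  have h1 := (hconv _ hX.isTest_divg).neg
  rw [h.integral_mul_divg hX, neg_neg] at h1
  filter_upwards [hV, h1.eventually (lt_mem_nhds (show ∫ y, ⟪θ y, X y⟫ ∂ν - ε / 2 <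
    ∫ y, ⟪θ y, X y⟫ ∂ν by linarith))] with j hj hj'
  linarith [hj X hX hXφ]

end LowerSemicontinuity

section SetInequality

variable {n : ℕ} {U E : Set (Eu n)} {ν μ : Measure (Eu n)} {θ σ X : Eu n → Eu n} {f φ : Eu n → ℝ}

lemma tendsto_integral_mul_of_ae {fj : ℕ → Eu n → ℝ} {w : Eu n → ℝ} {M : ℝ} {m : Measure (Eu n)}
    (hm : ∀ j, Measurable (fj j)) (hb : ∀ j x, |fj j x| ≤ M)
    (hlim : ∀ᵐ x ∂m, Tendsto (fun j => fj j x) atTop (𝓝 (f x))) (hw : Integrable w m) :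
    Tendsto (fun j => ∫ y, fj j y * w y ∂m) atTop (𝓝 (∫ y, f y * w y ∂m)) := by
  refine tendsto_integral_of_dominated_convergence (fun y => M * ‖w y‖)
    (fun j => (hm j).aestronglyMeasurable.mul hw.1) (hw.norm.const_mul M)
    (fun j => Eventually.of_forall fun y => ?_) ?_
  · rw [norm_mul]
    exact mul_le_mul_of_nonneg_right (hb j y) (norm_nonneg _)
  · filter_upwards [hlim] with y hy
    exact hy.mul_const _

/-- Mollification does not increase the total variation asymptotically. -/
lemma GradOn.eventually_integral_fderiv_mol_le (h : GradOn U f ν θ) (hφ : IsTest U φ)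
    (hφ0 : ∀ x, 0 ≤ φ x) {ε : ℝ} (hε : 0 < ε) :
    ∀ᶠ j in atTop, ∫ y, φ y * ‖fderiv ℝ (mol (bumpSeq n j) f) y‖ ≤ ∫ y, φ y ∂ν + ε := by
  have := h.fin
  have hN : 0 ≤ ν.real univ := measureReal_nonneg
  set δ := ε / (ν.real univ + 1) with hδ
  have hδ0 : 0 < δ := by positivity
  obtain ⟨r, hr, hrφ⟩ := Metric.uniformContinuous_iff.1
    (hφ.hasCompactSupport.uniformContinuous_of_continuous hφ.continuous) δ hδ0
  obtain ⟨s, hs, hsU⟩ := hφ.hasCompactSupport.isCompact.exists_cthickening_subset_open h.isOpen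
    hφ.2.2
  filter_upwards [(tendsto_bumpSeq_rOut n).eventually (gt_mem_nhds hr),
    (tendsto_bumpSeq_rOut n).eventually (gt_mem_nhds hs)] with j hjr hjs
  set b := bumpSeq n j
  have hcont : Continuous fun y => ‖fderiv ℝ (mol b f) y‖ :=
    ((contDiff_mol b h.locallyIntegrable).continuous_fderiv (by simp)).norm
  have hInt : Integrable fun y => φ y * ‖fderiv ℝ (mol b f) y‖ :=
    (hφ.continuous.mul hcont).integrable_of_hasCompactSupport hφ.hasCompactSupport.mul_right
  have h1 := h.lintegral_fderiv_mol_le b (w := fun y => ENNReal.ofReal (φ y))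
    hφ.continuous.measurable.ennreal_ofReal (fun y hy => by
      have hy' : y ∈ tsupport φ := by
        by_contra hn
        exact hy (by simp [image_eq_zero_of_notMem_tsupport hn])
      exact (closedBall_subset_cthickening hy' _).trans ((cthickening_mono hjs.le _).trans hsU))
  have h2 : ∀ z, ∫⁻ y, ENNReal.ofReal (φ y) * ENNReal.ofReal (b.normed volume (y - z)) ≤
      ENNReal.ofReal (φ z + δ) := fun z => by
    calc ∫⁻ y, ENNReal.ofReal (φ y) * ENNReal.ofReal (b.normed volume (y - z))
        ≤ ∫⁻ y, ENNReal.ofReal (φ z + δ) * ENNReal.ofReal (b.normed volume (y - z)) := by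
          refine lintegral_mono fun y => ?_
          by_cases hyz : b.rOut ≤ dist y z
          · rw [mol_kernel_eq_zero b hyz]; simp
          · have h3 := hrφ ((not_le.1 hyz).trans hjr)
            rw [Real.dist_eq] at h3
            have h4 := (abs_lt.1 h3).2
            gcongr
            linarith
      _ = ENNReal.ofReal (φ z + δ) := by
          rw [lintegral_const_mul' _ _ ENNReal.ofReal_ne_top, lintegral_mol_kernel, mul_one]
  have hInt' : Integrable (fun y => φ y + δ) ν := (hφ.integrable ν).add (integrable_const δ)
  have h3 : ENNReal.ofReal (∫ y, φ y * ‖fderiv ℝ (mol b f) y‖) ≤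
      ENNReal.ofReal (∫ y, (φ y + δ) ∂ν) := by
    rw [ofReal_integral_eq_lintegral_ofReal hInt
        (Eventually.of_forall fun y => mul_nonneg (hφ0 y) (norm_nonneg _)),
      ofReal_integral_eq_lintegral_ofReal hInt'
        (Eventually.of_forall fun y => add_nonneg (hφ0 y) hδ0.le)]
    simp_rw [ENNReal.ofReal_mul (hφ0 _), ofReal_norm]
    exact h1.trans (lintegral_mono h2)
  rw [ENNReal.ofReal_le_ofReal_iff (integral_nonneg fun y => add_nonneg (hφ0 y) hδ0.le),
    integral_add (hφ.integrable ν) (integrable_const δ), integral_const, smul_eq_mul] at h3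
  have h4 : ν.real univ * δ ≤ ε := by
    rw [hδ, mul_div_assoc', div_le_iff₀ (by positivity)]
    nlinarith
  linarith

/-- The Leibniz rule for the divergence measure. -/
lemma DivOn.integral_mul_eq (hd : DivOn U σ μ) (hφ : IsTest U φ) (hf : ContDiff ℝ (⊤ : ℕ∞) f) :
    ∫ y, φ y * f y ∂μ = (∫ y, f y * fderiv ℝ φ y (σ y)) + ∫ y, φ y * fderiv ℝ f y (σ y) := by
  have hfd : ∀ y, fderiv ℝ (fun x => φ x * f x) y (σ y) =
      f y * fderiv ℝ φ y (σ y) + φ y * fderiv ℝ f y (σ y) := by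
    intro y
    have h1 : HasFDerivAt (fun x => φ x * f x) (φ y • fderiv ℝ f y + f y • fderiv ℝ φ y) y :=
      (hφ.differentiable y).hasFDerivAt.mul (hf.differentiable (by simp) y).hasFDerivAt
    rw [h1.fderiv]
    simp [add_comm]
  have hm : ∀ g : Eu n → ℝ, ContDiff ℝ (⊤ : ℕ∞) g →
      AEStronglyMeasurable (fun y => fderiv ℝ g y (σ y)) volume := fun g hg => by
    have : Continuous fun p : Eu n × Eu n => fderiv ℝ g p.1 p.2 :=
      ((hg.continuous_fderiv (by simp)).comp continuous_fst).clm_apply continuous_snd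
    exact (this.measurable.comp (measurable_id.prodMk hd.meas)).aestronglyMeasurable
  have hbd : ∀ g : Eu n → ℝ, ∀ y, ‖fderiv ℝ g y (σ y)‖ ≤ ‖fderiv ℝ g y‖ := fun g y =>
    ((fderiv ℝ g y).le_opNorm _).trans (mul_le_of_le_one_right (norm_nonneg _) (hd.norm_le y))
  rw [← hd.ibp _ (hφ.mul_contDiff hf)]
  simp_rw [hfd]
  refine integral_add ?_ ?_
  · have hi : Integrable fun y => f y * ‖fderiv ℝ φ y‖ :=
      (hf.continuous.mul hφ.continuous_fderiv.norm).integrable_of_hasCompactSupport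
        (hφ.hasCompactSupport.fderiv ℝ).norm.mul_left
    refine hi.mono (hf.continuous.aestronglyMeasurable.mul (hm φ hφ.contDiff))
      (Eventually.of_forall fun y => ?_)
    rw [norm_mul, norm_mul, norm_norm]
    exact mul_le_mul_of_nonneg_left (hbd φ y) (norm_nonneg _)
  · have hi : Integrable fun y => φ y * ‖fderiv ℝ f y‖ :=
      (hφ.continuous.mul (hf.continuous_fderiv (by simp)).norm).integrable_of_hasCompactSupport
        hφ.hasCompactSupport.mul_right
    refine hi.mono (hφ.continuous.aestronglyMeasurable.mul (hm f hf))
      (Eventually.of_forall fun y => ?_)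
    rw [norm_mul, norm_mul, norm_norm]
    exact mul_le_mul_of_nonneg_left (hbd f y) (norm_nonneg _)

lemma le_mol_indicator (hE : MeasurableSet E) (j : ℕ) {x : Eu n}
    (hx : lowDens n * (bumpSeq n j).rIn ^ n ≤ ballVol E x (bumpSeq n j).rIn) :
    lowDens n / (2 ^ n * unitVol n) ≤ mol (bumpSeq n j) (E.indicator 1) x := by
  set b := bumpSeq n j with hb
  have hω := unitVol_pos n
  have hin := b.rIn_pos
  have hout : b.rOut = 2 * b.rIn := by
    rw [hb, bumpSeq_rOut, bumpSeq_rIn]; field_simp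
  set I : ℝ := ∫ z, b z ∂(volume : Measure (Eu n)) with hI
  have hI0 : 0 < I := b.integral_pos
  have hI1 : I ≤ (2 * b.rIn) ^ n * unitVol n := by
    rw [← hout, ← volume_real_closedBall 0 b.rOut_pos.le]
    exact b.integral_le_measure_closedBall _
  have hS : MeasurableSet (E ∩ closedBall x b.rIn) := hE.inter measurableSet_closedBall
  have hbdd : ∃ M, ∀ y, |E.indicator (1 : Eu n → ℝ) y| ≤ M := ⟨1, fun y => by
    by_cases hy : y ∈ E <;> simp [hy]⟩
  have h1 : ballVol E x b.rIn / I ≤ mol b (E.indicator 1) x := by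
    have h2 : ballVol E x b.rIn / I = ∫ z, (E ∩ closedBall x b.rIn).indicator (fun _ => I⁻¹) z := by
      rw [integral_indicator hS, setIntegral_const, smul_eq_mul, div_eq_mul_inv]; rfl
    rw [h2]
    refine integral_mono ((integrable_indicator_iff hS).2
        (integrableOn_const (inter_closedBall_ne_top _ _ _)))
      (integrable_mol_integrand b (measurable_one.indicator hE) hbdd x) fun z => ?_
    by_cases hz : z ∈ E ∩ closedBall x b.rIn
    · have hz1 : z ∈ E := hz.1
      have hz2 : x - z ∈ closedBall (0 : Eu n) b.rIn := by
        have := hz.2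
        rw [mem_closedBall, dist_comm, dist_eq_norm] at this
        rwa [mem_closedBall_zero_iff]
      rw [indicator_of_mem hz]
      simp only [indicator_of_mem hz1, Pi.one_apply, mul_one, ContDiffBump.normed,
        b.one_of_mem_closedBall hz2, one_div]
      exact le_rfl
    · rw [indicator_of_notMem hz]
      exact mul_nonneg (b.nonneg_normed _) (indicator_nonneg (fun _ _ => zero_le_one) _)
  refine le_trans ?_ h1
  calc lowDens n / (2 ^ n * unitVol n)
      = lowDens n * b.rIn ^ n / ((2 * b.rIn) ^ n * unitVol n) := by
        rw [mul_pow]; field_simp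
    _ ≤ ballVol E x b.rIn / I := div_le_div₀ (ballVol_nonneg _ _ _) hx hI0 hI1

/-- A smooth monotone profile vanishing at zero and equal to one beyond `c`. -/
lemma exists_profile {c : ℝ} (hc : 0 < c) :
    ∃ (H : ℝ → ℝ) (L : ℝ), ContDiff ℝ (⊤ : ℕ∞) H ∧ H 0 = 0 ∧ (∀ t, c ≤ t → H t = 1) ∧
      (∀ t, 0 ≤ H t ∧ H t ≤ 1) ∧ 2 ≤ L ∧ ∀ t ∈ Icc (0 : ℝ) 1, 0 ≤ deriv H t ∧ deriv H t ≤ L := by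
  set H : ℝ → ℝ := fun t => Real.smoothTransition (t / c) with hH
  have hHs : ContDiff ℝ (⊤ : ℕ∞) H := by
    have h1 : ContDiff ℝ (⊤ : ℕ∞) (fun t : ℝ => t / c) := contDiff_id.div_const c
    have h2 : ContDiff ℝ (⊤ : ℕ∞) Real.smoothTransition := Real.smoothTransition.contDiff
    exact h2.comp h1
  have hmono : Monotone H := fun s t hst =>
    Real.smoothTransition.monotone (by gcongr)
  obtain ⟨L, hL⟩ := (isCompact_Icc (a := (0 : ℝ)) (b := 1)).exists_bound_of_continuousOn
    (hHs.continuous_deriv (by simp)).continuousOn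
  refine ⟨H, max L 2, hHs, ?_, ?_, fun t => ⟨Real.smoothTransition.nonneg _,
    Real.smoothTransition.le_one _⟩, le_max_right _ _, fun t ht => ⟨hmono.deriv_nonneg, ?_⟩⟩
  · exact Real.smoothTransition.zero_of_nonpos (by simp)
  · intro t ht
    exact Real.smoothTransition.one_of_one_le ((one_le_div hc).2 ht)
  · exact (le_abs_self _).trans ((hL t ht).trans (le_max_left _ _))

lemma abs_indicator_one_le (E : Set (Eu n)) (y : Eu n) : |E.indicator (1 : Eu n → ℝ) y| ≤ 1 := by
  by_cases hy : y ∈ E <;> simp [hy]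

lemma mol_indicator_mem_Icc (hE : MeasurableSet E) (b : ContDiffBump (0 : Eu n)) (y : Eu n) :
    mol b (E.indicator 1) y ∈ Icc (0 : ℝ) 1 := by
  have hm : Measurable (E.indicator (1 : Eu n → ℝ)) := measurable_one.indicator hE
  exact ⟨le_mol b hm ⟨1, abs_indicator_one_le E⟩
      (fun x => indicator_nonneg (fun _ _ => zero_le_one) x) y,
    mol_le b hm ⟨1, abs_indicator_one_le E⟩
      (fun x => (le_abs_self _).trans (abs_indicator_one_le E x)) y⟩

lemma GradOn.eventually_integral_fderiv_comp_le (hE : MeasurableSet E)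
    (h : GradOn U (E.indicator 1) ν θ) (hφ : IsTest U φ) (hφ0 : ∀ x, 0 ≤ φ x) {H : ℝ → ℝ} {L : ℝ}
    (hH : ContDiff ℝ (⊤ : ℕ∞) H) (hH0 : H 0 = 0) (hH1 : H 1 = 1) (hL : 2 ≤ L)
    (hHb : ∀ t, 0 ≤ H t ∧ H t ≤ 1)
    (hHL : ∀ t ∈ Icc (0 : ℝ) 1, 0 ≤ deriv H t ∧ deriv H t ≤ L) {ε : ℝ} (hε : 0 < ε) :
    ∀ᶠ j in atTop,
      ∫ y, φ y * ‖fderiv ℝ (fun x => H (mol (bumpSeq n j) (E.indicator 1) x)) y‖ ≤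
        ∫ y, φ y ∂ν + ε := by
  set g : ℕ → Eu n → ℝ := fun j => mol (bumpSeq n j) (E.indicator 1) with hg
  have hgs : ∀ j, ContDiff ℝ (⊤ : ℕ∞) (g j) := fun j => contDiff_mol _ h.locallyIntegrable
  have hg01 : ∀ j y, g j y ∈ Icc (0 : ℝ) 1 := fun j y => mol_indicator_mem_Icc hE _ y
  set k : ℕ → Eu n → ℝ := fun j y => (L - 1)⁻¹ * (L * g j y - H (g j y)) with hk
  have hL1 : 0 < L - 1 := by linarith
  have hHg : ∀ j, ContDiff ℝ (⊤ : ℕ∞) fun y => H (g j y) := fun j => hH.comp (hgs j)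
  have hks : ∀ j, ContDiff ℝ (⊤ : ℕ∞) (k j) := fun j =>
    contDiff_const.mul ((contDiff_const.mul (hgs j)).sub (hHg j))
  have hdH : ∀ j y, HasFDerivAt (fun x => H (g j x)) (deriv H (g j y) • fderiv ℝ (g j) y) y :=
    fun j y => (hH.differentiable (by simp) _).hasDerivAt.comp_hasFDerivAt y
      ((hgs j).differentiable (by simp) y).hasFDerivAt
  have hnH : ∀ j y, ‖fderiv ℝ (fun x => H (g j x)) y‖ =
      deriv H (g j y) * ‖fderiv ℝ (g j) y‖ := fun j y => by
    rw [(hdH j y).fderiv, norm_smul, Real.norm_of_nonneg (hHL _ (hg01 j y)).1]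
  have hnk : ∀ j y, ‖fderiv ℝ (k j) y‖ =
      (L - 1)⁻¹ * (L * ‖fderiv ℝ (g j) y‖ - ‖fderiv ℝ (fun x => H (g j x)) y‖) := fun j y => by
    have hd : HasFDerivAt (k j) ((L - 1)⁻¹ • (L • fderiv ℝ (g j) y -
        deriv H (g j y) • fderiv ℝ (g j) y)) y :=
      ((((hgs j).differentiable (by simp) y).hasFDerivAt.const_mul L).sub (hdH j y)).const_mul _
    rw [hd.fderiv, ← sub_smul, smul_smul, norm_smul, norm_mul, hnH,
      Real.norm_of_nonneg (by positivity),
      Real.norm_of_nonneg (sub_nonneg.2 (hHL _ (hg01 j y)).2)]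
    ring
  have hkb : ∀ j y, |k j y| ≤ (L - 1)⁻¹ * (L + 1) := fun j y => by
    rw [hk, abs_mul, abs_of_pos (inv_pos.2 hL1)]
    gcongr
    have h1 := hg01 j y
    have h2 := hHb (g j y)
    rw [abs_le]
    constructor <;> nlinarith [h1.1, h1.2]
  have hlim : ∀ᵐ x : Eu n, Tendsto (fun j => k j x) atTop (𝓝 (E.indicator 1 x)) := by
    filter_upwards [ae_tendsto_mol h.locallyIntegrable] with x hx
    have h1 : Tendsto (fun j => k j x) atTop
        (𝓝 ((L - 1)⁻¹ * (L * E.indicator 1 x - H (E.indicator 1 x)))) :=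
      ((hx.const_mul L).sub ((hH.continuous.tendsto _).comp hx)).const_mul _
    convert h1 using 2
    by_cases hxE : x ∈ E
    · simp only [indicator_of_mem hxE, Pi.one_apply, hH1]
      field_simp
    · simp only [indicator_of_notMem hxE, hH0]; simp
  have hInt : ∀ f : Eu n → ℝ, ContDiff ℝ (⊤ : ℕ∞) f →
      Integrable fun y => φ y * ‖fderiv ℝ f y‖ := fun f hf =>
    (hφ.continuous.mul (hf.continuous_fderiv (by simp)).norm).integrable_of_hasCompactSupport
      hφ.hasCompactSupport.mul_right
  set δ := ε / (2 * L) with hδ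
  have hδ0 : 0 < δ := by positivity
  have hlsc := h.eventually_integral_le (l := atTop) (fj := k)
    (V := fun j => ∫ y, φ y * ‖fderiv ℝ (k j) y‖) hφ hφ0
    (fun ψ hψ => tendsto_integral_mul_of_ae (fun j => (hks j).continuous.measurable) hkb hlim
      (hψ.integrable volume))
    (Eventually.of_forall fun j X hX hXφ => neg_integral_mul_divg_le (hks j) hX hφ hXφ) hδ0
  filter_upwards [hlsc, h.eventually_integral_fderiv_mol_le hφ hφ0 hδ0] with j hj hj'
  have hsplit : ∫ y, φ y * ‖fderiv ℝ (k j) y‖ = (L - 1)⁻¹ *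
      (L * (∫ y, φ y * ‖fderiv ℝ (g j) y‖) - ∫ y, φ y * ‖fderiv ℝ (fun x => H (g j x)) y‖) := by
    rw [← integral_const_mul, ← integral_sub ((hInt _ (hgs j)).const_mul L) (hInt _ (hHg j)),
      ← integral_const_mul]
    refine integral_congr_ae (Eventually.of_forall fun y => ?_)
    simp only [hnk j y]
    ring
  rw [hsplit] at hj
  have h1 : (L - 1) * (∫ y, φ y ∂ν - δ) ≤ L * (∫ y, φ y * ‖fderiv ℝ (g j) y‖) -
      ∫ y, φ y * ‖fderiv ℝ (fun x => H (g j x)) y‖ := by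
    rw [← le_inv_mul_iff₀ hL1]
    linarith
  have h2 : L * (∫ y, φ y * ‖fderiv ℝ (g j) y‖) ≤ L * (∫ y, φ y ∂ν + δ) :=
    mul_le_mul_of_nonneg_left hj' (by linarith)
  have h3 : 2 * L * δ = ε := by rw [hδ]; field_simp
  change ∫ y, φ y * ‖fderiv ℝ (fun x => H (g j x)) y‖ ≤ _
  linarith

/-- The pairing inequality for a set of finite perimeter. -/
lemma GradOn.setIntegral_le (hE : MeasurableSet E) (h : GradOn U (E.indicator 1) ν θ)
    (hd : DivOn U σ μ) (hφ : IsTest U φ) (hφ0 : ∀ x, 0 ≤ φ x) :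
    ∫ y in {x | ¬ DensityZeroAt E x}, φ y ∂μ ≤
      ∫ y, φ y ∂ν + ∫ y, E.indicator 1 y * fderiv ℝ φ y (σ y) := by
  have := hd.fin
  have hω := unitVol_pos n
  set c := lowDens n / (2 ^ n * unitVol n) with hc
  have hc0 : 0 < c := div_pos (lowDens_pos n) (by positivity)
  have hc1 : c ≤ 1 := by
    have h1 := two_pow_mul_lowDens_le n
    rw [hc, div_le_one (by positivity)]
    have h2 : (1 : ℝ) ≤ 2 ^ n := one_le_pow₀ (by norm_num)
    nlinarith [lowDens_pos n]
  obtain ⟨H, L, hH, hH0, hH1, hHb, hL, hHL⟩ := exists_profile hc0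
  set g : ℕ → Eu n → ℝ := fun j x => H (mol (bumpSeq n j) (E.indicator 1) x) with hg
  have hgs : ∀ j, ContDiff ℝ (⊤ : ℕ∞) (g j) := fun j => hH.comp (contDiff_mol _ h.locallyIntegrable)
  have hgb : ∀ j x, |g j x| ≤ 1 := fun j x => by
    rw [abs_of_nonneg (hHb _).1]; exact (hHb _).2
  have hwi : Integrable fun y => fderiv ℝ φ y (σ y) := by
    have hcont : Continuous fun p : Eu n × Eu n => fderiv ℝ φ p.1 p.2 :=
      (hφ.continuous_fderiv.comp continuous_fst).clm_apply continuous_snd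
    refine hφ.integrable_fderiv.mono
      (hcont.measurable.comp (measurable_id.prodMk hd.meas)).aestronglyMeasurable
      (Eventually.of_forall fun y => ?_)
    exact ((fderiv ℝ φ y).le_opNorm _).trans
      (mul_le_of_le_one_right (norm_nonneg _) (hd.norm_le y))
  have hlim1 : Tendsto (fun j => ∫ y, g j y * fderiv ℝ φ y (σ y)) atTop
      (𝓝 (∫ y, E.indicator 1 y * fderiv ℝ φ y (σ y))) := by
    refine tendsto_integral_mul_of_ae (fun j => (hgs j).continuous.measurable) hgb ?_ hwi
    filter_upwards [ae_tendsto_mol h.locallyIntegrable] with x hx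
    have h1 := (hH.continuous.tendsto _).comp hx
    have h2 : H (E.indicator 1 x) = E.indicator 1 x := by
      by_cases hxE : x ∈ E
      · rw [indicator_of_mem hxE]; exact hH1 1 hc1
      · rw [indicator_of_notMem hxE]; exact hH0
    rw [h2] at h1
    exact h1
  set P := {x | ¬ DensityZeroAt E x} with hP
  have hPm : MeasurableSet P := measurableSet_not_densityZeroAt hE
  have hlim2 : Tendsto (fun j => ∫ y in P, g j y * φ y ∂μ) atTop (𝓝 (∫ y in P, φ y ∂μ)) := by
    have h1 := tendsto_integral_mul_of_ae (f := fun _ => 1) (m := μ.restrict P)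
      (fun j => (hgs j).continuous.measurable) hgb (w := φ) ?_ (hφ.integrable μ).restrict
    · simpa using h1
    rw [ae_restrict_iff' hPm]
    filter_upwards [ae_densityZero_or_lowDens_le hE h hd] with x hx hxP
    have h2 := hx.resolve_left hxP
    have hrin : Tendsto (fun j => (bumpSeq n j).rIn) atTop (𝓝[>] 0) := by
      rw [tendsto_nhdsWithin_iff]
      refine ⟨?_, Eventually.of_forall fun j => (bumpSeq n j).rIn_pos⟩
      exact squeeze_zero (fun j => (bumpSeq n j).rIn_pos.le) (fun j => (bumpSeq n j).rIn_lt_rOut.le)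
        (tendsto_bumpSeq_rOut n)
    refine tendsto_const_nhds.congr' ?_
    filter_upwards [hrin.eventually h2] with j hj
    exact (hH1 _ (le_mol_indicator hE j hj)).symm
  refine le_of_forall_pos_le_add fun ε hε => ?_
  have hev := h.eventually_integral_fderiv_comp_le hE hφ hφ0 hH hH0 (hH1 1 hc1) hL hHb hHL hε
  refine le_of_tendsto_of_tendsto hlim2 ((tendsto_const_nhds (x := ∫ y, φ y ∂ν + ε)).add hlim1) ?_
    |>.trans_eq (by ring)
  filter_upwards [hev] with j hj
  have h1 : ∫ y in P, g j y * φ y ∂μ ≤ ∫ y, φ y * g j y ∂μ := by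
    simp_rw [mul_comm (g j _)]
    exact setIntegral_le_integral ((hφ.mul_contDiff (hgs j)).integrable μ)
      (Eventually.of_forall fun y => mul_nonneg (hφ0 y) (hHb _).1)
  rw [hd.integral_mul_eq hφ (hgs j)] at h1
  have h2 : ∫ y, φ y * fderiv ℝ (g j) y (σ y) ≤ ∫ y, φ y * ‖fderiv ℝ (g j) y‖ := by
    have hi : Integrable fun y => φ y * ‖fderiv ℝ (g j) y‖ :=
      (hφ.continuous.mul ((hgs j).continuous_fderiv
        (by simp)).norm).integrable_of_hasCompactSupport hφ.hasCompactSupport.mul_right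
    refine (Real.le_norm_self _).trans (norm_integral_le_of_norm_le hi
      (Eventually.of_forall fun y => ?_))
    rw [norm_mul, Real.norm_of_nonneg (hφ0 y)]
    exact mul_le_mul_of_nonneg_left (((fderiv ℝ (g j) y).le_opNorm _).trans
      (mul_le_of_le_one_right (norm_nonneg _) (hd.norm_le y))) (hφ0 y)
  linarith

end SetInequality

section WeakLimits

open scoped CompactlySupported NNReal

lemma integrable_of_measure_tsupport_lt_top {X : Type*} [TopologicalSpace X] [MeasurableSpace X]
    [OpensMeasurableSpace X] {m : Measure X} {f : X → ℝ} (hf : Continuous f)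
    (hc : HasCompactSupport f) (hm : m (tsupport f) < ∞) : Integrable f m := by
  obtain ⟨C, hC⟩ := hf.bounded_above_of_compact_support hc
  rw [← integrableOn_iff_integrable_of_support_subset (subset_tsupport f)]
  exact Measure.integrableOn_of_bounded (M := C) hm.ne hf.aestronglyMeasurable
    (Eventually.of_forall hC)

lemma norm_integral_le_of_measure_tsupport_le {X : Type*} [TopologicalSpace X] [MeasurableSpace X]
    {m : Measure X} {f : X → ℝ} {B : ℝ} {C : ℝ≥0} (hB : ∀ x, ‖f x‖ ≤ B)
    (hm : m (tsupport f) ≤ C) (hB0 : 0 ≤ B) : ‖∫ x, f x ∂m‖ ≤ B * C := by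
  rw [← setIntegral_eq_integral_of_forall_compl_eq_zero (s := tsupport f)
    fun x hx => image_eq_zero_of_notMem_tsupport hx]
  refine (norm_setIntegral_le_of_norm_le_const (hm.trans_lt ENNReal.coe_lt_top)
    fun x _ => hB x).trans ?_
  gcongr
  exact ENNReal.toReal_mono ENNReal.coe_ne_top hm

/-- Vague compactness of locally bounded families of measures, along an ultrafilter. -/
lemma exists_vague_limit {X ι : Type*} [TopologicalSpace X] [T2Space X] [LocallyCompactSpace X]
    [MeasurableSpace X] [BorelSpace X] (𝒰 : Ultrafilter ι) (m : ι → Measure X)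
    (hb : ∀ K, IsCompact K → ∃ C : ℝ≥0, ∀ᶠ j in (𝒰 : Filter ι), m j K ≤ C) :
    ∃ μ : Measure X, IsFiniteMeasureOnCompacts μ ∧ ∀ f : X → ℝ, Continuous f →
      HasCompactSupport f → Tendsto (fun j => ∫ x, f x ∂m j) 𝒰 (𝓝 (∫ x, f x ∂μ)) := by
  have hlim : ∀ f : C_c(X, ℝ), ∃ a : ℝ, Tendsto (fun j => ∫ x, f x ∂m j) 𝒰 (𝓝 a) := by
    intro f
    obtain ⟨C, hC⟩ := hb (tsupport f) f.hasCompactSupport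
    obtain ⟨B, hB⟩ := f.continuous.bounded_above_of_compact_support f.hasCompactSupport
    have h1 : ∀ᶠ j in (𝒰 : Filter ι), ∫ x, f x ∂m j ∈ closedBall (0 : ℝ) (max B 0 * C) := by
      filter_upwards [hC] with j hj
      rw [mem_closedBall_zero_iff]
      exact norm_integral_le_of_measure_tsupport_le (fun x => (hB x).trans (le_max_left _ _)) hj
        (le_max_right _ _)
    obtain ⟨a, -, ha⟩ := (isCompact_closedBall (0 : ℝ) (max B 0 * C)).ultrafilter_le_nhds
      (𝒰.map fun j => ∫ x, f x ∂m j) (by rw [le_principal_iff]; exact h1)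
    exact ⟨a, ha⟩
  have hInt : ∀ f : C_c(X, ℝ), ∀ᶠ j in (𝒰 : Filter ι), Integrable f (m j) := by
    intro f
    obtain ⟨C, hC⟩ := hb (tsupport f) f.hasCompactSupport
    filter_upwards [hC] with j hj
    exact integrable_of_measure_tsupport_lt_top f.continuous f.hasCompactSupport
      (hj.trans_lt ENNReal.coe_lt_top)
  choose L hL using hlim
  let Λ : C_c(X, ℝ) →ₚ[ℝ] ℝ := PositiveLinearMap.mk₀
    { toFun := L
      map_add' := fun f g => by
        refine tendsto_nhds_unique (hL (f + g)) (((hL f).add (hL g)).congr' ?_)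
        filter_upwards [hInt f, hInt g] with j hf hg
        exact (integral_add hf hg).symm
      map_smul' := fun c f => by
        refine tendsto_nhds_unique (hL (c • f)) (((hL f).const_mul c).congr fun j => ?_)
        exact (integral_const_mul c _).symm }
    (fun f hf => ge_of_tendsto' (hL f) fun j => integral_nonneg fun x => hf x)
  refine ⟨RealRMK.rieszMeasure Λ, inferInstance, fun f hf hc => ?_⟩
  have h1 := RealRMK.integral_rieszMeasure Λ ⟨⟨f, hf⟩, hc⟩
  have h2 := hL ⟨⟨f, hf⟩, hc⟩
  change Tendsto _ _ (𝓝 (Λ _)) at h2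
  rw [← h1] at h2
  exact h2

/-- Vague compactness on an open subset of Euclidean space. -/
lemma exists_locFinOn_limit {n : ℕ} {ι : Type*} {Ω : Set (Eu n)} (hΩ : IsOpen Ω)
    (𝒰 : Ultrafilter ι) (m : ι → Measure (Eu n))
    (hb : ∀ K ⊆ Ω, IsCompact K → ∃ C : ℝ≥0, ∀ᶠ j in (𝒰 : Filter ι), m j K ≤ C) :
    ∃ μ : Measure (Eu n), LocFinOn Ω μ ∧ ∀ f : Eu n → ℝ, Continuous f →
      HasCompactSupport f → tsupport f ⊆ Ω →
      Tendsto (fun j => ∫ x, f x ∂m j) 𝒰 (𝓝 (∫ x, f x ∂μ)) := by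
  have : LocallyCompactSpace Ω := hΩ.locallyCompactSpace
  have hemb : MeasurableEmbedding ((↑) : Ω → Eu n) := .subtype_coe hΩ.measurableSet
  obtain ⟨μ, hμ, hμl⟩ := exists_vague_limit 𝒰 (fun j => (m j).comap ((↑) : Ω → Eu n))
    (fun K hK => by
      obtain ⟨C, hC⟩ := hb ((↑) '' K) (Subtype.coe_image_subset _ _)
        (hK.image continuous_subtype_val)
      refine ⟨C, hC.mono fun j hj => ?_⟩
      rwa [hemb.comap_apply])
  refine ⟨μ.map (↑), ⟨fun K hK hKc => ?_, ?_⟩, fun f hf hc hs => ?_⟩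
  · rw [hemb.map_apply]
    exact (IsInducing.subtypeVal.isCompact_preimage' hKc (by simpa using hK)).measure_lt_top
  · rw [hemb.map_apply]
    simp
  · have h1 := hμl (fun x => f x) (hf.comp continuous_subtype_val) ?_
    · rw [hemb.integral_map]
      refine h1.congr fun j => ?_
      rw [integral_subtype_comap hΩ.measurableSet (fun x => f x)]
      exact setIntegral_eq_integral_of_forall_compl_eq_zero fun x hx =>
        image_eq_zero_of_notMem_tsupport fun h => hx (hs h)
    · have hk : IsCompact (((↑) : Ω → Eu n) ⁻¹' tsupport f) :=
        IsInducing.subtypeVal.isCompact_preimage' hc (by simpa using hs)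
      exact HasCompactSupport.of_support_subset_isCompact hk fun x hx => subset_tsupport f hx

end WeakLimits

section Existence

open scoped NNReal

variable {n : ℕ} {U : Set (Eu n)}

/-- Polar decomposition of the vector measure with components `α i - β i`. -/
lemma exists_polar (α β : Fin n → Measure (Eu n)) [∀ i, IsFiniteMeasure (α i)]
    [∀ i, IsFiniteMeasure (β i)] (hα : ∀ i, α i Uᶜ = 0) (hβ : ∀ i, β i Uᶜ = 0) :
    ∃ (ν : Measure (Eu n)) (θ : Eu n → Eu n), IsFiniteMeasure ν ∧ ν Uᶜ = 0 ∧ Measurable θ ∧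
      (∀ᵐ x ∂ν, ‖θ x‖ = 1) ∧ ∀ (φ : Eu n → ℝ) (C : ℝ), Measurable φ → (∀ x, |φ x| ≤ C) →
        ∀ i, ∫ x, φ x * θ x i ∂ν = ∫ x, φ x ∂α i - ∫ x, φ x ∂β i := by
  set m : Measure (Eu n) := ∑ i, (α i + β i) with hm
  have hmf : IsFiniteMeasure m := ⟨by
    rw [hm, Measure.finsetSum_apply]
    exact ENNReal.sum_lt_top.2 fun i _ => measure_lt_top _ _⟩
  have hleb : ∀ γ : Measure (Eu n), IsFiniteMeasure γ → γ.HaveLebesgueDecomposition m :=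
    fun γ _ => Measure.haveLebesgueDecomposition_of_sigmaFinite γ m
  have hlα := fun i => hleb (α i) inferInstance
  have hlβ := fun i => hleb (β i) inferInstance
  have hle : ∀ i, α i + β i ≤ m := fun i => by
    rw [hm, ← Finset.add_sum_erase _ _ (Finset.mem_univ i)]
    exact Measure.le_add_right le_rfl
  have hαm : ∀ i, α i ≪ m := fun i =>
    ((Measure.le_add_right le_rfl).trans (hle i)).absolutelyContinuous
  have hβm : ∀ i, β i ≪ m := fun i =>
    ((Measure.le_add_left le_rfl).trans (hle i)).absolutelyContinuous
  set v : Eu n → Eu n := fun x => WithLp.toLp 2 fun i =>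
    ((α i).rnDeriv m x).toReal - ((β i).rnDeriv m x).toReal with hv
  have hvi : ∀ x i, v x i = ((α i).rnDeriv m x).toReal - ((β i).rnDeriv m x).toReal :=
    fun x i => rfl
  have hvm : Measurable v := by
    refine (PiLp.continuous_toLp 2 _).measurable.comp (measurable_pi_lambda _ fun i => ?_)
    exact (Measure.measurable_rnDeriv _ _).ennreal_toReal.sub
      (Measure.measurable_rnDeriv _ _).ennreal_toReal
  have hvint : Integrable v m := by
    have : v = fun x => ∑ i, v x i • EuclideanSpace.single i (1 : ℝ) := by
      funext x; exact (sum_apply_smul_single _).symm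
    rw [this]
    refine integrable_finsetSum _ fun i _ => Integrable.smul_const ?_ _
    exact Measure.integrable_toReal_rnDeriv.sub Measure.integrable_toReal_rnDeriv
  set ν := m.withDensity fun x => (‖v x‖₊ : ℝ≥0∞) with hν
  have hνm : ν ≪ m := withDensity_absolutelyContinuous _ _
  refine ⟨ν, fun x => ‖v x‖⁻¹ • v x, ?_, hνm ?_, hvm.norm.inv.smul hvm, ?_, ?_⟩
  · exact isFiniteMeasure_withDensity hvint.2.ne
  · simp [hm, hα, hβ]
  · rw [hν, ae_withDensity_iff hvm.nnnorm.coe_nnreal_ennreal]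
    refine Eventually.of_forall fun x hx => ?_
    have : ‖v x‖ ≠ 0 := by simpa using hx
    rw [norm_smul, norm_inv, norm_norm, inv_mul_cancel₀ this]
  · intro φ C hφ hC i
    have hi : ∀ (γ : Measure (Eu n)), IsFiniteMeasure γ → γ ≪ m →
        Integrable (fun x => (γ.rnDeriv m x).toReal • φ x) m := fun γ h hγ =>
      have := hleb γ h
      (integrable_rnDeriv_smul_iff hγ).2 (Integrable.of_bound (μ := γ) hφ.aestronglyMeasurable C
        (Eventually.of_forall hC))
    rw [hν, integral_withDensity_eq_integral_smul hvm.nnnorm,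
      ← integral_rnDeriv_smul (hαm i), ← integral_rnDeriv_smul (hβm i),
      ← integral_sub (hi _ inferInstance (hαm i)) (hi _ inferInstance (hβm i))]
    refine integral_congr_ae (Eventually.of_forall fun x => ?_)
    simp only [PiLp.smul_apply, smul_eq_mul, NNReal.smul_def, coe_nnnorm]
    rw [← sub_mul, ← hvi]
    by_cases h0 : v x = 0
    · simp [h0]
    · have : ‖v x‖ ≠ 0 := norm_ne_zero_iff.2 h0
      field_simp

/-- A weak limit of smooth functions with locally bounded variation has a gradient measure. -/
lemma exists_gradOn {ι : Type*} {U' : Set (Eu n)} {f : Eu n → ℝ} {fj : ι → Eu n → ℝ}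
    (𝒰 : Ultrafilter ι) (hU : IsOpen U) (hU' : IsOpen U') (hc : IsCompact (closure U'))
    (hUU : closure U' ⊆ U) (hf : Measurable f) (hfb : ∃ M, ∀ x, |f x| ≤ M)
    (hfj : ∀ j, ContDiff ℝ (⊤ : ℕ∞) (fj j))
    (hconv : ∀ ψ, IsTest U ψ → Tendsto (fun j => ∫ y, fj j y * ψ y) 𝒰 (𝓝 (∫ y, f y * ψ y)))
    (hb : ∀ K ⊆ U, IsCompact K →
      ∃ C : ℝ≥0, ∀ᶠ j in (𝒰 : Filter ι), ∫⁻ y in K, ‖fderiv ℝ (fj j) y‖ₑ ≤ C) :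
    ∃ ν θ, GradOn U' f ν θ := by
  have hfd : ∀ j (e : Eu n), Continuous fun x => fderiv ℝ (fj j) x e := fun j e =>
    ((hfj j).continuous_fderiv (by simp)).clm_apply continuous_const
  have key : ∀ e : Eu n, ‖e‖ ≤ 1 → ∃ μ : Measure (Eu n), LocFinOn U μ ∧ ∀ φ : Eu n → ℝ,
      Continuous φ → HasCompactSupport φ → tsupport φ ⊆ U →
      Tendsto (fun j => ∫ x, φ x ∂volume.withDensity
        fun y => (Real.toNNReal (fderiv ℝ (fj j) y e) : ℝ≥0∞)) 𝒰 (𝓝 (∫ x, φ x ∂μ)) := by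
    intro e he
    refine exists_locFinOn_limit hU 𝒰 _ fun K hK hKc => ?_
    obtain ⟨C, hC⟩ := hb K hK hKc
    refine ⟨C, hC.mono fun j hj => le_trans ?_ hj⟩
    rw [withDensity_apply _ hKc.measurableSet]
    refine lintegral_mono fun y => ?_
    rw [← ofReal_norm]
    refine ENNReal.ofReal_le_ofReal ((le_abs_self _).trans (((fderiv ℝ (fj j) y).le_opNorm e).trans
      (mul_le_of_le_one_right (norm_nonneg _) he)))
  have hs : ∀ i : Fin n, ‖EuclideanSpace.single i (1 : ℝ)‖ ≤ 1 := fun i => by simp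
  choose α hα hαl using fun i : Fin n => key (EuclideanSpace.single i 1) (hs i)
  choose β hβ hβl using fun i : Fin n => key (-EuclideanSpace.single i 1) (by simp)
  have hfin : ∀ γ : Measure (Eu n), LocFinOn U γ → IsFiniteMeasure (γ.restrict U') := fun γ hγ =>
    ⟨by
      rw [Measure.restrict_apply_univ]
      exact (measure_mono subset_closure).trans_lt (hγ.1 _ hUU hc)⟩
  have := fun i => hfin _ (hα i)
  have := fun i => hfin _ (hβ i)
  have hnull : ∀ γ : Measure (Eu n), γ.restrict U' U'ᶜ = 0 := fun γ => by
    rw [Measure.restrict_apply hU'.measurableSet.compl]; simp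
  obtain ⟨ν, θ, hν, hν0, hθ, hθ1, hrep⟩ := exists_polar (U := U') (fun i => (α i).restrict U')
    (fun i => (β i).restrict U') (fun i => hnull _) (fun i => hnull _)
  refine ⟨ν, θ, hU', hf, hfb, hν, hν0, hθ, hθ1, fun φ hφ e => ?_⟩
  have hφU : IsTest U φ := hφ.mono (subset_closure.trans hUU)
  have hres : ∀ γ : Measure (Eu n), ∫ x in U', φ x ∂γ = ∫ x, φ x ∂γ := fun γ =>
    setIntegral_eq_integral_of_forall_compl_eq_zero fun x hx => hφ.zero_of_notMem hx
  have hcomp : ∀ i : Fin n, ∫ y, f y * fderiv ℝ φ y (EuclideanSpace.single i 1) =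
      - ∫ y, φ y * θ y i ∂ν := by
    intro i
    obtain ⟨C, -, hC⟩ := hφ.exists_bound
    rw [hrep φ C hφ.continuous.measurable hC i, hres, hres]
    have h1 := (hαl i φ hφ.continuous hφ.hasCompactSupport hφU.2.2).sub
      (hβl i φ hφ.continuous hφ.hasCompactSupport hφU.2.2)
    have h2 := (hconv _ (hφU.fderiv_apply (EuclideanSpace.single i 1))).neg
    refine (neg_eq_iff_eq_neg.1 (tendsto_nhds_unique h2 (h1.congr fun j => ?_)))
    have hw : ∀ e : Eu n, Measurable fun y => Real.toNNReal (fderiv ℝ (fj j) y e) := fun e =>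
      (hfd j e).measurable.real_toNNReal
    have hi : ∀ e : Eu n, Integrable fun y => Real.toNNReal (fderiv ℝ (fj j) y e) • φ y := fun e =>
      ((continuous_real_toNNReal.comp (hfd j e)).smul
        hφ.continuous).integrable_of_hasCompactSupport hφ.hasCompactSupport.smul_left
    rw [integral_withDensity_eq_integral_smul (hw _), integral_withDensity_eq_integral_smul (hw _),
      ← integral_sub (hi _) (hi _)]
    have ht := hφ.fderiv_apply (EuclideanSpace.single i 1)
    rw [integral_mul_fderiv_eq_neg_fderiv_mul_of_integrable
      (((hfd j _).mul hφ.continuous).integrable_of_hasCompactSupport hφ.hasCompactSupport.mul_left)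
      (((hfj j).continuous.mul ht.continuous).integrable_of_hasCompactSupport
        ht.hasCompactSupport.mul_left)
      (((hfj j).continuous.mul hφ.continuous).integrable_of_hasCompactSupport
        hφ.hasCompactSupport.mul_left)
      (fun x _ => (hfj j).differentiable (by simp) x) (fun x _ => hφ.differentiable x), neg_neg]
    refine integral_congr_ae (Eventually.of_forall fun y => ?_)
    simp only [NNReal.smul_def, smul_eq_mul, Real.coe_toNNReal', map_neg, ← sub_mul]
    congr 1
    rcases le_total 0 (fderiv ℝ (fj j) y (EuclideanSpace.single i 1)) with h | h
    · rw [max_eq_left h, max_eq_right (by linarith)]; ring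
    · rw [max_eq_right h, max_eq_left (by linarith)]; ring
  have hL : ∀ i, Integrable fun y => e i * (f y * fderiv ℝ φ y (EuclideanSpace.single i 1)) := by
    intro i
    have ht := hφ.fderiv_apply (EuclideanSpace.single i 1)
    refine Integrable.const_mul ?_ _
    simpa [smul_eq_mul, mul_comm] using (locallyIntegrable_of_bdd hf
      hfb).integrable_smul_left_of_hasCompactSupport ht.continuous ht.hasCompactSupport
  have hθi : ∀ i, Integrable (fun y => φ y * θ y i) ν := by
    intro i
    obtain ⟨C, hC0, hC⟩ := hφ.exists_bound
    refine Integrable.of_bound (C := C) (hφ.continuous.measurable.mul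
      ((PiLp.continuous_apply 2 _ i).measurable.comp hθ)).aestronglyMeasurable ?_
    filter_upwards [hθ1] with y hy
    rw [norm_mul]
    have h1 := PiLp.norm_apply_le (θ y) i
    exact (mul_le_mul (hC y) (h1.trans hy.le) (norm_nonneg _) hC0).trans_eq (mul_one _)
  calc ∫ y, f y * fderiv ℝ φ y e
      = ∫ y, ∑ i, e i * (f y * fderiv ℝ φ y (EuclideanSpace.single i 1)) := by
        refine integral_congr_ae (Eventually.of_forall fun y => ?_)
        simp only
        rw [← sum_mul_clm_single (fderiv ℝ φ y) e, Finset.mul_sum]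
        exact Finset.sum_congr rfl fun i _ => by ring
    _ = ∑ i, e i * -∫ y, φ y * θ y i ∂ν := by
        rw [integral_finsetSum _ fun i _ => hL i]
        simp_rw [integral_const_mul, hcomp]
    _ = - ∫ y, ∑ i, e i * (φ y * θ y i) ∂ν := by
        rw [integral_finsetSum _ fun i _ => (hθi i).const_mul _]
        simp_rw [integral_const_mul, mul_neg, Finset.sum_neg_distrib]
    _ = _ := by
        congr 1
        refine integral_congr_ae (Eventually.of_forall fun y => ?_)
        simp only
        rw [← sum_mul_inner_single, Finset.mul_sum]
        refine Finset.sum_congr rfl fun i _ => ?_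
        rw [EuclideanSpace.inner_single_right]
        simp
        ring

end Existence

section Coarea

open scoped NNReal

variable {n : ℕ} {U U' : Set (Eu n)} {ν : Measure (Eu n)} {θ : Eu n → Eu n} {u φ : Eu n → ℝ}

lemma differentiable_smoothTransition : Differentiable ℝ Real.smoothTransition :=
  (Real.smoothTransition.contDiff (n := ⊤)).differentiable (by simp)

lemma continuous_deriv_smoothTransition : Continuous (deriv Real.smoothTransition) :=
  (Real.smoothTransition.contDiff (n := ⊤)).continuous_deriv (by simp)

lemma deriv_smoothTransition_of_notMem {s : ℝ} (hs : s ∉ Icc (0 : ℝ) 1) :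
    deriv Real.smoothTransition s = 0 := by
  rw [mem_Icc, not_and_or, not_le, not_le] at hs
  rcases hs with hs | hs
  · have : Real.smoothTransition =ᶠ[𝓝 s] fun _ => 0 := by
      filter_upwards [gt_mem_nhds hs] with x hx
      exact Real.smoothTransition.zero_of_nonpos hx.le
    rw [this.deriv_eq, deriv_const]
  · have : Real.smoothTransition =ᶠ[𝓝 s] fun _ => 1 := by
      filter_upwards [lt_mem_nhds hs] with x hx
      exact Real.smoothTransition.one_of_one_le hx.le
    rw [this.deriv_eq, deriv_const]

lemma lintegral_deriv_smoothTransition {N : ℝ} (hN : 0 < N) (c : ℝ) :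
    ∫⁻ t, ENNReal.ofReal (N * deriv Real.smoothTransition (N * (c - t))) = 1 := by
  have hcont : Continuous fun t => N * deriv Real.smoothTransition (N * (c - t)) :=
    continuous_const.mul (continuous_deriv_smoothTransition.comp
      (continuous_const.mul (continuous_const.sub continuous_id)))
  have hle : c - N⁻¹ ≤ c := by linarith [inv_pos.2 hN]
  have hind : ∀ t ∉ Icc (c - N⁻¹) c,
      ENNReal.ofReal (N * deriv Real.smoothTransition (N * (c - t))) = 0 := by
    intro t ht
    rw [deriv_smoothTransition_of_notMem, mul_zero, ENNReal.ofReal_zero]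
    contrapose! ht
    rw [mem_Icc] at ht ⊢
    have h1 : 0 ≤ c - t := nonneg_of_mul_nonneg_right ht.1 hN
    have h2 : c - t ≤ N⁻¹ := by rw [← one_div, le_div_iff₀' hN]; exact ht.2
    constructor <;> linarith
  rw [← setLIntegral_eq_of_support_subset (s := Icc (c - N⁻¹) c) ?_]
  · rw [← ofReal_integral_eq_lintegral_ofReal (hcont.integrableOn_Icc)
      (Eventually.of_forall fun t => mul_nonneg hN.le Real.smoothTransition.monotone.deriv_nonneg),
      integral_Icc_eq_integral_Ioc, ← intervalIntegral.integral_of_le hle,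
      intervalIntegral.integral_eq_sub_of_hasDerivAt
        (f := fun t => - Real.smoothTransition (N * (c - t))) ?_ (hcont.intervalIntegrable _ _)]
    · simp [hN.ne']
    · intro t _
      have h1 : HasDerivAt (fun t => N * (c - t)) (N * (0 - 1)) t :=
        ((hasDerivAt_const t c).sub (hasDerivAt_id t)).const_mul N
      have h2 : HasDerivAt (fun t => Real.smoothTransition (N * (c - t)))
          (deriv Real.smoothTransition (N * (c - t)) * (N * (0 - 1))) t :=
        HasDerivAt.comp (h₂ := Real.smoothTransition) t
          (differentiable_smoothTransition (N * (c - t))).hasDerivAt h1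
      have h3 : N * deriv Real.smoothTransition (N * (c - t)) =
          -(deriv Real.smoothTransition (N * (c - t)) * (N * (0 - 1))) := by ring
      rw [h3]
      exact h2.fun_neg
  · intro t ht
    by_contra h
    exact ht (hind t h)

/-- Smooth approximation of the superlevel indicator `1_{u > t}`. -/
def levelApprox (u : Eu n → ℝ) (t : ℝ) (j : ℕ) (y : Eu n) : ℝ :=
  Real.smoothTransition (((j : ℝ) + 1) * (mol (bumpSeq n j) u y - t))

lemma contDiff_levelApprox (hu : LocallyIntegrable u) (t : ℝ) (j : ℕ) :
    ContDiff ℝ (⊤ : ℕ∞) (levelApprox u t j) :=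
  Real.smoothTransition.contDiff.comp
    (contDiff_const.mul ((contDiff_mol _ hu).sub contDiff_const))

lemma abs_levelApprox_le (u : Eu n → ℝ) (t : ℝ) (j : ℕ) (y : Eu n) :
    |levelApprox u t j y| ≤ 1 := by
  unfold levelApprox
  rw [abs_of_nonneg (Real.smoothTransition.nonneg _)]
  exact Real.smoothTransition.le_one _

lemma enorm_fderiv_levelApprox (hu : LocallyIntegrable u) (t : ℝ) (j : ℕ) (y : Eu n) :
    ‖fderiv ℝ (levelApprox u t j) y‖ₑ =
      ENNReal.ofReal (((j : ℝ) + 1) * deriv Real.smoothTransition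
        (((j : ℝ) + 1) * (mol (bumpSeq n j) u y - t))) * ‖fderiv ℝ (mol (bumpSeq n j) u) y‖ₑ := by
  have h1 : HasFDerivAt (fun y => ((j : ℝ) + 1) * (mol (bumpSeq n j) u y - t))
      (((j : ℝ) + 1) • fderiv ℝ (mol (bumpSeq n j) u) y) y :=
    (((contDiff_mol _ hu).differentiable (by simp) y).hasFDerivAt.sub_const t).const_mul _
  have h2 : HasFDerivAt (levelApprox u t j) _ y :=
    (differentiable_smoothTransition _).hasDerivAt.comp_hasFDerivAt y h1
  rw [h2.fderiv, smul_smul, enorm_smul, mul_comm (deriv _ _), Real.enorm_of_nonneg]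
  exact mul_nonneg (by positivity) Real.smoothTransition.monotone.deriv_nonneg

lemma measurable_enorm_fderiv_levelApprox (hu : LocallyIntegrable u) (j : ℕ) :
    Measurable fun p : ℝ × Eu n => ‖fderiv ℝ (levelApprox u p.1 j) p.2‖ₑ := by
  simp_rw [enorm_fderiv_levelApprox hu]
  have h1 : Continuous (mol (bumpSeq n j) u) := (contDiff_mol _ hu).continuous
  have h2 : Continuous fun y => ‖fderiv ℝ (mol (bumpSeq n j) u) y‖ₑ :=
    ((contDiff_mol _ hu).continuous_fderiv (by simp)).enorm
  refine Measurable.mul ?_ (h2.comp continuous_snd).measurable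
  refine (Continuous.measurable ?_).ennreal_ofReal
  exact continuous_const.mul (continuous_deriv_smoothTransition.comp
    (continuous_const.mul ((h1.comp continuous_snd).sub continuous_fst)))

/-- The coarea formula for the approximations. -/
lemma lintegral_lintegral_fderiv_levelApprox (hu : LocallyIntegrable u) (j : ℕ)
    {w : Eu n → ℝ≥0∞} (hw : Measurable w) :
    ∫⁻ t, ∫⁻ y, w y * ‖fderiv ℝ (levelApprox u t j) y‖ₑ =
      ∫⁻ y, w y * ‖fderiv ℝ (mol (bumpSeq n j) u) y‖ₑ := by
  have hm := measurable_enorm_fderiv_levelApprox hu j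
  rw [lintegral_lintegral_swap ((hw.comp measurable_snd).mul hm).aemeasurable]
  refine lintegral_congr fun y => ?_
  simp_rw [enorm_fderiv_levelApprox hu]
  have hcont : Continuous fun t => ((j : ℝ) + 1) * deriv Real.smoothTransition
      (((j : ℝ) + 1) * (mol (bumpSeq n j) u y - t)) :=
    continuous_const.mul (continuous_deriv_smoothTransition.comp
      (continuous_const.mul (continuous_const.sub continuous_id)))
  rw [lintegral_const_mul _ (hcont.measurable.ennreal_ofReal.mul_const _),
    lintegral_mul_const _ hcont.measurable.ennreal_ofReal,
    lintegral_deriv_smoothTransition (by positivity), one_mul]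

lemma ae_tendsto_levelApprox (hu : LocallyIntegrable u) {t : ℝ} (ht : volume {y | u y = t} = 0) :
    ∀ᵐ y, Tendsto (fun j => levelApprox u t j y) atTop (𝓝 ({y | t < u y}.indicator 1 y)) := by
  have h0 : ∀ᵐ y, u y ≠ t := measure_eq_zero_iff_ae_notMem.1 ht
  filter_upwards [ae_tendsto_mol hu, h0] with y hy hyt
  have hN : Tendsto (fun j : ℕ => (j : ℝ) + 1) atTop atTop :=
    tendsto_atTop_add_const_right _ _ tendsto_natCast_atTop_atTop
  have hd : Tendsto (fun j => mol (bumpSeq n j) u y - t) atTop (𝓝 (u y - t)) := hy.sub_const t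
  rcases lt_or_gt_of_ne hyt with hlt | hlt
  · rw [indicator_of_notMem (by simpa using hlt.le)]
    refine tendsto_const_nhds.congr' ?_
    filter_upwards [hd.eventually (gt_mem_nhds (sub_neg.2 hlt))] with j hj
    exact (Real.smoothTransition.zero_of_nonpos (mul_nonpos_of_nonneg_of_nonpos
      (by positivity) hj.le)).symm
  · rw [indicator_of_mem (by simpa using hlt)]
    refine tendsto_const_nhds.congr' ?_
    filter_upwards [(hN.atTop_mul_pos (sub_pos.2 hlt) hd).eventually_ge_atTop 1] with j hj
    exact (Real.smoothTransition.one_of_one_le hj).symm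

/-- The coarea inequality: almost every superlevel set of a function of bounded variation has
a gradient measure, with control on the integral of the total variations. -/
lemma GradOn.exists_coarea (h : GradOn U u ν θ) (hU' : IsOpen U') (hc : IsCompact (closure U'))
    (hUU : closure U' ⊆ U) (hφ : IsTest U' φ) (hφ0 : ∀ x, 0 ≤ φ x) {ε : ℝ} (hε : 0 < ε) :
    ∃ a : ℝ → ℝ≥0∞, Measurable a ∧ ∫⁻ t, a t ≤ ENNReal.ofReal (∫ y, φ y ∂ν + ε) ∧
      ∀ᵐ t, ∃ νt θt, GradOn U' ({y | t < u y}.indicator 1) νt θt ∧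
        ENNReal.ofReal (∫ y, φ y ∂νt) ≤ a t := by
  have := h.fin
  have hu := h.locallyIntegrable
  have hφU : IsTest U φ := hφ.mono (subset_closure.trans hUU)
  obtain ⟨η, hη, hη01, W, hW, hcW, hηW⟩ := exists_isTest_one_nhdsSet hc h.isOpen hUU
  set I := ∫ y, η y ∂ν with hI
  have hI0 : 0 ≤ I := integral_nonneg fun y => (hη01 y).1
  set δ := ε / (2 * (I + 1)) with hδ
  have hδ0 : 0 < δ := by positivity
  have hψ : IsTest U fun y => φ y + δ * η y := hφU.add (hη.const_mul δ)
  have hψ0 : ∀ y, 0 ≤ φ y + δ * η y := fun y =>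
    add_nonneg (hφ0 y) (mul_nonneg hδ0.le (hη01 y).1)
  set w : Eu n → ℝ≥0∞ := fun y => ENNReal.ofReal (φ y + δ * η y) with hw
  have hwm : Measurable w := hψ.continuous.measurable.ennreal_ofReal
  set aj : ℕ → ℝ → ℝ≥0∞ := fun j t => ∫⁻ y, w y * ‖fderiv ℝ (levelApprox u t j) y‖ₑ with haj
  have hajm : ∀ j, Measurable (aj j) := fun j =>
    ((hwm.comp measurable_snd).mul (measurable_enorm_fderiv_levelApprox hu j)).lintegral_prod_right'
  have hwr : ∀ f : Eu n → ℝ, ContDiff ℝ (⊤ : ℕ∞) f → ∫⁻ y, w y * ‖fderiv ℝ f y‖ₑ =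
      ENNReal.ofReal (∫ y, (φ y + δ * η y) * ‖fderiv ℝ f y‖) := by
    intro f hf
    rw [ofReal_integral_eq_lintegral_ofReal]
    · refine lintegral_congr fun y => ?_
      rw [ENNReal.ofReal_mul (hψ0 y), ofReal_norm]
    · exact (hψ.continuous.mul
        (hf.continuous_fderiv (by simp)).norm).integrable_of_hasCompactSupport
        hψ.hasCompactSupport.mul_right
    · exact Eventually.of_forall fun y => mul_nonneg (hψ0 y) (norm_nonneg _)
  have htot : ∫⁻ t, liminf (fun j => aj j t) atTop ≤ ENNReal.ofReal (∫ y, φ y ∂ν + ε) := by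
    refine (lintegral_liminf_le hajm).trans (liminf_le_of_frequently_le' (Eventually.frequently ?_))
    filter_upwards [h.eventually_integral_fderiv_mol_le hψ hψ0 (half_pos hε)] with j hj
    rw [haj, lintegral_lintegral_fderiv_levelApprox hu j hwm, hwr _ (contDiff_mol _ hu)]
    refine ENNReal.ofReal_le_ofReal (hj.trans ?_)
    rw [integral_add (hφ.integrable ν) ((hη.integrable ν).const_mul δ), integral_const_mul, ← hI]
    have : δ * I ≤ ε / 2 := by
      have h1 : δ * (I + 1) = ε / 2 := by rw [hδ]; field_simp
      nlinarith
    linarith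
  refine ⟨fun t => liminf (fun j => aj j t) atTop, Measurable.liminf hajm, htot, ?_⟩
  have hlev : ∀ᵐ t : ℝ, volume {y | u y = t} = 0 := by
    have h1 := Measure.countable_meas_level_set_pos (μ := (volume : Measure (Eu n))) h.meas
    filter_upwards [h1.ae_notMem volume] with t ht
    simpa using ht
  filter_upwards [hlev, ae_lt_top (Measurable.liminf hajm)
    (htot.trans_lt ENNReal.ofReal_lt_top).ne] with t ht hat
  set E := {y | t < u y} with hE
  have hEm : MeasurableSet E := measurableSet_lt measurable_const h.meas
  have hlim := ae_tendsto_levelApprox hu ht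
  have hconv : ∀ ψ, IsTest univ ψ → Tendsto (fun j => ∫ y, levelApprox u t j y * ψ y) atTop
      (𝓝 (∫ y, E.indicator 1 y * ψ y)) := fun ψ hψ =>
    tendsto_integral_mul_of_ae (fun j => (contDiff_levelApprox hu t j).continuous.measurable)
      (abs_levelApprox_le u t) hlim (hψ.integrable volume)
  have hfreq : ∀ A : ℝ≥0∞, liminf (fun j => aj j t) atTop < A →
      (atTop ⊓ 𝓟 {j | aj j t < A}).NeBot := fun A hA =>
    frequently_mem_iff_neBot.1 (frequently_lt_of_liminf_lt (by isBoundedDefault) hA)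
  obtain ⟨B, hB⟩ := ENNReal.lt_iff_exists_nnreal_btwn.1 hat
  have hex : ∃ νt θt, GradOn U' (E.indicator 1) νt θt := by
    have := hfreq B hB.1
    set 𝒰 := Ultrafilter.of (atTop ⊓ 𝓟 {j | aj j t < B})
    have h𝒰 : (𝒰 : Filter ℕ) ≤ atTop ⊓ 𝓟 {j | aj j t < B} := Ultrafilter.of_le _
    refine exists_gradOn 𝒰 hW hU' hc hcW (measurable_one.indicator hEm)
      ⟨1, abs_indicator_one_le E⟩ (contDiff_levelApprox hu t)
      (fun ψ hψ => (hconv ψ (hψ.mono (subset_univ _))).mono_left (h𝒰.trans inf_le_left))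
      fun K hK hKc => ⟨δ.toNNReal⁻¹ * B, ?_⟩
    filter_upwards [h𝒰 (mem_inf_of_right (mem_principal_self _))] with j hj
    have h1 : ENNReal.ofReal δ * ∫⁻ y in K, ‖fderiv ℝ (levelApprox u t j) y‖ₑ ≤ aj j t := by
      rw [← lintegral_const_mul']
      · refine (setLIntegral_mono' hKc.measurableSet fun y hy => ?_).trans
          (setLIntegral_le_lintegral K _)
        refine mul_le_mul_left (ENNReal.ofReal_le_ofReal ?_) _
        rw [hηW y (hK hy)]
        linarith [hφ0 y]
      · exact ENNReal.ofReal_ne_top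
    rw [ENNReal.coe_mul, ENNReal.coe_inv (by simpa using hδ0)]
    rw [← ENNReal.div_eq_inv_mul, ENNReal.le_div_iff_mul_le (by simp [hδ0]) (by simp)]
    rw [mul_comm]
    exact h1.trans (le_of_lt hj)
  obtain ⟨νt, θt, hg⟩ := hex
  refine ⟨νt, θt, hg, le_of_forall_gt_imp_ge_of_dense fun A hA => ?_⟩
  have := hfreq A hA
  rcases eq_or_ne A ⊤ with rfl | hAt
  · exact le_top
  refine ENNReal.ofReal_le_of_le_toReal (le_of_forall_pos_le_add fun e he => ?_)
  have hV := hg.eventually_integral_le (l := atTop ⊓ 𝓟 {j | aj j t < A})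
    (V := fun j => ∫ y, φ y * ‖fderiv ℝ (levelApprox u t j) y‖) hφ hφ0
    (fun ψ hψ => (hconv ψ (hψ.mono (subset_univ _))).mono_left inf_le_left)
    (Eventually.of_forall fun j X hX hXφ =>
      neg_integral_mul_divg_le (contDiff_levelApprox hu t j) hX hφ hXφ) he
  obtain ⟨j, hj, hjA⟩ := (hV.and (mem_inf_of_right (mem_principal_self _))).exists
  refine hj.trans (add_le_add_left ?_ e)
  have hfd := ((contDiff_levelApprox hu t j).continuous_fderiv (by simp)).norm
  have hjA' : aj j t < A := hjA
  rw [haj] at hjA'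
  simp only [] at hjA'
  rw [hwr _ (contDiff_levelApprox hu t j)] at hjA'
  refine le_trans ?_ (ENNReal.ofReal_le_iff_le_toReal hAt |>.1 hjA'.le)
  refine integral_mono
    ((hφ.continuous.mul hfd).integrable_of_hasCompactSupport hφ.hasCompactSupport.mul_right)
    ((hψ.continuous.mul hfd).integrable_of_hasCompactSupport hψ.hasCompactSupport.mul_right)
    fun y => mul_le_mul_of_nonneg_right ?_ (norm_nonneg _)
  linarith [mul_nonneg hδ0.le (hη01 y).1]

end Coarea

section UpperRep

variable {n : ℕ} {u v : Eu n → ℝ} {x : Eu n} {M t : ℝ} {A B : Set (Eu n)}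

lemma DensityZeroAt.mono (h : DensityZeroAt B x) {r₀ : ℝ} (hr₀ : 0 < r₀)
    (hAB : volume ((A ∩ ball x r₀) \ B) = 0) : DensityZeroAt A x := by
  refine tendsto_of_tendsto_of_tendsto_of_le_of_le' tendsto_const_nhds h
    (Eventually.of_forall fun r => zero_le) ?_
  filter_upwards [Ioo_mem_nhdsGT hr₀] with r hr
  refine ENNReal.div_le_div_right ?_ _
  have hsub : A ∩ ball x r ⊆ (B ∩ ball x r) ∪ ((A ∩ ball x r₀) \ B) := by
    intro y hy
    by_cases hB : y ∈ B
    · exact Or.inl ⟨hB, hy.2⟩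
    · exact Or.inr ⟨⟨hy.1, ball_subset_ball hr.2.le hy.2⟩, hB⟩
  refine (measure_mono hsub).trans ((measure_union_le _ _).trans ?_)
  rw [hAB, add_zero]

lemma DensityZeroAt.mono_subset (h : DensityZeroAt B x) (hAB : A ⊆ B) : DensityZeroAt A x :=
  h.mono one_pos (by simp [sdiff_eq_empty.2 (inter_subset_left.trans hAB)])

lemma densityZeroAt_empty : DensityZeroAt (∅ : Set (Eu n)) x := by
  simp [DensityZeroAt]

lemma not_densityZeroAt_univ : ¬ DensityZeroAt (univ : Set (Eu n)) x := by
  intro h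
  have h1 : Tendsto (fun _ : ℝ => (1 : ℝ≥0∞)) (𝓝[>] 0) (𝓝 0) := by
    refine h.congr' ?_
    filter_upwards [self_mem_nhdsWithin] with r hr
    rw [univ_inter]
    exact ENNReal.div_self (measure_ball_pos _ _ hr).ne' measure_ball_lt_top.ne
  exact one_ne_zero (tendsto_nhds_unique tendsto_const_nhds h1)

lemma neg_le_of_densityZeroAt {r₀ : ℝ} (hr₀ : 0 < r₀)
    (hu : ∀ᵐ y ∂volume.restrict (ball x r₀), |u y| ≤ M)
    (h : DensityZeroAt {y | t < u y} x) : -M ≤ t := by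
  by_contra! htM
  refine not_densityZeroAt_univ (h.mono (A := univ) hr₀ ?_)
  rw [ae_restrict_iff' measurableSet_ball] at hu
  refine measure_mono_null (fun y hy => ?_) (ae_iff.1 hu)
  intro hc
  have h1 := (abs_le.1 (hc hy.1.2)).1
  exact hy.2 (show t < u y by linarith)

lemma densityZeroAt_of_le {r₀ : ℝ} (hr₀ : 0 < r₀)
    (hu : ∀ᵐ y ∂volume.restrict (ball x r₀), |u y| ≤ M) (ht : M ≤ t) :
    DensityZeroAt {y | t < u y} x := by
  refine densityZeroAt_empty.mono hr₀ ?_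
  rw [ae_restrict_iff' measurableSet_ball] at hu
  refine measure_mono_null (fun y hy => ?_) (ae_iff.1 hu)
  intro hc
  have h1 := (abs_le.1 (hc hy.1.2)).2
  have h2 : t < u y := hy.1.1
  linarith

lemma le_upperRep_of_not_densityZeroAt {r₀ : ℝ} (hr₀ : 0 < r₀)
    (hu : ∀ᵐ y ∂volume.restrict (ball x r₀), |u y| ≤ M)
    (h : ¬ DensityZeroAt {y | t < u y} x) : t ≤ upperRep u x := by
  refine le_csInf ⟨M, densityZeroAt_of_le hr₀ hu le_rfl⟩ fun s hs => ?_
  by_contra! hst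
  exact h (DensityZeroAt.mono_subset hs fun y hy => lt_trans hst hy)

lemma upperRep_le_of_densityZeroAt {r₀ : ℝ} (hr₀ : 0 < r₀)
    (hu : ∀ᵐ y ∂volume.restrict (ball x r₀), |u y| ≤ M)
    (h : DensityZeroAt {y | t < u y} x) : upperRep u x ≤ t :=
  csInf_le ⟨-M, fun _ hs => neg_le_of_densityZeroAt hr₀ hu hs⟩ h

lemma abs_upperRep_le_of_ae {r₀ : ℝ} (hr₀ : 0 < r₀)
    (hu : ∀ᵐ y ∂volume.restrict (ball x r₀), |u y| ≤ M) : |upperRep u x| ≤ M :=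
  abs_le.2 ⟨le_csInf ⟨M, densityZeroAt_of_le hr₀ hu le_rfl⟩ fun _ hs =>
    neg_le_of_densityZeroAt hr₀ hu hs,
    upperRep_le_of_densityZeroAt hr₀ hu (densityZeroAt_of_le hr₀ hu le_rfl)⟩

lemma abs_upperRep_le (hu : ∀ y, |u y| ≤ M) (x : Eu n) : |upperRep u x| ≤ M :=
  abs_upperRep_le_of_ae one_pos (Eventually.of_forall hu)

lemma upperRep_mono_of_ae {r₀ : ℝ} (hr₀ : 0 < r₀)
    (hu : ∀ᵐ y ∂volume.restrict (ball x r₀), |u y| ≤ M)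
    (hv : ∀ᵐ y ∂volume.restrict (ball x r₀), |v y| ≤ M)
    (huv : ∀ᵐ y ∂volume.restrict (ball x r₀), u y ≤ v y) : upperRep u x ≤ upperRep v x := by
  refine le_csInf ⟨M, densityZeroAt_of_le hr₀ hv le_rfl⟩ fun s hs => ?_
  refine upperRep_le_of_densityZeroAt hr₀ hu (DensityZeroAt.mono hs hr₀ ?_)
  rw [ae_restrict_iff' measurableSet_ball] at huv
  refine measure_mono_null (fun y hy => ?_) (ae_iff.1 huv)
  intro hc
  exact hy.2 (lt_of_lt_of_le hy.1.1 (hc hy.1.2))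

lemma upperRep_congr_of_ae {r₀ : ℝ} (hr₀ : 0 < r₀)
    (hu : ∀ᵐ y ∂volume.restrict (ball x r₀), |u y| ≤ M)
    (huv : ∀ᵐ y ∂volume.restrict (ball x r₀), u y = v y) : upperRep u x = upperRep v x := by
  have hv : ∀ᵐ y ∂volume.restrict (ball x r₀), |v y| ≤ M := by
    filter_upwards [hu, huv] with y h1 h2
    rwa [← h2]
  exact le_antisymm (upperRep_mono_of_ae hr₀ hu hv (huv.mono fun _ h => h.le))
    (upperRep_mono_of_ae hr₀ hv hu (huv.mono fun _ h => h.ge))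

lemma measurable_upperRep (hm : Measurable u) (hu : ∀ y, |u y| ≤ M) : Measurable (upperRep u) := by
  have hu' : ∀ x : Eu n, ∀ᵐ y ∂volume.restrict (ball x 1), |u y| ≤ M := fun x =>
    Eventually.of_forall hu
  refine measurable_of_Iio fun t => ?_
  have : upperRep u ⁻¹' Iio t =
      ⋃ q : ℚ, ⋃ _ : (q : ℝ) < t, {x | DensityZeroAt {y | (q : ℝ) < u y} x} := by
    ext x
    simp only [mem_preimage, mem_Iio, mem_iUnion, exists_prop]
    constructor
    · intro h
      obtain ⟨q, hq1, hq2⟩ := exists_rat_btwn h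
      refine ⟨q, hq2, ?_⟩
      by_contra hc
      exact hq1.not_ge (le_upperRep_of_not_densityZeroAt one_pos (hu' x) hc)
    · rintro ⟨q, hq, h⟩
      exact (upperRep_le_of_densityZeroAt one_pos (hu' x) h).trans_lt hq
  rw [this]
  exact MeasurableSet.iUnion fun q => MeasurableSet.iUnion fun _ =>
    measurableSet_densityZeroAt (measurableSet_lt measurable_const hm)

end UpperRep

section LayerCake

variable {α : Type*} [MeasurableSpace α] {ρ : Measure α} [SFinite ρ] {v g : α → ℝ} {M : ℝ}

lemma integrable_layer_prod (hv : Measurable v) (hg : Integrable g ρ) (M : ℝ) :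
    Integrable (fun p : ℝ × α => {y | p.1 < v y}.indicator 1 p.2 * g p.2)
      ((volume.restrict (Ioo (-M) M)).prod ρ) := by
  have h1 : Integrable (fun p : ℝ × α => g p.2) ((volume.restrict (Ioo (-M) M)).prod ρ) :=
    hg.comp_snd _
  have h2 : MeasurableSet {p : ℝ × α | p.1 < v p.2} :=
    measurableSet_lt measurable_fst (hv.comp measurable_snd)
  refine (h1.indicator h2).congr (Eventually.of_forall fun p => ?_)
  by_cases hp : p.1 < v p.2 <;> simp [indicator, hp]

lemma integrableOn_layer (hv : Measurable v) (hg : Integrable g ρ) (M : ℝ) :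
    IntegrableOn (fun t => ∫ y, {y | t < v y}.indicator 1 y * g y ∂ρ) (Ioo (-M) M) :=
  (integrable_layer_prod hv hg M).integral_prod_left

lemma integral_layer (hv : Measurable v) (hg : Integrable g ρ) (hM : ∀ y, |v y| ≤ M) :
    ∫ t in Ioo (-M) M, ∫ y, {y | t < v y}.indicator 1 y * g y ∂ρ =
      ∫ y, v y * g y ∂ρ + M * ∫ y, g y ∂ρ := by
  rw [integral_integral_swap (f := fun t y => {y | t < v y}.indicator 1 y * g y)
    (integrable_layer_prod hv hg M), ← integral_const_mul, ← integral_add]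
  · refine integral_congr_ae (Eventually.of_forall fun y => ?_)
    have h0 := abs_le.1 (hM y)
    simp only
    rw [integral_mul_const, ← add_mul]
    congr 1
    have : (fun t : ℝ => {y | t < v y}.indicator (1 : α → ℝ) y) = (Iio (v y)).indicator 1 := by
      ext t
      by_cases ht : t < v y <;> simp [indicator, ht]
    rw [this, integral_indicator_one measurableSet_Iio, measureReal_restrict_apply measurableSet_Iio,
      inter_comm, Ioo_inter_Iio, min_eq_right h0.2, Real.volume_real_Ioo_of_le h0.1]
    ring
  · exact hg.bdd_mul (c := M) hv.aestronglyMeasurable (Eventually.of_forall hM)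
  · exact hg.const_mul M

end LayerCake

section Pairing

variable {n : ℕ} {U U' : Set (Eu n)} {ν μ : Measure (Eu n)} {θ σ : Eu n → Eu n} {u φ : Eu n → ℝ}

lemma DivOn.integrable_fderiv (hd : DivOn U σ μ) (hφ : IsTest U φ) :
    Integrable fun y => fderiv ℝ φ y (σ y) := by
  have hi := hφ.integrable_fderiv
  refine hi.norm.mono' ?_ (Eventually.of_forall fun y => ?_)
  · have hc : Continuous fun p : (Eu n →L[ℝ] ℝ) × Eu n => p.1 p.2 :=
      continuous_fst.clm_apply continuous_snd
    exact (hc.measurable.comp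
      (hφ.continuous_fderiv.measurable.prodMk hd.meas)).aestronglyMeasurable
  · refine ((fderiv ℝ φ y).le_opNorm (σ y)).trans ?_
    exact mul_le_of_le_one_right (norm_nonneg _) (hd.norm_le y)

lemma integral_indicator_lt_upperRep_le {M : ℝ} [IsFiniteMeasure μ] (hm : Measurable u)
    (hM : ∀ y, |u y| ≤ M) (hφ : IsTest U φ) (hφ0 : ∀ x, 0 ≤ φ x) (t : ℝ) :
    ∫ y, {y | t < upperRep u y}.indicator 1 y * φ y ∂μ ≤
      ∫ y in {x | ¬ DensityZeroAt {y | t < u y} x}, φ y ∂μ := by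
  have h1 : MeasurableSet {y | t < upperRep u y} :=
    measurableSet_lt measurable_const (measurable_upperRep hm hM)
  have h2 := measurableSet_not_densityZeroAt (measurableSet_lt (measurable_const (a := t)) hm)
  rw [← integral_indicator h2]
  have heq : ∀ y, {y | t < upperRep u y}.indicator 1 y * φ y =
      {y | t < upperRep u y}.indicator φ y := by
    intro y
    by_cases hy : t < upperRep u y <;> simp [indicator, hy]
  simp_rw [heq]
  refine integral_mono ((hφ.integrable μ).indicator h1) ((hφ.integrable μ).indicator h2) ?_
  refine indicator_le_indicator_of_subset (fun y hy => ?_) hφ0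
  intro hc
  exact (not_le.2 (show t < upperRep u y from hy))
    (upperRep_le_of_densityZeroAt one_pos (Eventually.of_forall hM) hc)

lemma setIntegral_not_densityZeroAt_le {M : ℝ} [IsFiniteMeasure μ] (hm : Measurable u)
    (hM : ∀ y, |u y| ≤ M) (hφ : IsTest U φ) (hφ0 : ∀ x, 0 ≤ φ x) {t : ℝ}
    (ht : μ {y | upperRep u y = t} = 0) :
    ∫ y in {x | ¬ DensityZeroAt {y | t < u y} x}, φ y ∂μ ≤
      ∫ y, {y | t < upperRep u y}.indicator 1 y * φ y ∂μ := by
  have h1 : MeasurableSet {y | t < upperRep u y} :=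
    measurableSet_lt measurable_const (measurable_upperRep hm hM)
  have h2 := measurableSet_not_densityZeroAt (measurableSet_lt (measurable_const (a := t)) hm)
  rw [← integral_indicator h2]
  have heq : ∀ y, {y | t < upperRep u y}.indicator 1 y * φ y =
      {y | t < upperRep u y}.indicator φ y := by
    intro y
    by_cases hy : t < upperRep u y <;> simp [indicator, hy]
  simp_rw [heq]
  refine integral_mono_ae ((hφ.integrable μ).indicator h2) ((hφ.integrable μ).indicator h1) ?_
  filter_upwards [measure_eq_zero_iff_ae_notMem.1 ht] with y hy
  by_cases hy' : DensityZeroAt {y | t < u y} y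
  · rw [indicator_of_notMem (by simpa using hy')]
    exact indicator_nonneg (fun z _ => hφ0 z) y
  · have hlt : t < upperRep u y := lt_of_le_of_ne
      (le_upperRep_of_not_densityZeroAt one_pos (Eventually.of_forall hM) hy') fun h => hy h.symm
    rw [indicator_of_mem (by simpa using hy'), indicator_of_mem (by simpa using hlt)]

/-- The pairing of `Du` with a field of norm at most one is dominated by the total variation. -/
lemma GradOn.pairing_le (h : GradOn U u ν θ) (hd : DivOn U' σ μ) (hc : IsCompact (closure U'))
    (hUU : closure U' ⊆ U) (hφ : IsTest U' φ) (hφ0 : ∀ x, 0 ≤ φ x) :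
    -(∫ y, u y * fderiv ℝ φ y (σ y)) + ∫ y, upperRep u y * φ y ∂μ ≤ ∫ y, φ y ∂ν := by
  have := h.fin
  have := hd.fin
  obtain ⟨M, hM⟩ := h.bdd
  refine le_of_forall_pos_le_add fun ε hε => ?_
  obtain ⟨a, ham, hale, hae⟩ := h.exists_coarea hd.isOpen hc hUU hφ hφ0 hε
  have hI0 : 0 ≤ ∫ y, φ y ∂ν := integral_nonneg hφ0
  have hafin : ∫⁻ t, a t ≠ ⊤ := (hale.trans_lt ENNReal.ofReal_lt_top).ne
  have hai : Integrable fun t => (a t).toReal := integrable_toReal_of_lintegral_ne_top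
    ham.aemeasurable hafin
  have hatot : ∫ t in Ioo (-M) M, (a t).toReal ≤ ∫ y, φ y ∂ν + ε := by
    refine (setIntegral_le_integral hai (Eventually.of_forall fun t => ENNReal.toReal_nonneg)).trans
      ?_
    rw [integral_toReal ham.aemeasurable (ae_lt_top ham hafin)]
    exact ENNReal.toReal_le_of_le_ofReal (by positivity) hale
  have hg := hd.integrable_fderiv hφ
  have hum := measurable_upperRep h.meas hM
  have h1 := integral_layer (ρ := μ) hum (hφ.integrable μ) (abs_upperRep_le hM)
  have h2 := integral_layer h.meas hg hM
  have h3 : ∫ t in Ioo (-M) M, ∫ y, {y | t < upperRep u y}.indicator 1 y * φ y ∂μ ≤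
      ∫ t in Ioo (-M) M, ((a t).toReal +
        ∫ y, {y | t < u y}.indicator 1 y * fderiv ℝ φ y (σ y)) := by
    refine integral_mono_ae (integrableOn_layer hum (hφ.integrable μ) M)
      (hai.integrableOn.add (integrableOn_layer h.meas hg M)) ?_
    filter_upwards [ae_restrict_of_ae hae, ae_restrict_of_ae (ae_lt_top ham hafin)] with t ht hat
    obtain ⟨νt, θt, hgt, hle⟩ := ht
    refine (integral_indicator_lt_upperRep_le h.meas hM hφ hφ0 t).trans
      ((hgt.setIntegral_le (measurableSet_lt measurable_const h.meas) hd hφ hφ0).trans ?_)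
    exact add_le_add_left ((ENNReal.ofReal_le_iff_le_toReal hat.ne).1 hle) _
  rw [integral_add hai.integrableOn (integrableOn_layer h.meas hg M), h1, h2, hd.ibp φ hφ] at h3
  linarith

/-- Upper semicontinuity of `μ ↦ ∫ u⁺ φ dμ` along divergence measures. -/
lemma GradOn.eventually_integral_upperRep_le (h : GradOn U u ν θ) (hc : IsCompact (closure U'))
    (hUU : closure U' ⊆ U) {σk : ℕ → Eu n → Eu n} {μk : ℕ → Measure (Eu n)}
    (hd : DivOn U' σ μ) (hdk : ∀ k, DivOn U' (σk k) (μk k))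
    (hconv : ∀ ψ, IsTest U' ψ → Tendsto (fun k => ∫ y, ψ y ∂μk k) atTop (𝓝 (∫ y, ψ y ∂μ)))
    (hφ : IsTest U' φ) (hφ0 : ∀ x, 0 ≤ φ x) {ε : ℝ} (hε : 0 < ε) :
    ∀ᶠ k in atTop, ∫ y, upperRep u y * φ y ∂μk k ≤ ∫ y, upperRep u y * φ y ∂μ + ε := by
  have := h.fin
  have := hd.fin
  have hfin := fun k => (hdk k).fin
  obtain ⟨M, hM⟩ := h.bdd
  obtain ⟨a, ham, hale, hae⟩ := h.exists_coarea hd.isOpen hc hUU hφ hφ0 hε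
  have hum := measurable_upperRep h.meas hM
  set f : ℝ → ℝ := fun t => ∫ y, {y | t < upperRep u y}.indicator 1 y * φ y ∂μ with hf
  set fk : ℕ → ℝ → ℝ := fun k t => ∫ y, {y | t < upperRep u y}.indicator 1 y * φ y ∂μk k with hfk
  have hfi : IntegrableOn f (Ioo (-M) M) := integrableOn_layer hum (hφ.integrable μ) M
  have hfki : ∀ k, IntegrableOn (fk k) (Ioo (-M) M) := fun k =>
    integrableOn_layer hum (hφ.integrable _) M
  have hsum := integral_layer (ρ := μ) hum (hφ.integrable μ) (abs_upperRep_le hM)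
  have hsumk := fun k => integral_layer (ρ := μk k) hum (hφ.integrable _) (abs_upperRep_le hM)
  obtain ⟨C, hC⟩ := (hconv φ hφ).bddAbove_range
  have hfnn : ∀ (m : Measure (Eu n)) (t : ℝ),
      0 ≤ ∫ y, {y | t < upperRep u y}.indicator 1 y * φ y ∂m := fun m t =>
    integral_nonneg fun y => mul_nonneg (indicator_nonneg (fun _ _ => zero_le_one) _) (hφ0 y)
  have hfkC : ∀ k t, fk k t ≤ C := by
    intro k t
    refine le_trans ?_ (hC (mem_range_self k))
    refine integral_mono_of_nonneg (Eventually.of_forall fun y => mul_nonneg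
      (indicator_nonneg (fun _ _ => zero_le_one) _) (hφ0 y)) (hφ.integrable _)
      (Eventually.of_forall fun y => ?_)
    refine mul_le_of_le_one_left (hφ0 y) ?_
    exact indicator_le_self' (fun _ _ => zero_le_one) y
  have hlev : ∀ᵐ t : ℝ, μ {y | upperRep u y = t} = 0 := by
    filter_upwards [(Measure.countable_meas_level_set_pos (μ := μ) hum).ae_notMem volume] with t ht
    simpa using ht
  have hlim : Tendsto (fun k => ∫ t in Ioo (-M) M, max (fk k t - f t) 0) atTop
      (𝓝 (∫ t in Ioo (-M) M, (0 : ℝ))) := by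
    refine tendsto_integral_of_dominated_convergence (fun _ => max C 0)
      (fun k => (((hfki k).sub hfi).aestronglyMeasurable.sup aestronglyMeasurable_const))
      (integrable_const _) (fun k => Eventually.of_forall fun t => ?_) ?_
    · rw [Real.norm_of_nonneg (le_max_right _ _)]
      exact max_le_max_right _ ((sub_le_self _ (hfnn μ t)).trans (hfkC k t))
    · filter_upwards [ae_restrict_of_ae hae, ae_restrict_of_ae hlev] with t ht htl
      obtain ⟨νt, θt, hgt, -⟩ := ht
      rw [Metric.tendsto_atTop']
      intro e he
      obtain ⟨N, hN⟩ := eventually_atTop.1 (eventually_setIntegral_le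
        (measurableSet_lt measurable_const h.meas) hgt hd hdk hconv hφ hφ0 (half_pos he))
      refine ⟨N, fun k hk => ?_⟩
      have h1 := hN k hk.le
      have h2 := integral_indicator_lt_upperRep_le (μ := μk k) h.meas hM hφ hφ0 t
      have h3 := setIntegral_not_densityZeroAt_le h.meas hM hφ hφ0 htl
      rw [Real.dist_eq, sub_zero, abs_of_nonneg (le_max_right _ _)]
      refine max_lt ?_ he
      simp only [hf, hfk]
      linarith
  rw [integral_zero] at hlim
  filter_upwards [hlim.eventually (gt_mem_nhds (half_pos (half_pos hε))),
    ((hconv φ hφ).const_mul M).eventually (lt_mem_nhds (show M * ∫ y, φ y ∂μ - ε / 2 <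
      M * ∫ y, φ y ∂μ by linarith))] with k hk1 hk2
  have h1 : ∫ t in Ioo (-M) M, (fk k t - f t) ≤ ∫ t in Ioo (-M) M, max (fk k t - f t) 0 := by
    refine integral_mono ((hfki k).sub hfi) ?_ fun t => le_max_left _ _
    exact ((hfki k).sub hfi).sup (integrable_const 0)
  rw [integral_sub (hfki k) hfi, hsum, hsumk k] at h1
  linarith

end Pairing

section WeakLimit

lemma exists_weak_limit {H : Type*} [NormedAddCommGroup H] [InnerProductSpace ℝ H] [CompleteSpace H]
    [TopologicalSpace.SeparableSpace H] {g : ℕ → H} {C : ℝ} (hg : ∀ k, ‖g k‖ ≤ C) :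
    ∃ (g' : H) (s : ℕ → ℕ), StrictMono s ∧
      ∀ z, Tendsto (fun k => ⟪g (s k), z⟫) atTop (𝓝 ⟪g', z⟫) := by
  have hmem : ∀ k, StrongDual.toWeakDual (InnerProductSpace.toDual ℝ H (g k)) ∈
      WeakDual.toStrongDual (𝕜 := ℝ) (E := H) ⁻¹' closedBall 0 C := by
    intro k
    rw [mem_preimage, mem_closedBall_zero_iff]
    exact ((InnerProductSpace.toDual ℝ H).norm_map (g k)).trans_le (hg k)
  obtain ⟨ℓ, -, s, hs, hlim⟩ := WeakDual.isSeqCompact_closedBall ℝ H 0 C hmem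
  refine ⟨(InnerProductSpace.toDual ℝ H).symm (WeakDual.toStrongDual ℓ), s, hs, fun z => ?_⟩
  rw [InnerProductSpace.toDual_symm_apply]
  exact ((WeakDual.eval_continuous z).tendsto ℓ).comp hlim

variable {n : ℕ}

/-- A positive continuous weight in `L²`. -/
def decay (x : Eu n) : ℝ := (1 + ‖x‖) ^ (-((n : ℝ) + 1))

lemma decay_pos (x : Eu n) : 0 < decay x := Real.rpow_pos_of_pos (by positivity) _

lemma continuous_decay : Continuous (decay (n := n)) :=
  (continuous_const.add continuous_norm).rpow_const fun x =>
    Or.inl (by positivity : (0 : ℝ) < 1 + ‖x‖).ne'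

lemma decay_le_one (x : Eu n) : decay x ≤ 1 :=
  Real.rpow_le_one_of_one_le_of_nonpos (by linarith [norm_nonneg x]) (by linarith [n.cast_nonneg (α := ℝ)])

lemma memLp_decay : MemLp (decay (n := n)) 2 := by
  rw [memLp_two_iff_integrable_sq continuous_decay.aestronglyMeasurable]
  have h1 : Integrable (decay (n := n)) := by
    refine integrable_one_add_norm ?_
    simp
  refine h1.mono' (continuous_decay.pow 2).aestronglyMeasurable (Eventually.of_forall fun x => ?_)
  rw [Real.norm_of_nonneg (sq_nonneg _), sq]
  exact mul_le_of_le_one_left (decay_pos x).le (decay_le_one x)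

lemma exists_le_decay (R : ℝ) : ∃ c > 0, ∀ x : Eu n, ‖x‖ ≤ R → c ≤ decay x := by
  rcases (closedBall (0 : Eu n) R).eq_empty_or_nonempty with h | h
  · refine ⟨1, one_pos, fun x hx => ?_⟩
    have : x ∈ closedBall (0 : Eu n) R := by simpa using hx
    rw [h] at this
    exact this.elim
  · obtain ⟨x, -, hx⟩ := (isCompact_closedBall (0 : Eu n) R).exists_isMinOn h
      continuous_decay.continuousOn
    exact ⟨decay x, decay_pos x, fun y hy => hx (show y ∈ closedBall 0 R by simpa using hy)⟩

/-- Bounded sequences of fields have weakly convergent subsequences. -/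
lemma exists_weak_limit_field {σk : ℕ → Eu n → Eu n} (hm : ∀ k, Measurable (σk k))
    (hb : ∀ k x, ‖σk k x‖ ≤ 1) :
    ∃ (σ : Eu n → Eu n) (s : ℕ → ℕ), StrictMono s ∧ Measurable σ ∧ (∀ x, ‖σ x‖ ≤ 1) ∧
      ∀ (Z : Eu n → Eu n) (C R : ℝ), AEStronglyMeasurable Z volume → (∀ᵐ x, ‖Z x‖ ≤ C) →
        (∀ x, R < ‖x‖ → Z x = 0) →
        Tendsto (fun k => ∫ x, ⟪σk (s k) x, Z x⟫) atTop (𝓝 (∫ x, ⟪σ x, Z x⟫)) := by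
  have : Fact ((2 : ℝ≥0∞) ≠ ⊤) := ⟨by simp⟩
  have hgm : ∀ k, MemLp (fun x => decay x • σk k x) 2 volume := fun k =>
    memLp_decay.of_le_mul (c := 1)
      (continuous_decay.aestronglyMeasurable.smul (hm k).aestronglyMeasurable)
      (Eventually.of_forall fun x => by
        rw [norm_smul, one_mul]
        exact mul_le_of_le_one_right (norm_nonneg _) (hb k x))
  set g : ℕ → Lp (Eu n) 2 (volume : Measure (Eu n)) := fun k => (hgm k).toLp with hg
  obtain ⟨g', s, hs, hlim⟩ := exists_weak_limit (g := g)
    (C := ‖(memLp_decay (n := n)).toLp‖) fun k => by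
      refine Lp.norm_le_norm_of_ae_le ?_
      filter_upwards [(hgm k).coeFn_toLp, (memLp_decay (n := n)).coeFn_toLp] with x h1 h2
      rw [h1, h2, norm_smul]
      exact mul_le_of_le_one_right (norm_nonneg _) (hb k x)
  set τ : Eu n → Eu n := fun x => (decay x)⁻¹ • g' x with hτ
  have hτm : Measurable τ :=
    continuous_decay.measurable.inv.smul (Lp.stronglyMeasurable g').measurable
  have hkey : ∀ (Z : Eu n → Eu n) (C R : ℝ), AEStronglyMeasurable Z volume → (∀ᵐ x, ‖Z x‖ ≤ C) →
        (∀ x, R < ‖x‖ → Z x = 0) →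
        Tendsto (fun k => ∫ x, ⟪σk (s k) x, Z x⟫) atTop (𝓝 (∫ x, ⟪τ x, Z x⟫)) := by
    intro Z C R hZm hZC hZR
    obtain ⟨c, hc0, hc⟩ := exists_le_decay (n := n) R
    have hZL : MemLp (fun x => (decay x)⁻¹ • Z x) 2 volume := by
      refine memLp_decay.of_le_mul (c := c⁻¹ * c⁻¹ * C)
        (continuous_decay.measurable.inv.aestronglyMeasurable.smul hZm) ?_
      filter_upwards [hZC] with x hx
      have hd := decay_pos x
      rw [norm_smul, Real.norm_of_nonneg (inv_nonneg.2 hd.le), Real.norm_of_nonneg hd.le]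
      have hC0 : 0 ≤ C := (norm_nonneg _).trans hx
      by_cases hxR : ‖x‖ ≤ R
      · have h1 := hc x hxR
        have h2 : (decay x)⁻¹ ≤ c⁻¹ := inv_anti₀ hc0 h1
        calc (decay x)⁻¹ * ‖Z x‖ ≤ c⁻¹ * C := by gcongr
          _ = c⁻¹ * c⁻¹ * C * c := by field_simp
          _ ≤ _ := by gcongr
      · rw [hZR x (not_le.1 hxR), norm_zero, mul_zero]
        positivity
    have h1 := hlim hZL.toLp
    have h2 : ∀ k, ⟪g (s k), hZL.toLp⟫ = ∫ x, ⟪σk (s k) x, Z x⟫ := by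
      intro k
      rw [L2.inner_def]
      refine integral_congr_ae ?_
      filter_upwards [(hgm (s k)).coeFn_toLp, hZL.coeFn_toLp] with x h1 h2
      rw [h2, hg]
      simp only
      rw [h1, real_inner_smul_left, real_inner_smul_right, ← mul_assoc,
        mul_inv_cancel₀ (decay_pos x).ne', one_mul]
    have h3 : ⟪g', hZL.toLp⟫ = ∫ x, ⟪τ x, Z x⟫ := by
      rw [L2.inner_def]
      refine integral_congr_ae ?_
      filter_upwards [hZL.coeFn_toLp] with x h2
      rw [h2, hτ]
      simp only
      rw [real_inner_smul_left, real_inner_smul_right]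
    simp_rw [h2] at h1
    rw [h3] at h1
    exact h1
  have hnull : ∀ R : ℕ, volume ({x | 1 < ‖τ x‖ ∧ ‖τ x‖ ≤ R} ∩ closedBall (0 : Eu n) R) = 0 := by
    intro R
    set A := {x | 1 < ‖τ x‖ ∧ ‖τ x‖ ≤ R} ∩ closedBall (0 : Eu n) R with hA
    have hAm : MeasurableSet A := ((measurableSet_lt measurable_const hτm.norm).inter
      (measurableSet_le hτm.norm measurable_const)).inter measurableSet_closedBall
    have hAfin : volume A < ⊤ := (measure_mono inter_subset_right).trans_lt measure_closedBall_lt_top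
    have hAr : IsFiniteMeasure (volume.restrict A) := ⟨by simpa using hAfin⟩
    have hZn : ∀ x, ‖A.indicator (fun x => ‖τ x‖⁻¹ • τ x) x‖ ≤ A.indicator 1 x := by
      intro x
      rw [norm_indicator_eq_indicator_norm]
      refine indicator_le_indicator ?_
      rw [norm_smul, norm_inv, norm_norm]
      exact inv_mul_le_one
    have h1 := hkey (A.indicator fun x => ‖τ x‖⁻¹ • τ x) 1 R
      (((hτm.norm.inv).smul hτm).indicator hAm).aestronglyMeasurable
      (Eventually.of_forall fun x => (hZn x).trans (indicator_le_self' (fun _ _ => zero_le_one) x))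
      fun x hx => indicator_of_notMem (fun h => hx.not_ge (by simpa using h.2)) _
    have h2 : ∫ x, ⟪τ x, A.indicator (fun x => ‖τ x‖⁻¹ • τ x) x⟫ = ∫ x in A, ‖τ x‖ := by
      rw [← integral_indicator hAm]
      refine integral_congr_ae (Eventually.of_forall fun x => ?_)
      by_cases hx : x ∈ A
      · have h0 : ‖τ x‖ ≠ 0 := (zero_lt_one.trans hx.1.1).ne'
        simp only [indicator_of_mem hx]
        rw [real_inner_smul_right, real_inner_self_eq_norm_sq]
        field_simp
      · simp [indicator_of_notMem hx]
    have hAint : Integrable (A.indicator (1 : Eu n → ℝ)) := (integrable_indicator_iff hAm).2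
      (integrableOn_const hAfin.ne)
    have h3 : ∫ x in A, ‖τ x‖ ≤ ∫ x in A, (1 : ℝ) := by
      rw [← h2]
      refine le_of_tendsto h1 (Eventually.of_forall fun k => ?_)
      rw [← integral_indicator hAm]
      refine (Real.le_norm_self _).trans (norm_integral_le_of_norm_le hAint
        (Eventually.of_forall fun x => ?_))
      refine (norm_inner_le_norm _ _).trans ?_
      exact (mul_le_of_le_one_left (norm_nonneg _) (hb _ x)).trans (hZn x)
    have hτi : IntegrableOn (fun x => ‖τ x‖) A := by
      refine Integrable.of_bound hτm.norm.aestronglyMeasurable R ?_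
      filter_upwards [ae_restrict_mem hAm] with x hx
      rw [norm_norm]
      exact hx.1.2
    have h4 : ∫ x in A, (‖τ x‖ - 1) = 0 := by
      refine le_antisymm ?_ (setIntegral_nonneg hAm fun x hx => sub_nonneg.2 hx.1.1.le)
      rw [integral_sub hτi (integrable_const _)]
      linarith
    have hτi' : IntegrableOn (fun x => ‖τ x‖ - 1) A := hτi.sub (integrable_const _)
    rw [setIntegral_eq_zero_iff_of_nonneg_ae ?_ hτi'] at h4
    · by_contra hne
      have h5 : ∀ᵐ x ∂volume.restrict A, False := by
        filter_upwards [h4, ae_restrict_mem hAm] with x hx hxA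
        exact (sub_pos.2 hxA.1.1).ne' hx
      rw [eventually_false_iff_eq_bot, ae_eq_bot, Measure.restrict_eq_zero] at h5
      exact hne h5
    · filter_upwards [ae_restrict_mem hAm] with x hx
      exact sub_nonneg.2 hx.1.1.le
  have hle : ∀ᵐ x, ‖τ x‖ ≤ 1 := by
    have h1 : volume {x | 1 < ‖τ x‖} = 0 := by
      refine measure_mono_null (fun x hx => ?_) (measure_iUnion_null hnull)
      obtain ⟨R, hR⟩ := exists_nat_ge (max ‖x‖ ‖τ x‖)
      exact mem_iUnion.2 ⟨R, ⟨hx, (le_max_right _ _).trans hR⟩,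
        by simpa using (le_max_left _ _).trans hR⟩
    filter_upwards [measure_eq_zero_iff_ae_notMem.1 h1] with x hx
    exact not_lt.1 hx
  have hS : MeasurableSet {x | ‖τ x‖ ≤ 1} := measurableSet_le hτm.norm measurable_const
  refine ⟨{x | ‖τ x‖ ≤ 1}.indicator τ, s, hs, hτm.indicator hS, fun x => ?_, fun Z C R h1 h2 h3 => ?_⟩
  · by_cases hx : ‖τ x‖ ≤ 1 <;> simp [indicator, hx]
  · have : ∫ x, ⟪{x | ‖τ x‖ ≤ 1}.indicator τ x, Z x⟫ = ∫ x, ⟪τ x, Z x⟫ := by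
      refine integral_congr_ae ?_
      filter_upwards [hle] with x hx
      rw [indicator_of_mem (by exact hx)]
    rw [this]
    exact hkey Z C R h1 h2 h3

end WeakLimit

section LocalLimit

variable {n : ℕ} {U U' : Set (Eu n)} {ν μ : Measure (Eu n)} {θ σ : Eu n → Eu n} {u φ : Eu n → ℝ}

lemma GradOn.neg_integral_mul_divg_le {X : Eu n → Eu n} (h : GradOn U u ν θ) (hX : IsTestField U X)
    (hφ : IsTest U φ) (hXφ : ∀ x, ‖X x‖ ≤ φ x) : - ∫ y, u y * divg X y ≤ ∫ y, φ y ∂ν := by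
  have := h.fin
  rw [h.integral_mul_divg hX, neg_neg]
  refine (Real.le_norm_self _).trans (norm_integral_le_of_norm_le (hφ.integrable ν) ?_)
  filter_upwards [h.norm_dir] with x hx
  refine (norm_inner_le_norm _ _).trans ?_
  rw [hx, one_mul]
  exact hXφ x

lemma GradOn.integrable_upperRep_mul [IsFiniteMeasure μ] (h : GradOn U u ν θ) (hφ : IsTest U' φ) :
    Integrable (fun y => upperRep u y * φ y) μ := by
  obtain ⟨M, hM⟩ := h.bdd
  exact (hφ.integrable μ).bdd_mul (c := M) (measurable_upperRep h.meas hM).aestronglyMeasurable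
    (Eventually.of_forall (abs_upperRep_le hM))

/-- Local stability of the pairing identity under convergence from below. -/
lemma GradOn.pairing_eq_of_tendsto (h : GradOn U u ν θ) (hc : IsCompact (closure U'))
    (hUU : closure U' ⊆ U) (hd : DivOn U' σ μ)
    {uk : ℕ → Eu n → ℝ} {νk : ℕ → Measure (Eu n)} {θk : ℕ → Eu n → Eu n}
    {σk : ℕ → Eu n → Eu n} {μk : ℕ → Measure (Eu n)}
    (hk : ∀ k, GradOn U (uk k) (νk k) (θk k)) (hdk : ∀ k, DivOn U' (σk k) (μk k))
    (hconv : ∀ ψ, IsTest U' ψ → Tendsto (fun k => ∫ y, ψ y ∂μk k) atTop (𝓝 (∫ y, ψ y ∂μ)))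
    (huk : ∀ ψ, IsTest U ψ → Tendsto (fun k => ∫ y, uk k y * ψ y) atTop (𝓝 (∫ y, u y * ψ y)))
    (hle : ∀ k, ∀ᵐ y ∂volume.restrict U, uk k y ≤ u y)
    (hφ : IsTest U' φ) (hφ0 : ∀ x, 0 ≤ φ x)
    (hpair : Tendsto (fun k => ∫ y, uk k y * fderiv ℝ φ y (σk k y)) atTop
      (𝓝 (∫ y, u y * fderiv ℝ φ y (σ y))))
    (heq : ∀ k, ∫ y, φ y ∂νk k ≤
      -(∫ y, uk k y * fderiv ℝ φ y (σk k y)) + ∫ y, upperRep (uk k) y * φ y ∂μk k) :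
    -(∫ y, u y * fderiv ℝ φ y (σ y)) + ∫ y, upperRep u y * φ y ∂μ = ∫ y, φ y ∂ν := by
  have hfin := fun k => (hdk k).fin
  have hU'U : U' ⊆ U := subset_closure.trans hUU
  refine le_antisymm (h.pairing_le hd hc hUU hφ hφ0) (le_of_forall_pos_le_add fun ε hε => ?_)
  have h1 := h.eventually_integral_le (l := atTop) (V := fun k => ∫ y, φ y ∂νk k)
    (hφ.mono hU'U) hφ0 huk (Eventually.of_forall fun k X hX hXφ =>
      (hk k).neg_integral_mul_divg_le hX (hφ.mono hU'U) hXφ) (show 0 < ε / 3 by positivity)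
  have h2 := h.eventually_integral_upperRep_le hc hUU hd hdk hconv hφ hφ0
    (show 0 < ε / 3 by positivity)
  have h3 := hpair.eventually (lt_mem_nhds (show (∫ y, u y * fderiv ℝ φ y (σ y)) - ε / 3 <
    ∫ y, u y * fderiv ℝ φ y (σ y) by linarith))
  obtain ⟨k, hk1, hk2, hk3⟩ := (h1.and (h2.and h3)).exists
  have h4 : ∫ y, upperRep (uk k) y * φ y ∂μk k ≤ ∫ y, upperRep u y * φ y ∂μk k := by
    refine integral_mono ((hk k).integrable_upperRep_mul hφ) (h.integrable_upperRep_mul hφ)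
      fun x => ?_
    by_cases hx : x ∈ U'
    · refine mul_le_mul_of_nonneg_right ?_ (hφ0 x)
      obtain ⟨r, hr, hrU⟩ := Metric.isOpen_iff.1 h.isOpen x (hU'U hx)
      obtain ⟨M, hM⟩ := h.bdd
      obtain ⟨M', hM'⟩ := (hk k).bdd
      exact upperRep_mono_of_ae (M := max M M') hr
        (Eventually.of_forall fun y => (hM' y).trans (le_max_right _ _))
        (Eventually.of_forall fun y => (hM y).trans (le_max_left _ _))
        (ae_restrict_of_ae_restrict_of_subset hrU (hle k))
    · simp only [hφ.zero_of_notMem hx, mul_zero, le_refl]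
  linarith [heq k]

end LocalLimit

section Localization

variable {n : ℕ} {Ω U : Set (Eu n)} {ν μ : Measure (Eu n)} {θ σ : Eu n → Eu n} {u φ : Eu n → ℝ}

lemma integral_eq_setIntegral_of_isTest (hU : U ⊆ Ω) (hφ : IsTest U φ) {f : Eu n → ℝ}
    (hf : ∀ x, fderiv ℝ φ x = 0 → f x = 0) : ∫ x in Ω, f x = ∫ x, f x := by
  refine setIntegral_eq_integral_of_forall_compl_eq_zero fun x hx => hf x ?_
  exact hφ.fderiv_zero_of_notMem fun h => hx (hU h)

lemma inner_gradient_eq (φ : Eu n → ℝ) (x v : Eu n) : ⟪v, gradient φ x⟫ = fderiv ℝ φ x v := by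
  rw [real_inner_comm, gradient, InnerProductSpace.toDual_symm_apply]

lemma IsTest.integrableOn_smul_gradient (hΩ : IsOpen Ω) (hφ : IsTest Ω φ)
    (hu : LocallyIntegrableOn u Ω) : IntegrableOn (fun x => u x • gradient φ x) Ω := by
  obtain ⟨C, -, hC⟩ := hφ.exists_bound_fderiv
  have hgc : Continuous (gradient φ) :=
    (InnerProductSpace.toDual ℝ (Eu n)).symm.continuous.comp hφ.continuous_fderiv
  have hgn : ∀ x, ‖gradient φ x‖ ≤ C := fun x =>
    ((InnerProductSpace.toDual ℝ (Eu n)).symm.norm_map _).trans_le (hC x)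
  have h1 : IntegrableOn (fun x => u x • gradient φ x) (tsupport φ) :=
    Integrable.smul_bdd (hu.integrableOn_compact_subset hφ.2.2 hφ.2.1) C
      hgc.aestronglyMeasurable (Eventually.of_forall hgn)
  refine h1.of_forall_sdiff_eq_zero hΩ.measurableSet fun x hx => ?_
  rw [gradient, fderiv_of_notMem_tsupport ℝ hx.2, map_zero, smul_zero]

/-- A gradient measure can be replaced by a smaller one with measurable polar vector. -/
lemma HasGradMeasure.exists_measurable (hΩ : IsOpen Ω) (hu : LocallyIntegrableOn u Ω)
    (hν : LocFinOn Ω ν) (h : HasGradMeasure Ω u ν θ) :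
    ∃ ν₀ θ₀, ν₀ ≤ ν ∧ LocFinOn Ω ν₀ ∧ Measurable θ₀ ∧ HasGradMeasure Ω u ν₀ θ₀ := by
  by_cases hθ : AEStronglyMeasurable θ ν
  · refine ⟨ν, hθ.mk, le_rfl, hν, hθ.stronglyMeasurable_mk.measurable, ?_, h.2.1, fun φ hφ => ?_⟩
    · filter_upwards [h.1, hθ.ae_eq_mk] with x h1 h2
      rw [← h2, h1]
    · rw [h.2.2 φ hφ]
      congr 1
      refine integral_congr_ae ?_
      filter_upwards [hθ.ae_eq_mk] with x h2
      rw [← h2]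
  · have hK : ∃ K ⊆ Ω, IsCompact K ∧ ¬ AEStronglyMeasurable θ (ν.restrict K) := by
      by_contra! hcon
      obtain ⟨F, hF, -, hFU, -⟩ := hΩ.exists_iUnion_isClosed
      refine hθ ?_
      have h1 : ν.restrict Ω = ν := Measure.restrict_eq_self_of_ae_mem (by
        exact h.2.1)
      have h2 : Ω = ⋃ p : ℕ × ℕ, F p.1 ∩ closedBall 0 p.2 := by
        rw [← hFU]
        ext x
        simp only [mem_iUnion, Prod.exists, mem_inter_iff]
        constructor
        · rintro ⟨i, hi⟩
          obtain ⟨R, hR⟩ := exists_nat_ge ‖x‖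
          exact ⟨i, R, hi, by simpa using hR⟩
        · rintro ⟨i, R, hi, -⟩
          exact ⟨i, hi⟩
      rw [← h1, h2, aestronglyMeasurable_iUnion_iff]
      intro p
      refine hcon _ ?_ ((isCompact_closedBall _ _).inter_left (hF p.1))
      rw [h2]
      exact subset_iUnion (fun p : ℕ × ℕ => F p.1 ∩ closedBall 0 (p.2 : ℝ)) p
    obtain ⟨K, hKΩ, hKc, hKθ⟩ := hK
    have hzero : ∀ ψ, IsTest Ω ψ → (∀ x ∈ K, ψ x ≠ 0) → ∫ x in Ω, u x • gradient ψ x = 0 := by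
      intro ψ hψ hψK
      rw [h.2.2 ψ hψ, integral_undef, neg_zero]
      intro hi
      refine hKθ ?_
      have h1 : AEStronglyMeasurable (fun x => (ψ x)⁻¹ • ψ x • θ x) (ν.restrict K) :=
        hψ.continuous.measurable.inv.aestronglyMeasurable.smul hi.1.restrict
      refine h1.congr ?_
      filter_upwards [ae_restrict_mem hKc.measurableSet] with x hx
      rw [smul_smul, inv_mul_cancel₀ (hψK x hx), one_smul]
    refine ⟨0, 0, Measure.zero_le _, ⟨fun _ _ _ => by simp, by simp⟩, measurable_zero, by simp,
      by simp, fun φ hφ => ?_⟩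
    rw [integral_zero_measure, neg_zero]
    obtain ⟨C, hC0, hC⟩ := hφ.exists_bound
    obtain ⟨η, hη, -, hη1⟩ := exists_isTest_one hKc hΩ hKΩ
    have h1 := hzero _ (hη.const_mul (C + 1)) fun x hx => by
      rw [hη1 x hx]; positivity
    have h2 := hzero _ ((hη.const_mul (C + 1)).add hφ) fun x hx => by
      rw [hη1 x hx]
      have := neg_le_of_abs_le (hC x)
      linarith
    have h3 : ∀ x, u x • gradient (fun y => (C + 1) * η y + φ y) x =
        u x • gradient (fun y => (C + 1) * η y) x + u x • gradient φ x := by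
      intro x
      rw [gradient, fderiv_fun_add ((hη.const_mul (C + 1)).differentiable x) (hφ.differentiable x),
        map_add, smul_add]
      rfl
    simp_rw [h3] at h2
    rwa [integral_add ((hη.const_mul (C + 1)).integrableOn_smul_gradient hΩ hu)
      (hφ.integrableOn_smul_gradient hΩ hu), h1, zero_add] at h2

/-- A locally bounded function of locally bounded variation agrees on a relatively compact open
set with a bounded function having a gradient measure there. -/
lemma HasGradMeasure.exists_gradOn (hΩ : IsOpen Ω) (hu : LocBddFun Ω u) (hν : LocFinOn Ω ν)
    (h : HasGradMeasure Ω u ν θ) (hθ : Measurable θ) (hUo : IsOpen U) (hc : IsCompact (closure U))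
    (hU : closure U ⊆ Ω) :
    ∃ v, GradOn U v (ν.restrict U) θ ∧ (∀ᵐ x ∂volume.restrict U, v x = u x) := by
  have hUΩ : U ⊆ Ω := subset_closure.trans hU
  obtain ⟨C, hC⟩ := hu.2 _ hU hc
  have hC := ae_restrict_of_ae_restrict_of_subset (subset_closure (s := U)) hC
  set w := hu.1.mk u with hw
  have hwm : Measurable w := hu.1.stronglyMeasurable_mk.measurable
  have hwu := ae_restrict_of_ae_restrict_of_subset hUΩ hu.1.ae_eq_mk
  rw [← hw] at hwu
  set S := {x | |w x| ≤ C} with hS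
  have hSm : MeasurableSet S := measurableSet_le hwm.abs measurable_const
  have hvu : ∀ᵐ x ∂volume.restrict U, S.indicator w x = u x := by
    filter_upwards [hC, hwu] with x h1 h2
    have hx : x ∈ S := show |w x| ≤ C by rwa [← h2]
    rw [indicator_of_mem hx, h2]
  have hνU : ν U < ⊤ := (measure_mono subset_closure).trans_lt (hν.1 _ hU hc)
  have hfin : IsFiniteMeasure (ν.restrict U) := ⟨by simpa using hνU⟩
  have hvb : ∀ x, |S.indicator w x| ≤ max C 0 := by
    intro x
    by_cases hx : x ∈ S
    · rw [indicator_of_mem hx]; exact le_max_of_le_left hx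
    · simp [indicator_of_notMem hx]
  have hvm : Measurable (S.indicator w) := hwm.indicator hSm
  refine ⟨S.indicator w, ⟨hUo, hvm, ⟨max C 0, hvb⟩, hfin,
    by simp [Measure.restrict_apply hUo.measurableSet.compl], hθ, ae_restrict_of_ae h.1,
    fun φ hφ e => ?_⟩, hvu⟩
  have hg0 : ∀ x ∉ U, gradient φ x = 0 := fun x hx => by
    rw [gradient, hφ.fderiv_zero_of_notMem hx, map_zero]
  have hi : Integrable (fun x => φ x • θ x) (ν.restrict U) := by
    refine (hφ.integrable (ν.restrict U)).norm.mono'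
      (hφ.continuous.measurable.smul hθ).aestronglyMeasurable ?_
    filter_upwards [ae_restrict_of_ae h.1] with x hx
    rw [norm_smul, hx, mul_one]
  have hi' : Integrable fun x => S.indicator w x • gradient φ x := by
    have := (hφ.mono (subset_univ U)).integrableOn_smul_gradient isOpen_univ
      ((locallyIntegrable_of_bdd hvm ⟨_, hvb⟩).locallyIntegrableOn univ)
    rwa [integrableOn_univ] at this
  have hν' : ∫ x, φ x • θ x ∂ν = ∫ x in U, φ x • θ x ∂ν := by
    rw [setIntegral_eq_integral_of_forall_compl_eq_zero]
    intro x hx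
    rw [hφ.zero_of_notMem hx, zero_smul]
  have hu' : ∫ x in Ω, u x • gradient φ x = ∫ x, S.indicator w x • gradient φ x := by
    rw [setIntegral_eq_of_subset_of_forall_sdiff_eq_zero hΩ.measurableSet hUΩ
      fun x hx => by rw [hg0 x hx.2, smul_zero]]
    rw [← setIntegral_eq_integral_of_forall_compl_eq_zero (s := U)
      (f := fun x => S.indicator w x • gradient φ x) fun x hx => by rw [hg0 x hx, smul_zero]]
    refine integral_congr_ae ?_
    filter_upwards [hvu] with x hx
    rw [hx]
  have h1 := congrArg (fun z : Eu n => ⟪e, z⟫) (h.2.2 φ (hφ.mono hUΩ))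
  simp only [inner_neg_right] at h1
  rw [hu', hν', ← integral_inner hi', ← integral_inner hi] at h1
  simp_rw [real_inner_smul_right, inner_gradient_eq] at h1
  simpa only [real_inner_comm] using h1

lemma RepNegDiv.divOn (hσ : Measurable σ) (hσ1 : ∀ x, ‖σ x‖ ≤ 1) (hμ : LocFinOn Ω μ)
    (h : RepNegDiv Ω σ μ 0) (hUo : IsOpen U) (hc : IsCompact (closure U))
    (hU : closure U ⊆ Ω) : DivOn U σ (μ.restrict U) := by
  have hUΩ : U ⊆ Ω := subset_closure.trans hU
  refine ⟨hUo, hσ, hσ1, ⟨?_⟩, by simp [Measure.restrict_apply hUo.measurableSet.compl], fun φ hφ => ?_⟩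
  · rw [Measure.restrict_apply_univ]
    exact (measure_mono subset_closure).trans_lt (hμ.1 _ hU hc)
  · have h1 := h φ (hφ.mono hUΩ)
    simp_rw [inner_gradient_eq] at h1
    rw [integral_eq_setIntegral_of_isTest hUΩ hφ (fun x hx => by rw [hx]; rfl),
      integral_zero_measure, sub_zero] at h1
    rw [h1, setIntegral_eq_integral_of_forall_compl_eq_zero]
    exact fun x hx => hφ.zero_of_notMem hx

end Localization

section Assembly

variable {n : ℕ} {Ω U U' : Set (Eu n)} {ν μ : Measure (Eu n)} {θ σ : Eu n → Eu n}
  {u v φ : Eu n → ℝ}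

lemma LocFinOn.integrable_isTest (hμ : LocFinOn Ω μ) (hφ : IsTest Ω φ) : Integrable φ μ := by
  have : IsFiniteMeasure (μ.restrict (tsupport φ)) :=
    ⟨by simpa using hμ.1 _ hφ.2.2 hφ.2.1⟩
  exact (integrableOn_iff_integrable_of_support_subset (subset_tsupport φ)).1
    (hφ.integrable (μ.restrict (tsupport φ)))

lemma upperRep_eq_of_ae_eq {M : ℝ} (hU : IsOpen U) (hv : ∀ y, |v y| ≤ M)
    (h : ∀ᵐ y ∂volume.restrict U, v y = u y) {x : Eu n} (hx : x ∈ U) :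
    upperRep v x = upperRep u x := by
  obtain ⟨r, hr, hrU⟩ := Metric.isOpen_iff.1 hU x hx
  exact upperRep_congr_of_ae hr (Eventually.of_forall hv)
    (ae_restrict_of_ae_restrict_of_subset hrU h)

lemma LocBddFun.integrableOn (hu : LocBddFun Ω u) {K : Set (Eu n)} (hK : K ⊆ Ω)
    (hc : IsCompact K) : IntegrableOn u K := by
  obtain ⟨C, hC⟩ := hu.2 K hK hc
  have : IsFiniteMeasure (volume.restrict K) := ⟨by simpa using hc.measure_lt_top⟩
  exact Integrable.of_bound (hu.1.mono_measure (Measure.restrict_mono hK le_rfl)) C hC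

lemma setIntegral_mul_inner_gradient_eq (hUΩ : U ⊆ Ω)
    (h : ∀ᵐ y ∂volume.restrict U, v y = u y) (hφ : IsTest U φ) :
    ∫ x in Ω, u x * ⟪σ x, gradient φ x⟫ = ∫ x, v x * fderiv ℝ φ x (σ x) := by
  simp_rw [inner_gradient_eq]
  rw [integral_eq_setIntegral_of_isTest hUΩ hφ fun x hx => by simp [hx],
    ← integral_eq_setIntegral_of_isTest (Ω := U) subset_rfl hφ fun x hx => by simp [hx],
    ← integral_eq_setIntegral_of_isTest (Ω := U) subset_rfl hφ fun x hx => by simp [hx]]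
  exact integral_congr_ae (h.mono fun x hx => by simp only [hx])

lemma integral_mul_upperRep_eq {M : ℝ} (hU : IsOpen U) (hUU : U' ⊆ U) (hv : ∀ y, |v y| ≤ M)
    (h : ∀ᵐ y ∂volume.restrict U, v y = u y) (hφ : IsTest U' φ) :
    ∫ x, φ x * upperRep u x ∂μ = ∫ x, upperRep v x * φ x ∂μ.restrict U' := by
  rw [setIntegral_eq_integral_of_forall_compl_eq_zero
    fun x hx => by rw [hφ.zero_of_notMem hx, mul_zero]]
  refine integral_congr_ae (Eventually.of_forall fun x => ?_)
  by_cases hx : x ∈ U'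
  · simp only [upperRep_eq_of_ae_eq hU hv h (hUU hx), mul_comm]
  · simp only [hφ.zero_of_notMem hx, mul_zero, zero_mul]

lemma IsTest.exists_open_nested (hΩ : IsOpen Ω) (hφ : IsTest Ω φ) :
    ∃ U' U : Set (Eu n), IsOpen U' ∧ IsOpen U ∧ IsTest U' φ ∧ IsCompact (closure U') ∧
      closure U' ⊆ U ∧ IsCompact (closure U) ∧ closure U ⊆ Ω := by
  obtain ⟨U', ho', hs', hcΩ', hc'⟩ := exists_open_between_and_isCompact_closure hφ.2.1 hΩ hφ.2.2
  obtain ⟨U, ho, hs, hcΩ, hc⟩ := exists_open_between_and_isCompact_closure hc' hΩ hcΩ'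
  exact ⟨U', U, ho', ho, ⟨hφ.1, hφ.2.1, hs'⟩, hc', hs, hc, hcΩ⟩

lemma integrable_mul_upperRep (hΩ : IsOpen Ω) (hu : LocBddFun Ω u) (hν : LocFinOn Ω ν)
    (hg : HasGradMeasure Ω u ν θ) (hθ : Measurable θ) (hμ : LocFinOn Ω μ) (hφ : IsTest Ω φ) :
    Integrable (fun x => φ x * upperRep u x) μ := by
  obtain ⟨U', U, ho', ho, hφ', hc', hs, hc, hcΩ⟩ := hφ.exists_open_nested hΩ
  obtain ⟨v, hv, hvu⟩ := hg.exists_gradOn hΩ hu hν hθ ho hc hcΩ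
  obtain ⟨M, hM⟩ := hv.bdd
  have hUU : U' ⊆ U := subset_closure.trans hs
  have h1 : Integrable (fun x => upperRep v x * φ x) μ :=
    (hμ.integrable_isTest hφ).bdd_mul (c := M) (measurable_upperRep hv.meas hM).aestronglyMeasurable
      (Eventually.of_forall (abs_upperRep_le hM))
  refine h1.congr (Eventually.of_forall fun x => ?_)
  by_cases hx : x ∈ U'
  · simp only [upperRep_eq_of_ae_eq ho hM hvu (hUU hx), mul_comm]
  · simp only [hφ'.zero_of_notMem hx, mul_zero, zero_mul]

/-- The field in the definition of super-1-harmonicity can be taken measurable and bounded by one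
everywhere, and the polar vector measurable, at the cost of an inequality. -/
lemma SuperOneHarmonic.exists_measurable (hΩ : IsOpen Ω) (h : SuperOneHarmonic Ω u) :
    ∃ σ μ ν θ, Measurable σ ∧ (∀ x, ‖σ x‖ ≤ 1) ∧ RepNegDiv Ω σ μ 0 ∧ LocFinOn Ω μ ∧
      LocFinOn Ω ν ∧ Measurable θ ∧ HasGradMeasure Ω u ν θ ∧
      ∀ φ, IsTest Ω φ → (∀ x, 0 ≤ φ x) → ∫ x, φ x ∂ν ≤
        -(∫ x in Ω, u x * ⟪σ x, gradient φ x⟫) + ∫ x, φ x * upperRep u x ∂μ := by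
  obtain ⟨hbv, -, σ, μ, hσ, -, hd, hμ, ν, θ, hν, hg, hp⟩ := h
  obtain ⟨ν₀, θ₀, hle, hν₀, hθ₀, hg₀⟩ := hg.exists_measurable hΩ hbv.1 hν
  set w := hσ.1.mk σ with hw
  have hwm : Measurable w := hσ.1.stronglyMeasurable_mk.measurable
  set S := {x | ‖w x‖ ≤ 1} with hS
  have hSm : MeasurableSet S := measurableSet_le hwm.norm measurable_const
  have hae : ∀ᵐ x ∂volume.restrict Ω, S.indicator w x = σ x := by
    filter_upwards [hσ.1.ae_eq_mk, hσ.2] with x h1 h2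
    have hx : x ∈ S := show ‖w x‖ ≤ 1 by rwa [hw, ← h1]
    rw [indicator_of_mem hx, hw, ← h1]
  refine ⟨S.indicator w, μ, ν₀, θ₀, hwm.indicator hSm, fun x => ?_, fun φ hφ => ?_, hμ, hν₀, hθ₀,
    hg₀, fun φ hφ hφ0 => ?_⟩
  · by_cases hx : x ∈ S
    · rw [indicator_of_mem hx]; exact hx
    · simp [indicator_of_notMem hx]
  · rw [← hd φ hφ]
    exact integral_congr_ae (hae.mono fun x hx => by simp only [hx])
  · have h1 : ∫ x in Ω, u x * ⟪S.indicator w x, gradient φ x⟫ =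
        ∫ x in Ω, u x * ⟪σ x, gradient φ x⟫ :=
      integral_congr_ae (hae.mono fun x hx => by simp only [hx])
    rw [h1, hp φ hφ]
    exact integral_mono_measure hle (Eventually.of_forall hφ0) (hν.integrable_isTest hφ)

lemma exists_limit_negDiv (hΩ : IsOpen Ω) {σk : ℕ → Eu n → Eu n} {μk : ℕ → Measure (Eu n)}
    (hσ : ∀ k x, ‖σk k x‖ ≤ 1) (hμ : ∀ k, LocFinOn Ω (μk k)) (hd : ∀ k, RepNegDiv Ω (σk k) (μk k) 0)
    (hconv : ∀ φ, IsTest Ω φ → Tendsto (fun k => ∫ x in Ω, ⟪σk k x, gradient φ x⟫) atTop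
      (𝓝 (∫ x in Ω, ⟪σ x, gradient φ x⟫))) :
    ∃ μ, LocFinOn Ω μ ∧ RepNegDiv Ω σ μ 0 ∧
      ∀ φ, IsTest Ω φ → Tendsto (fun k => ∫ x, φ x ∂μk k) atTop (𝓝 (∫ x, φ x ∂μ)) := by
  have hd' : ∀ k φ, IsTest Ω φ → ∫ x in Ω, ⟪σk k x, gradient φ x⟫ = ∫ x, φ x ∂μk k := by
    intro k φ hφ
    rw [hd k φ hφ, integral_zero_measure, sub_zero]
  obtain ⟨μ, hμ', hlim⟩ := exists_locFinOn_limit hΩ (hyperfilter ℕ) μk fun K hK hKc => by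
    obtain ⟨η, hη, hη01, hη1⟩ := exists_isTest_one hKc hΩ hK
    refine ⟨(∫ x, ‖fderiv ℝ η x‖).toNNReal, Eventually.of_forall fun k => ?_⟩
    have hi := (hμ k).integrable_isTest hη
    have h1 : ∫ x, η x ∂μk k ≤ ∫ x, ‖fderiv ℝ η x‖ := by
      rw [← hd' k η hη, integral_eq_setIntegral_of_isTest subset_rfl hη fun x hx => by
        rw [inner_gradient_eq, hx]; rfl]
      refine (Real.le_norm_self _).trans
        (norm_integral_le_of_norm_le hη.integrable_fderiv.norm (Eventually.of_forall fun x => ?_))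
      rw [inner_gradient_eq]
      exact ((fderiv ℝ η x).le_opNorm _).trans
        (mul_le_of_le_one_right (norm_nonneg _) (hσ k x))
    calc μk k K = ∫⁻ x in K, 1 ∂μk k := by simp
      _ ≤ ∫⁻ x, ENNReal.ofReal (η x) ∂μk k := by
        rw [← lintegral_indicator hKc.measurableSet]
        refine lintegral_mono fun x => ?_
        by_cases hx : x ∈ K
        · simp [hx, hη1 x hx]
        · simp [hx]
      _ = ENNReal.ofReal (∫ x, η x ∂μk k) :=
        (ofReal_integral_eq_lintegral_ofReal hi (Eventually.of_forall fun x => (hη01 x).1)).symm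
      _ ≤ ENNReal.ofReal (∫ x, ‖fderiv ℝ η x‖) := ENNReal.ofReal_le_ofReal h1
  have hrep : ∀ φ, IsTest Ω φ → ∫ x in Ω, ⟪σ x, gradient φ x⟫ = ∫ x, φ x ∂μ := by
    intro φ hφ
    have h1 := (hconv φ hφ).mono_left (Nat.hyperfilter_le_atTop)
    simp_rw [hd' _ φ hφ] at h1
    exact tendsto_nhds_unique h1 (hlim φ hφ.continuous hφ.2.1 hφ.2.2)
  refine ⟨μ, hμ', fun φ hφ => by rw [hrep φ hφ, integral_zero_measure, sub_zero], fun φ hφ => ?_⟩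
  have h1 := hconv φ hφ
  simp_rw [hd' _ φ hφ, hrep φ hφ] at h1
  exact h1

lemma tendsto_integral_mul_sub (hc : IsCompact (closure U))
    {uk vk gk : ℕ → Eu n → ℝ} {C : ℝ} (hv : Measurable v) (hvb : ∃ M, ∀ x, |v x| ≤ M)
    (hvk : ∀ k, Measurable (vk k)) (hvkb : ∀ k, ∃ M, ∀ x, |vk k x| ≤ M)
    (hvu : ∀ᵐ x ∂volume.restrict U, v x = u x)
    (hvuk : ∀ k, ∀ᵐ x ∂volume.restrict U, vk k x = uk k x)
    (hi : ∀ k, IntegrableOn (fun x => uk k x - u x) (closure U))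
    (hL1 : Tendsto (fun k => ∫ x in closure U, |uk k x - u x|) atTop (𝓝 0))
    (hg : ∀ k, Measurable (gk k)) (hgC : ∀ k x, |gk k x| ≤ C) (hg0 : ∀ k, ∀ x ∉ U, gk k x = 0) :
    Tendsto (fun k => (∫ x, vk k x * gk k x) - ∫ x, v x * gk k x) atTop (𝓝 0) := by
  have hgi : ∀ k, Integrable (gk k) := fun k =>
    (integrableOn_iff_integrable_of_support_subset fun x hx => by
      by_contra h
      exact hx (hg0 k x fun h' => h (subset_closure h'))).1
      (Measure.integrableOn_of_bounded (M := C) hc.measure_lt_top.ne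
        (hg k).aestronglyMeasurable (Eventually.of_forall (hgC k)))
  have hmul : ∀ k (w : Eu n → ℝ), Measurable w → (∃ M, ∀ x, |w x| ≤ M) →
      Integrable fun x => w x * gk k x := fun k w hw ⟨M, hM⟩ =>
    (hgi k).bdd_mul (c := M) hw.aestronglyMeasurable (Eventually.of_forall hM)
  refine squeeze_zero_norm (a := fun k => C * ∫ x in closure U, |uk k x - u x|) (fun k => ?_)
    (by simpa using hL1.const_mul C)
  have hC : 0 ≤ C := (abs_nonneg _).trans (hgC 0 0)
  rw [← integral_sub (hmul k _ (hvk k) (hvkb k)) (hmul k _ hv hvb), ← integral_const_mul,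
    ← setIntegral_eq_integral_of_forall_compl_eq_zero (s := U) fun x hx => by
      rw [hg0 k x hx, mul_zero, mul_zero, sub_zero]]
  have hi' : IntegrableOn (fun x => C * |uk k x - u x|) (closure U) := (hi k).abs.const_mul C
  refine (norm_integral_le_of_norm_le (hi'.mono_set subset_closure) ?_).trans
    (setIntegral_mono_set hi' (Eventually.of_forall fun x => by positivity)
      (LE.le.eventuallyLE subset_closure))
  filter_upwards [hvu, hvuk k] with x h1 h2
  rw [← sub_mul, h1, h2, norm_mul, mul_comm]
  exact mul_le_mul_of_nonneg_right (hgC k x) (norm_nonneg _)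

/-- Stability of the pairing identity, tested against nonnegative functions. -/
lemma pairing_eq_of_nonneg (hΩ : IsOpen Ω) (hu : LocBddFun Ω u) (hν : LocFinOn Ω ν)
    (hg : HasGradMeasure Ω u ν θ) (hθ : Measurable θ) (hσ : Measurable σ) (hσ1 : ∀ x, ‖σ x‖ ≤ 1)
    (hμ : LocFinOn Ω μ) (hd : RepNegDiv Ω σ μ 0)
    {uk : ℕ → Eu n → ℝ} {νk μk : ℕ → Measure (Eu n)} {θk σk : ℕ → Eu n → Eu n}
    (huk : ∀ k, LocBddFun Ω (uk k)) (hνk : ∀ k, LocFinOn Ω (νk k))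
    (hgk : ∀ k, HasGradMeasure Ω (uk k) (νk k) (θk k)) (hθk : ∀ k, Measurable (θk k))
    (hσk : ∀ k, Measurable (σk k)) (hσk1 : ∀ k x, ‖σk k x‖ ≤ 1)
    (hμk : ∀ k, LocFinOn Ω (μk k)) (hdk : ∀ k, RepNegDiv Ω (σk k) (μk k) 0)
    (hweak : ∀ (Z : Eu n → Eu n) (C R : ℝ), AEStronglyMeasurable Z volume → (∀ᵐ x, ‖Z x‖ ≤ C) →
      (∀ x, R < ‖x‖ → Z x = 0) →
      Tendsto (fun k => ∫ x, ⟪σk k x, Z x⟫) atTop (𝓝 (∫ x, ⟪σ x, Z x⟫)))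
    (hconv : ∀ φ, IsTest Ω φ → Tendsto (fun k => ∫ x, φ x ∂μk k) atTop (𝓝 (∫ x, φ x ∂μ)))
    (hL1 : ∀ K ⊆ Ω, IsCompact K → Tendsto (fun k => ∫ x in K, |uk k x - u x|) atTop (𝓝 0))
    (hle : ∀ k, ∀ᵐ x ∂volume.restrict Ω, uk k x ≤ u x)
    (hineq : ∀ k φ, IsTest Ω φ → (∀ x, 0 ≤ φ x) → ∫ x, φ x ∂νk k ≤
      -(∫ x in Ω, uk k x * ⟪σk k x, gradient φ x⟫) + ∫ x, φ x * upperRep (uk k) x ∂μk k)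
    (hφ : IsTest Ω φ) (hφ0 : ∀ x, 0 ≤ φ x) :
    -(∫ x in Ω, u x * ⟪σ x, gradient φ x⟫) + ∫ x, φ x * upperRep u x ∂μ = ∫ x, φ x ∂ν := by
  obtain ⟨U', U, ho', ho, hφ', hc', hs, hc, hcΩ⟩ := hφ.exists_open_nested hΩ
  have hUU : U' ⊆ U := subset_closure.trans hs
  have hUΩ : U ⊆ Ω := subset_closure.trans hcΩ
  have hφU := hφ'.mono hUU
  obtain ⟨v, hv, hvu⟩ := hg.exists_gradOn hΩ hu hν hθ ho hc hcΩ
  obtain ⟨M, hM⟩ := hv.bdd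
  choose vk hvk hvuk using fun k => (hgk k).exists_gradOn hΩ (huk k) (hνk k) (hθk k) ho hc hcΩ
  have hL := hL1 _ hcΩ hc
  have hi : ∀ k, IntegrableOn (fun x => uk k x - u x) (closure U) := fun k =>
    ((huk k).integrableOn hcΩ hc).sub (hu.integrableOn hcΩ hc)
  have hc'Ω : closure U' ⊆ Ω := hs.trans hUΩ
  have hνφ : ∀ m : Measure (Eu n), ∫ x in U, φ x ∂m = ∫ x, φ x ∂m := fun m =>
    setIntegral_eq_integral_of_forall_compl_eq_zero fun x hx => hφU.zero_of_notMem hx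
  obtain ⟨C, -, hC⟩ := hφ.exists_bound_fderiv
  rw [setIntegral_mul_inner_gradient_eq hUΩ hvu hφU,
    integral_mul_upperRep_eq ho hUU hM hvu hφ', ← hνφ]
  refine hv.pairing_eq_of_tendsto hc' hs (hd.divOn hσ hσ1 hμ ho' hc' hc'Ω) hvk
    (fun k => (hdk k).divOn (hσk k) (hσk1 k) (hμk k) ho' hc' hc'Ω) (fun ψ hψ => ?_)
    (fun ψ hψ => ?_) (fun k => ?_) hφ' hφ0 ?_ fun k => ?_
  · have hm : ∀ m : Measure (Eu n), ∫ x in U', ψ x ∂m = ∫ x, ψ x ∂m := fun m =>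
      setIntegral_eq_integral_of_forall_compl_eq_zero fun x hx => hψ.zero_of_notMem hx
    simp_rw [hm]
    exact hconv ψ (hψ.mono (hUU.trans hUΩ))
  · obtain ⟨D, -, hD⟩ := hψ.exists_bound
    exact tendsto_sub_nhds_zero_iff.1 <| tendsto_integral_mul_sub hc (gk := fun _ => ψ) hv.meas
      hv.bdd (fun k => (hvk k).meas) (fun k => (hvk k).bdd) hvu hvuk hi hL
      (fun _ => hψ.continuous.measurable) (fun _ => hD) fun _ x hx => hψ.zero_of_notMem hx
  · filter_upwards [hvu, hvuk k, ae_restrict_of_ae_restrict_of_subset hUΩ (hle k)] with x h1 h2 h3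
    rwa [h1, h2]
  · have h1 := tendsto_integral_mul_sub hc (gk := fun k x => fderiv ℝ φ x (σk k x)) (C := C)
      hv.meas hv.bdd (fun k => (hvk k).meas) (fun k => (hvk k).bdd) hvu hvuk hi hL
      (fun k => by
        simp_rw [← inner_gradient_eq]
        exact (hσk k).inner ((InnerProductSpace.toDual ℝ (Eu n)).symm.continuous.comp
          hφ.continuous_fderiv).measurable)
      (fun k x => ((fderiv ℝ φ x).le_of_opNorm_le (hC x) _).trans
        (mul_le_of_le_one_right ((norm_nonneg _).trans (hC x)) (hσk1 k x)))
      fun k x hx => by rw [hφU.fderiv_zero_of_notMem hx]; rfl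
    obtain ⟨R, hR⟩ := hφ.2.1.isBounded.exists_norm_le
    have h2 := hweak (fun x => v x • gradient φ x) (M * C) R
      (hv.meas.smul ((InnerProductSpace.toDual ℝ (Eu n)).symm.continuous.comp
          hφ.continuous_fderiv).measurable).aestronglyMeasurable
      (Eventually.of_forall fun x => by
        rw [norm_smul]
        exact mul_le_mul (hM x) (((InnerProductSpace.toDual ℝ (Eu n)).symm.norm_map _).trans_le
          (hC x)) (norm_nonneg _) ((abs_nonneg _).trans (hM x)))
      fun x hx => by
        rw [gradient, fderiv_of_notMem_tsupport ℝ fun h => (hR x h).not_gt hx, map_zero, smul_zero]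
    simp_rw [real_inner_smul_right, inner_gradient_eq] at h2
    simpa using h1.add h2
  · rw [hνφ, ← setIntegral_mul_inner_gradient_eq hUΩ (hvuk k) hφU]
    obtain ⟨M', hM'⟩ := (hvk k).bdd
    rw [← integral_mul_upperRep_eq ho hUU hM' (hvuk k) hφ']
    exact hineq k φ hφ hφ0

lemma IsTest.integrableOn_mul_inner_gradient (hφ : IsTest Ω φ) (hΩ : IsOpen Ω)
    (hu : LocBddFun Ω u) (hσ : Measurable σ) (hσ1 : ∀ x, ‖σ x‖ ≤ 1) :
    IntegrableOn (fun x => u x * ⟪σ x, gradient φ x⟫) Ω := by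
  obtain ⟨C, -, hC⟩ := hφ.exists_bound_fderiv
  have h1 : IntegrableOn (fun x => u x * ⟪σ x, gradient φ x⟫) (tsupport φ) :=
    (hu.integrableOn hφ.2.2 hφ.2.1).mul_bdd (c := C)
      (hσ.inner ((InnerProductSpace.toDual ℝ (Eu n)).symm.continuous.comp
        hφ.continuous_fderiv).measurable).aestronglyMeasurable
      (Eventually.of_forall fun x => by
        rw [inner_gradient_eq]
        exact ((fderiv ℝ φ x).le_of_opNorm_le (hC x) _).trans
          (mul_le_of_le_one_right ((norm_nonneg _).trans (hC x)) (hσ1 x)))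
  refine h1.of_forall_sdiff_eq_zero hΩ.measurableSet fun x hx => ?_
  rw [inner_gradient_eq, fderiv_of_notMem_tsupport ℝ hx.2, _root_.zero_apply, mul_zero]

/-- Linearity extends an identity between pairings from nonnegative to arbitrary test functions. -/
lemma pairing_eq_of_forall_nonneg (hΩ : IsOpen Ω) (hu : LocBddFun Ω u) (hν : LocFinOn Ω ν)
    (hg : HasGradMeasure Ω u ν θ) (hθ : Measurable θ) (hσ : Measurable σ) (hσ1 : ∀ x, ‖σ x‖ ≤ 1)
    (hμ : LocFinOn Ω μ)
    (h : ∀ φ, IsTest Ω φ → (∀ x, 0 ≤ φ x) →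
      -(∫ x in Ω, u x * ⟪σ x, gradient φ x⟫) + ∫ x, φ x * upperRep u x ∂μ = ∫ x, φ x ∂ν)
    (hφ : IsTest Ω φ) :
    -(∫ x in Ω, u x * ⟪σ x, gradient φ x⟫) + ∫ x, φ x * upperRep u x ∂μ = ∫ x, φ x ∂ν := by
  obtain ⟨C, hC0, hC⟩ := hφ.exists_bound
  obtain ⟨η, hη, hη01, hη1⟩ := exists_isTest_one hφ.2.1 hΩ hφ.2.2
  have hψ := hη.const_mul C
  have h1 := h _ hψ fun x => mul_nonneg hC0 (hη01 x).1
  have h2 := h _ (hφ.add hψ) fun x => by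
    by_cases hx : x ∈ tsupport φ
    · rw [hη1 x hx]
      linarith [neg_le_of_abs_le (hC x)]
    · rw [image_eq_zero_of_notMem_tsupport hx, zero_add]
      exact mul_nonneg hC0 (hη01 x).1
  have h3 : ∀ x, u x * ⟪σ x, gradient (fun y => φ y + C * η y) x⟫ =
      u x * ⟪σ x, gradient φ x⟫ + u x * ⟪σ x, gradient (fun y => C * η y) x⟫ := fun x => by
    simp_rw [inner_gradient_eq]
    rw [fderiv_fun_add (hφ.differentiable x) (hψ.differentiable x), ← mul_add]
    rfl
  simp_rw [h3, add_mul] at h2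
  rw [integral_add (hφ.integrableOn_mul_inner_gradient hΩ hu hσ hσ1)
      (hψ.integrableOn_mul_inner_gradient hΩ hu hσ hσ1),
    integral_add (integrable_mul_upperRep hΩ hu hν hg hθ hμ hφ)
      (integrable_mul_upperRep hΩ hu hν hg hθ hμ hψ),
    integral_add (hν.integrable_isTest hφ) (hν.integrable_isTest hψ)] at h2
  linarith

end Assembly

/-- convergence from below preserves super-1-harmonicity:
if weakly super-1-harmonic `u_k` converge to `u` locally weakly* in `BV_loc(Ω)`
(i.e. strongly in `L^1_loc` together with weak* convergence of the gradient measures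
`Du_k = θ_k ν_k` to `Du = θ ν`) and in `L^∞_loc(Ω)`, with `u_k ≤ u` a.e., then `u` is
weakly super-1-harmonic on `Ω`. -/
theorem stmt9 {n : ℕ} (Ω : Set (Eu n)) (hΩ : IsOpen Ω)
    (uk : ℕ → Eu n → ℝ) (u : Eu n → ℝ)
    (hsup : ∀ k, SuperOneHarmonic Ω (uk k))
    (hu : MemBVLoc Ω u) (hub : LocBddFun Ω u)
    (νk : ℕ → Measure (Eu n)) (θk : ℕ → Eu n → Eu n)
    (hgradk : ∀ k, LocFinOn Ω (νk k) ∧ HasGradMeasure Ω (uk k) (νk k) (θk k))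
    (ν : Measure (Eu n)) (θ : Eu n → Eu n)
    (hgrad : LocFinOn Ω ν ∧ HasGradMeasure Ω u ν θ)
    -- strong convergence in `L^1_loc(Ω)`
    (hL1 : ∀ K : Set (Eu n), K ⊆ Ω → IsCompact K →
      Tendsto (fun k => ∫ x in K, |uk k x - u x|) atTop (𝓝 0))
    -- weak* convergence of the gradient measures on `Ω`
    (hDu : ∀ φ : Eu n → ℝ, Continuous φ → HasCompactSupport φ → tsupport φ ⊆ Ω →
      Tendsto (fun k => ∫ x, φ x • θk k x ∂(νk k)) atTop (𝓝 (∫ x, φ x • θ x ∂ν)))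
    -- local weak* convergence in `L^∞_loc(Ω)`
    (hLinf : ∀ g : Eu n → ℝ, Integrable g (volume.restrict Ω) → HasCompactSupport g →
      tsupport g ⊆ Ω →
      Tendsto (fun k => ∫ x in Ω, uk k x * g x) atTop (𝓝 (∫ x in Ω, u x * g x)))
    (hle : ∀ k, ∀ᵐ x ∂(volume.restrict Ω), uk k x ≤ u x) :
    SuperOneHarmonic Ω u := by
  choose σk μk νk' θk' hσk hσk1 hdk hμk hνk hθk hgk hineq using fun k =>
    (hsup k).exists_measurable hΩ
  obtain ⟨ν₀, θ₀, -, hν₀, hθ₀, hg₀⟩ := hgrad.2.exists_measurable hΩ hu.1 hgrad.1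
  obtain ⟨σ, s, hs, hσ, hσ1, hweak⟩ := exists_weak_limit_field hσk hσk1
  have hconv : ∀ φ, IsTest Ω φ → Tendsto (fun k => ∫ x in Ω, ⟪σk (s k) x, gradient φ x⟫) atTop
      (𝓝 (∫ x in Ω, ⟪σ x, gradient φ x⟫)) := by
    intro φ hφ
    obtain ⟨C, -, hC⟩ := hφ.exists_bound_fderiv
    obtain ⟨R, hR⟩ := hφ.2.1.isBounded.exists_norm_le
    have h0 : ∀ τ : Eu n → Eu n, ∫ x in Ω, ⟪τ x, gradient φ x⟫ = ∫ x, ⟪τ x, gradient φ x⟫ :=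
      fun τ => integral_eq_setIntegral_of_isTest subset_rfl hφ fun x hx => by
        rw [inner_gradient_eq, hx]; rfl
    simp_rw [h0]
    exact hweak _ C R ((InnerProductSpace.toDual ℝ (Eu n)).symm.continuous.comp
        hφ.continuous_fderiv).aestronglyMeasurable
      (Eventually.of_forall fun x =>
        ((InnerProductSpace.toDual ℝ (Eu n)).symm.norm_map _).trans_le (hC x))
      fun x hx => by
        rw [gradient, fderiv_of_notMem_tsupport ℝ fun h => (hR x h).not_gt hx, map_zero]
  obtain ⟨μ, hμ, hd, hμconv⟩ := exists_limit_negDiv hΩ (fun k => hσk1 (s k)) (fun k => hμk (s k))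
    (fun k => hdk (s k)) hconv
  refine ⟨hu, hub, σ, μ, ⟨hσ.aestronglyMeasurable, Eventually.of_forall hσ1⟩, fun φ hφ hφ0 => ?_,
    hd, hμ, ν₀, θ₀, hν₀, hg₀, fun φ hφ => ?_⟩
  · rw [hd φ hφ, integral_zero_measure, sub_zero]
    exact integral_nonneg hφ0
  · refine pairing_eq_of_forall_nonneg hΩ hub hν₀ hg₀ hθ₀ hσ hσ1 hμ (fun ψ hψ hψ0 => ?_) hφ
    exact pairing_eq_of_nonneg hΩ hub hν₀ hg₀ hθ₀ hσ hσ1 hμ hd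
      (fun k => (hsup (s k)).2.1) (fun k => hνk (s k)) (fun k => hgk (s k)) (fun k => hθk (s k))
      (fun k => hσk (s k)) (fun k => hσk1 (s k)) (fun k => hμk (s k)) (fun k => hdk (s k)) hweak
      hμconv (fun K hK hKc => (hL1 K hK hKc).comp hs.tendsto_atTop) (fun k => hle (s k))
      (fun k => hineq (s k)) hψ hψ0
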